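/- Let $p_1 \ge \dots \ge p_\sigma \ge 1$ with $\sigma = 2\tau$ even, $p_1 + \dots + p_\sigma = n$, $\bar p$ the conjugate partition, $k = p_1$, and assume $\bar p_1 = \sigma$ is even. Then $j_{S_{\bar p_k} \times \dots \times S_{\bar p_2} \times W'_{\bar p_1/2} \times W'_{\bar p_1/2}}^{W'_n}(\mathrm{sgn}) = [(p_{\sigma-1}+1 < p_{\sigma-3}+2 < \dots < p_1+\tau), (p_\sigma - 1 < p_{\sigma-2} < \dots < p_4+\tau-3 < p_2+\tau-2)]$. -/

import Mathlib

open Finset Equiv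

namespace CS

noncomputable section

/-- Inner product of class functions on a finite group. -/
def cinner {G : Type} [Group G] (φ ψ : G → ℂ) : ℂ :=
  (Nat.card G : ℂ)⁻¹ * ∑ᶠ g : G, φ g * ψ g⁻¹

/-- The character of the `d`-th symmetric power of a representation with character
`χ`, computed via Newton's recursion
`d·χ_{Sym^d}(g) = ∑_{k=1}^{d} χ(g^k) χ_{Sym^{d-k}}(g)`. -/
def symChar {G : Type} [Group G] (χ : G → ℂ) : ℕ → G → ℂ
  | 0, _ => 1
  | (d+1), g => ((d : ℂ) + 1)⁻¹ *
      ∑ k ∈ Finset.range (d + 1), χ (g ^ (k + 1)) * symChar χ (d - k) g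
  termination_by d _ => d
  decreasing_by omega

/-- Induction of class functions from a subgroup `H` to a subgroup `K` (of an ambient
group `G`), by the usual induced-character formula. -/
def indChar {G : Type} [Group G] (H K : Subgroup G) (φ : H → ℂ) : K → ℂ :=
  open scoped Classical in
  fun g => (Nat.card H : ℂ)⁻¹ *
    ∑ᶠ x : K, if h : ((x : G) * g * (x : G)⁻¹) ∈ H then φ ⟨_, h⟩ else 0

/-- Restriction of a class function on the ambient group to a subgroup. -/
def resChar {G : Type} [Group G] (H : Subgroup G) (χ : G → ℂ) : H → ℂ :=
  fun h => χ h

/-- Restriction of a class function from a subgroup `K` to a subgroup `H` (junk value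
`0` off `K`; meaningful when `H ≤ K`). -/
def resSub {G : Type} [Group G] (H K : Subgroup G) (χ : K → ℂ) : H → ℂ :=
  open scoped Classical in
  fun h => if hh : (h : G) ∈ K then χ ⟨_, hh⟩ else 0

/-- `χ` is the character of a (finite-dimensional, complex) representation. -/
def IsChar {G : Type} [Group G] (χ : G → ℂ) : Prop :=
  ∃ (V : Type) (_ : AddCommGroup V) (_ : Module ℂ V) (ρ : Representation ℂ G V),
    FiniteDimensional ℂ V ∧ ∀ g, χ g = LinearMap.trace ℂ V (ρ g)

/-- `χ` is an irreducible character: a genuine character of norm one. -/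
def IsIrrChar {G : Type} [Group G] (χ : G → ℂ) : Prop :=
  IsChar χ ∧ cinner χ χ = 1

/-- Multiplicity of `χE` in the `d`-th symmetric power of the reflection
representation (with character `χR`). -/
def bMult {G : Type} [Group G] (χR χE : G → ℂ) (d : ℕ) : ℂ :=
  cinner χE (symChar χR d)

/-- `b` is the `b`-invariant of `χE`: the least degree of the symmetric algebra of
the reflection representation containing `χE`. -/
def IsBAt {G : Type} [Group G] (χR χE : G → ℂ) (b : ℕ) : Prop :=
  bMult χR χE b ≠ 0 ∧ ∀ d < b, bMult χR χE d = 0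

/-- `χE = j_H^K (χE')` (GP 5.2.6): `χE` is an irreducible character of `K` occurring
in the induction of `χE'` from `H`, with the same `b`-invariant as `χE'`, where `χE'`
occurs with multiplicity one in the corresponding symmetric power for `H`; the
reflection characters of `H` and `K` are the restrictions of the ambient reflection
character `χR`. -/
def IsJInd {G : Type} [Group G] (χR : G → ℂ) (H K : Subgroup G)
    (χE' : H → ℂ) (χE : K → ℂ) : Prop :=
  IsIrrChar χE ∧ cinner χE (indChar H K χE') ≠ 0 ∧
  ∃ b, IsBAt (resChar H χR) χE' b ∧ bMult (resChar H χR) χE' b = 1 ∧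
    IsBAt (resChar K χR) χE b

/-! ### The hyperoctahedral group and its reflection subgroups.

We realize `W_n` (type `B_n/C_n`) as the permutations of `Fin n ⊕ Fin n`
(thought of as `{1,…,n} ⊔ {-1,…,-n}`) generated by the reflections below; `W'_n`
(type `D_n`) and the various reflection subgroups are likewise generated by the
appropriate reflections. -/

/-- Ambient permutation group of the `2n` points. -/
abbrev PG (n : ℕ) := Equiv.Perm (Fin n ⊕ Fin n)

/-- The reflection-representation matrix of a signed permutation. -/
def Mrefl {n : ℕ} (π : PG n) : Matrix (Fin n) (Fin n) ℂ :=
  Matrix.of fun j i =>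
    (if π (Sum.inl i) = Sum.inl j then 1 else 0) -
      (if π (Sum.inl i) = Sum.inr j then 1 else 0)

/-- The character of the reflection representation (on signed permutations). -/
def reflChar {n : ℕ} : PG n → ℂ := fun π => (Mrefl π).trace

/-- The sign (determinant) character of the reflection representation. -/
def sgnChar {n : ℕ} : PG n → ℂ := fun π => (Mrefl π).det

/-- The reflection `(e_i ↔ e_j)` (a double transposition). -/
def dsw {n : ℕ} (i j : Fin n) : PG n :=
  Equiv.swap (Sum.inl i) (Sum.inl j) * Equiv.swap (Sum.inr i) (Sum.inr j)

/-- The reflection `e_i ↦ -e_i` (a sign change). -/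
def ssw {n : ℕ} (i : Fin n) : PG n := Equiv.swap (Sum.inl i) (Sum.inr i)

/-- The reflection `e_i ↦ -e_j, e_j ↦ -e_i`. -/
def msw {n : ℕ} (i j : Fin n) : PG n :=
  Equiv.swap (Sum.inl i) (Sum.inr j) * Equiv.swap (Sum.inr i) (Sum.inl j)

/-- Types of blocks: symmetric group (`A`-type), hyperoctahedral (`B`-type),
even-signed (`D`-type). -/
inductive BTy | S | B | D
deriving DecidableEq

/-- The reflection subgroup of `W_n` determined by a block structure: `f` assigns to
each index its block, `ty` the type of each index.  On an `S`-block only the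
transpositions `dsw` act, on a `B`-block also the sign changes, on a `D`-block the
`dsw` and the `msw`.  (`W_{m₁} × … `-style products of reflection subgroups.) -/
def blkSub (n : ℕ) (f : Fin n → ℕ) (ty : Fin n → BTy) : Subgroup (PG n) :=
  Subgroup.closure
    ({π | ∃ i j, f i = f j ∧ π = dsw i j} ∪
     {π | ∃ i, ty i = BTy.B ∧ π = ssw i} ∪
     {π | ∃ i j, f i = f j ∧ ty i = BTy.D ∧ ty j = BTy.D ∧ π = msw i j})

/-- The hyperoctahedral group `W_n` (Weyl group of type `B_n/C_n`). -/
def BWn (n : ℕ) : Subgroup (PG n) := blkSub n (fun _ => 0) (fun _ => BTy.B)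

/-- The Weyl group `W'_n` of type `D_n` (the even elements of `W_n`). -/
def DWn (n : ℕ) : Subgroup (PG n) := blkSub n (fun _ => 0) (fun _ => BTy.D)

/-- The block of the index `i`, for blocks of consecutive sizes `c 0, c 1, …`
(`N` blocks in total). -/
def blockOf (N : ℕ) (c : ℕ → ℕ) (i : ℕ) : ℕ :=
  ((Finset.range N).filter fun b => ∑ b' ∈ Finset.range (b + 1), c b' ≤ i).card

/-- The linear character of (a reflection subgroup of) `W_n` given by the product of
the signs of the coordinates in `T`. -/
def epsOn {n : ℕ} (T : Set (Fin n)) : PG n → ℂ :=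
  open scoped Classical in
  fun π => ∏ᶠ i : Fin n, if i ∈ T ∧ (∃ j, π (Sum.inl i) = Sum.inr j) then -1 else 1

/-- The basic induced character of `W_n` attached to two sequences of (possibly
negative, in which case the character is `0`) block sizes: the character induced from
the product of the hyperoctahedral groups of the blocks, of the (trivial) ⊠ (product
of signs of coordinates) character, the second family of blocks carrying the
sign-of-coordinates character.  (These are the `h`-pieces of the Jacobi–Trudi-type
formula for the irreducible characters of `W_n`.) -/
def indPiece (n r s : ℕ) (c : Fin r → ℤ) (d : Fin s → ℤ) : (BWn n) → ℂ :=
  open scoped Classical in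
  if (∀ i, 0 ≤ c i) ∧ (∀ j, 0 ≤ d j) ∧ ((∑ i, c i) + ∑ j, d j) = (n : ℤ) then
    letI cs : ℕ → ℕ := fun b =>
      if hb : b < r then (c ⟨b, hb⟩).toNat
      else if hb' : b - r < s then (d ⟨b - r, hb'⟩).toNat else 0
    letI f : Fin n → ℕ := fun i => blockOf (r + s) cs (i : ℕ)
    indChar (blkSub n f (fun _ => BTy.B)) (BWn n)
      (resChar _ (epsOn {i | r ≤ f i}))
  else 0

/-- The irreducible character of the hyperoctahedral group `W_n` attached to a
bipartition `(α, β)` (each written as a weakly decreasing integer vector), via the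
Jacobi–Trudi-type determinantal formula
`χ_{(α,β)} = ∑_{σ,τ} sgn(σ)sgn(τ) · indPiece((αᵢ - i + σ(i))ᵢ, (βⱼ - j + τ(j))ⱼ)`. -/
def chiB (n r s : ℕ) (α : Fin r → ℤ) (β : Fin s → ℤ) : (BWn n) → ℂ :=
  fun w => ∑ᶠ σ : Equiv.Perm (Fin r), ∑ᶠ τ : Equiv.Perm (Fin s),
    (((Equiv.Perm.sign σ : ℤ) * (Equiv.Perm.sign τ : ℤ) : ℤ) : ℂ) *
      indPiece n r s (fun i => α i - (i : ℕ) + ((σ i : ℕ) : ℤ))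
        (fun j => β j - (j : ℕ) + ((τ j : ℕ) : ℤ)) w

/-- The irreducible character of `W_n` attached to a symbol
`[(λ₀ < … < λ_m), (μ₀ < … < μ_{m-1})]` (rows written as increasing sequences, with
`∑λ + ∑μ = m² + n`): subtract the staircases to get the bipartition. -/
def chiBSymbol (n m : ℕ) (row1 : Fin (m + 1) → ℕ) (row2 : Fin m → ℕ) : (BWn n) → ℂ :=
  chiB n (m + 1) m
    (fun i => (row1 ⟨m - (i : ℕ), by have := i.isLt; omega⟩ : ℤ) - ((m - (i : ℕ) : ℕ) : ℤ))
    (fun j => (row2 ⟨m - 1 - (j : ℕ), by have := j.isLt; omega⟩ : ℤ) -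
      ((m - 1 - (j : ℕ) : ℕ) : ℤ))

/-- The irreducible character of `W'_n` (type `D_n`) attached to a symbol
`[(λ₀ < … < λ_{m-1}), (μ₀ < … < μ_{m-1})]` with distinct rows (`∑λ + ∑μ = m² - m + n`):
the restriction to `W'_n` of the corresponding character of `W_n`. -/
def chiDSymbol (n m : ℕ) (row1 row2 : Fin m → ℕ) : (DWn n) → ℂ :=
  resSub (DWn n) (BWn n)
    (chiB n m m
      (fun i => (row1 ⟨m - 1 - (i : ℕ), by have := i.isLt; omega⟩ : ℤ) -
        ((m - 1 - (i : ℕ) : ℕ) : ℤ))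
      (fun j => (row2 ⟨m - 1 - (j : ℕ), by have := j.isLt; omega⟩ : ℤ) -
        ((m - 1 - (j : ℕ) : ℕ) : ℤ)))

section RepresentationTheory

open Representation Module

variable {G : Type} [Group G]

theorem cinner_eq_sum [Fintype G] (φ ψ : G → ℂ) :
    cinner φ ψ = (Nat.card G : ℂ)⁻¹ * ∑ g : G, φ g * ψ g⁻¹ := by
  rw [cinner, finsum_eq_sum_of_fintype]

theorem cinner_comm [Finite G] (φ ψ : G → ℂ) : cinner φ ψ = cinner ψ φ := by
  have := Fintype.ofFinite G
  rw [cinner_eq_sum, cinner_eq_sum]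
  congr 1
  refine Fintype.sum_equiv (Equiv.inv G) _ _ fun g => ?_
  simp [mul_comm]

theorem cinner_add_left [Finite G] (φ φ' ψ : G → ℂ) :
    cinner (φ + φ') ψ = cinner φ ψ + cinner φ' ψ := by
  have := Fintype.ofFinite G
  simp [cinner_eq_sum, add_mul, Finset.sum_add_distrib, mul_add]

theorem cinner_smul_left [Finite G] (c : ℂ) (φ ψ : G → ℂ) : cinner (c • φ) ψ = c * cinner φ ψ := by
  have := Fintype.ofFinite G
  simp only [cinner_eq_sum, Pi.smul_apply, smul_eq_mul, mul_assoc, ← Finset.mul_sum]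
  ring

theorem cinner_neg_left [Finite G] (φ ψ : G → ℂ) : cinner (-φ) ψ = - cinner φ ψ := by
  simpa using cinner_smul_left (-1) φ ψ

theorem cinner_sub_left [Finite G] (φ φ' ψ : G → ℂ) :
    cinner (φ - φ') ψ = cinner φ ψ - cinner φ' ψ := by
  rw [sub_eq_add_neg, cinner_add_left, cinner_neg_left, sub_eq_add_neg]

theorem cinner_add_right [Finite G] (φ ψ ψ' : G → ℂ) :
    cinner φ (ψ + ψ') = cinner φ ψ + cinner φ ψ' := by
  rw [cinner_comm, cinner_add_left, cinner_comm ψ, cinner_comm ψ']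

theorem cinner_sub_right [Finite G] (φ ψ ψ' : G → ℂ) :
    cinner φ (ψ - ψ') = cinner φ ψ - cinner φ ψ' := by
  rw [cinner_comm, cinner_sub_left, cinner_comm ψ, cinner_comm ψ']

theorem cinner_neg_right [Finite G] (φ ψ : G → ℂ) : cinner φ (-ψ) = - cinner φ ψ := by
  rw [cinner_comm, cinner_neg_left, cinner_comm ψ]

theorem cinner_sum_left [Finite G] {ι : Type*} (s : Finset ι) (φ : ι → G → ℂ) (ψ : G → ℂ) :
    cinner (∑ i ∈ s, φ i) ψ = ∑ i ∈ s, cinner (φ i) ψ := by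
  classical
  induction s using Finset.induction_on with
  | empty => simpa using cinner_smul_left 0 (0 : G → ℂ) ψ
  | insert i s hi ih => rw [Finset.sum_insert hi, Finset.sum_insert hi, cinner_add_left, ih]

variable {V W : Type} [AddCommGroup V] [Module ℂ V] [FiniteDimensional ℂ V]
  [AddCommGroup W] [Module ℂ W] [FiniteDimensional ℂ W]

theorem cinner_character [Finite G] (ρ : Representation ℂ G V) (σ : Representation ℂ G W) :
    cinner σ.character ρ.character = finrank ℂ (IntertwiningMap ρ σ) := by
  have := Fintype.ofFinite G
  have : Invertible (Nat.card G : ℂ) := invertibleOfNonzero (by exact_mod_cast Nat.card_pos.ne')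
  rw [cinner_eq_sum, card_inv_mul_sum_char_mul_char_eq_finrank]

theorem finite_intertwiningMap (ρ : Representation ℂ G V) (σ : Representation ℂ G W) :
    Module.Finite ℂ (IntertwiningMap ρ σ) :=
  Module.Finite.equiv (invariantsEquivIntertwiningMap ρ σ)

theorem exists_intertwiningMap_ne_zero [Finite G] {ρ : Representation ℂ G V}
    {σ : Representation ℂ G W}
    (h : cinner σ.character ρ.character ≠ 0) : ∃ f : IntertwiningMap ρ σ, f ≠ 0 := by
  by_contra! hf
  have : Subsingleton (IntertwiningMap ρ σ) := ⟨fun a b => by rw [hf a, hf b]⟩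
  exact h (by rw [cinner_character, finrank_zero_of_subsingleton, Nat.cast_zero])

theorem cinner_character_ne_zero [Finite G] {ρ : Representation ℂ G V} {σ : Representation ℂ G W}
    {f : IntertwiningMap ρ σ} (hf : f ≠ 0) : cinner σ.character ρ.character ≠ 0 := by
  have := finite_intertwiningMap ρ σ
  have : Nontrivial (IntertwiningMap ρ σ) := ⟨f, 0, hf⟩
  rw [cinner_character]
  exact_mod_cast finrank_pos.ne'

theorem subsingleton_of_finrank_end_eq_zero [Finite G] (ρ : Representation ℂ G V)
    (h : finrank ℂ (IntertwiningMap ρ ρ) = 0) : Subsingleton V := by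
  by_contra hV
  rw [not_subsingleton_iff_nontrivial] at hV
  obtain ⟨v, hv⟩ := exists_ne (0 : V)
  have hid : IntertwiningMap.id ρ ≠ 0 := fun h0 => hv (by
    simpa using congrArg (fun f : IntertwiningMap ρ ρ => f v) h0)
  exact cinner_character_ne_zero hid (by rw [cinner_character, h, Nat.cast_zero])

theorem character_of_isCompl {ρ : Representation ℂ G V} {A B : Subrepresentation ρ}
    (h : IsCompl A B) :
    ρ.character = A.toRepresentation.character + B.toRepresentation.character := by
  have h' : IsCompl A.toSubmodule B.toSubmodule := by
    refine ⟨disjoint_iff.2 ?_, codisjoint_iff.2 ?_⟩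
    · exact congrArg Subrepresentation.toSubmodule (disjoint_iff.1 h.1)
    · exact congrArg Subrepresentation.toSubmodule (codisjoint_iff.1 h.2)
  ext g
  have hinternal : DirectSum.IsInternal
      (fun b : Bool => bif b then A.toSubmodule else B.toSubmodule) :=
    (DirectSum.isInternal_submodule_iff_isCompl _ (i := true) (j := false) (by simp)
      (by ext b; cases b <;> simp)).2 h'
  have hmaps : ∀ b : Bool, Set.MapsTo (ρ g) ((fun b : Bool => bif b then A.toSubmodule
      else B.toSubmodule) b) ((fun b : Bool => bif b then A.toSubmodule else B.toSubmodule) b) := by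
    rintro (_ | _)
    · exact B.apply_mem_toSubmodule g
    · exact A.apply_mem_toSubmodule g
  have := LinearMap.trace_eq_sum_trace_restrict hinternal hmaps
  rw [Fintype.sum_bool] at this
  exact this

theorem isIrreducible_of_cinner_self_eq_one [Finite G] (ρ : Representation ℂ G V)
    (h : cinner ρ.character ρ.character = 1) : IsIrreducible ρ := by
  have : NeZero (Nat.card G : ℂ) := ⟨by exact_mod_cast Nat.card_pos.ne'⟩
  have hsub : ∀ A : Subrepresentation ρ, Subsingleton A.toSubmodule → A = ⊥ := by
    intro A hA
    apply Subrepresentation.toSubmodule_injective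
    exact (Submodule.eq_bot_iff _).2 fun x hx => congrArg Subtype.val
      (hA.elim ⟨x, hx⟩ ⟨0, A.toSubmodule.zero_mem⟩)
  have hnt : Nontrivial (Subrepresentation ρ) := by
    refine ⟨⊥, ⊤, fun hbt => ?_⟩
    have hbt' : (⊥ : Submodule ℂ V) = ⊤ := congrArg Subrepresentation.toSubmodule hbt
    have : Subsingleton V := (Submodule.subsingleton_iff ℂ).1 (subsingleton_of_bot_eq_top hbt')
    obtain ⟨f, hf⟩ := exists_intertwiningMap_ne_zero (ρ := ρ) (σ := ρ) (by rw [h]; norm_num)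
    exact hf (by ext v; exact Subsingleton.elim _ _)
  refine ⟨fun A => ?_⟩
  obtain ⟨B, hB⟩ := exists_isCompl A
  rw [character_of_isCompl hB, cinner_add_left, cinner_add_right, cinner_add_right,
    cinner_character, cinner_character, cinner_character, cinner_character] at h
  norm_cast at h
  rcases Nat.eq_zero_or_pos (finrank ℂ (IntertwiningMap A.toRepresentation A.toRepresentation))
    with hA | hA
  · exact Or.inl (hsub _ (subsingleton_of_finrank_end_eq_zero _ hA))
  · right
    have hB0 : B = ⊥ := hsub _ (subsingleton_of_finrank_end_eq_zero B.toRepresentation (by omega))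
    subst hB0
    simpa using hB.sup_eq_top

/-- A difference of two characters that has norm one is, up to sign, an irreducible character. -/
theorem exists_irreducible_of_virtual [Finite G] (N : ℕ) :
    ∀ (V W : Type) [AddCommGroup V] [Module ℂ V]
    [FiniteDimensional ℂ V] [AddCommGroup W] [Module ℂ W] [FiniteDimensional ℂ W]
    (ρ : Representation ℂ G V) (σ : Representation ℂ G W),
    finrank ℂ V + finrank ℂ W ≤ N →
    cinner (ρ.character - σ.character) (ρ.character - σ.character) = 1 →
    ∃ (U : Type) (_ : AddCommGroup U) (_ : Module ℂ U) (_ : FiniteDimensional ℂ U)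
      (π : Representation ℂ G U), IsIrreducible π ∧ cinner π.character π.character = 1 ∧
        (ρ.character - σ.character = π.character ∨
          ρ.character - σ.character = - π.character) := by
  have : NeZero (Nat.card G : ℂ) := ⟨by exact_mod_cast Nat.card_pos.ne'⟩
  induction N with
  | zero =>
    intro V W _ _ _ _ _ _ ρ σ hN h
    have hV : Subsingleton V := finrank_zero_iff.1 (by omega : finrank ℂ V = 0)
    have hW : Subsingleton W := finrank_zero_iff.1 (by omega : finrank ℂ W = 0)
    have h1 : ρ.character = 0 := by
      ext g; simp [character, Subsingleton.elim (ρ g) 0]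
    have h2 : σ.character = 0 := by
      ext g; simp [character, Subsingleton.elim (σ g) 0]
    rw [h1, h2] at h
    simp [cinner] at h
  | succ N ih =>
    intro V W _ _ _ _ _ _ ρ σ hN h
    by_cases hf : ∃ f : IntertwiningMap ρ σ, f ≠ 0
    · obtain ⟨f, hf⟩ := hf
      obtain ⟨V₁, hV₁⟩ := exists_isCompl f.ker
      obtain ⟨W₁, hW₁⟩ := exists_isCompl f.range
      have hiso : V₁.toRepresentation.character = f.range.toRepresentation.character := by
        have hbij : Function.Bijective
            ((f.toLinearMap.comp V₁.toSubmodule.subtype).codRestrict f.range.toSubmodule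
              (fun v => ⟨v, rfl⟩)) := by
          constructor
          · rw [← LinearMap.ker_eq_bot, Submodule.eq_bot_iff]
            rintro ⟨v, hv⟩ hfv
            have hfv' : f.toLinearMap v = 0 := congrArg Subtype.val hfv
            have hmem : v ∈ f.ker ⊓ V₁ := ⟨hfv', hv⟩
            rw [hV₁.inf_eq_bot] at hmem
            exact Subtype.ext hmem
          · rintro ⟨w, v, rfl⟩
            have hv : v ∈ (f.ker ⊔ V₁).toSubmodule := by rw [hV₁.sup_eq_top]; trivial
            obtain ⟨a, ha, b, hb, rfl⟩ := Submodule.mem_sup.1 hv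
            refine ⟨⟨b, hb⟩, Subtype.ext ?_⟩
            have ha' : f.toLinearMap a = 0 := ha
            change f.toLinearMap b = f.toLinearMap (a + b)
            rw [map_add, ha', zero_add]
        refine char_iso (Representation.Equiv.mk (LinearEquiv.ofBijective _ hbij) fun g => ?_)
        ext v
        exact f.isIntertwining _ _ g v
      have hchar : ρ.character - σ.character =
          f.ker.toRepresentation.character - W₁.toRepresentation.character := by
        rw [character_of_isCompl hV₁, character_of_isCompl hW₁, hiso]
        abel
      rw [hchar] at h ⊢
      refine ih _ _ _ _ ?_ h
      have h1 : finrank ℂ f.ker.toSubmodule < finrank ℂ V := by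
        refine Submodule.finrank_lt fun htop => hf ?_
        ext v
        have : v ∈ f.ker.toSubmodule := by rw [htop]; trivial
        exact this
      have h2 : finrank ℂ W₁.toSubmodule ≤ finrank ℂ W := Submodule.finrank_le _
      omega
    · have h0 : cinner σ.character ρ.character = 0 := by
        by_contra hne
        exact hf (exists_intertwiningMap_ne_zero hne)
      have h' := h
      rw [cinner_sub_left, cinner_sub_right, cinner_sub_right, cinner_comm ρ.character σ.character,
        h0, sub_zero, zero_sub, sub_neg_eq_add, cinner_character, cinner_character] at h
      norm_cast at h
      have hzero : ∀ {X : Type} [AddCommGroup X] [Module ℂ X] [FiniteDimensional ℂ X]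
          (τ : Representation ℂ G X), finrank ℂ (IntertwiningMap τ τ) = 0 → τ.character = 0 := by
        intro X _ _ _ τ hτ
        have := subsingleton_of_finrank_end_eq_zero τ hτ
        ext g
        simp [character, Subsingleton.elim (τ g) 0]
      rcases Nat.eq_zero_or_pos (finrank ℂ (IntertwiningMap σ σ)) with hσ | hσ
      · have hσ0 := hzero σ hσ
        rw [hσ0, sub_zero] at h' ⊢
        exact ⟨V, _, _, inferInstance, ρ, isIrreducible_of_cinner_self_eq_one ρ h', h',
          Or.inl rfl⟩
      · have hρ0 := hzero ρ (by omega)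
        rw [hρ0, zero_sub, cinner_neg_left, cinner_neg_right, neg_neg] at h'
        rw [hρ0, zero_sub]
        exact ⟨W, _, _, inferInstance, σ, isIrreducible_of_cinner_self_eq_one σ h', h',
          Or.inr rfl⟩

/-- The one-dimensional representation afforded by a linear character. -/
def linearRep (χ : G →* ℂ) : Representation ℂ G ℂ :=
  (Algebra.lmul ℂ ℂ : ℂ →ₐ[ℂ] _).toMonoidHom.comp χ

@[simp]
theorem linearRep_apply (χ : G →* ℂ) (g : G) (z : ℂ) : linearRep χ g z = χ g * z := rfl

theorem linearRep_character (χ : G →* ℂ) : (linearRep χ).character = χ := by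
  ext g
  rw [character, LinearMap.trace_eq_matrix_trace ℂ (Basis.singleton Unit ℂ)]
  simp [Matrix.trace, LinearMap.toMatrix_apply]

theorem exists_semiinvariant [Finite G] {ρ : Representation ℂ G V} {χ : G →* ℂ}
    (h : cinner ρ.character χ ≠ 0) : ∃ v : V, v ≠ 0 ∧ ∀ g, ρ g v = χ g • v := by
  rw [← linearRep_character] at h
  obtain ⟨f, hf⟩ := exists_intertwiningMap_ne_zero h
  refine ⟨f 1, fun h1 => hf ?_, fun g => ?_⟩
  · ext
    exact h1
  · have := f.isIntertwining _ _ g 1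
    rw [← this, linearRep_apply, mul_one, ← map_smul, smul_eq_mul, mul_one]

theorem cinner_ne_zero_of_semiinvariant [Finite G] {ρ : Representation ℂ G V} {χ : G →* ℂ} {v : V}
    (hv : v ≠ 0) (h : ∀ g, ρ g v = χ g • v) : cinner ρ.character χ ≠ 0 := by
  rw [← linearRep_character]
  let f : IntertwiningMap (linearRep χ) ρ :=
    (LinearMap.toSpanSingleton ℂ V v).intertwiningMap_of_isIntertwiningMap _ _ fun g z => by
      simp [h, mul_smul, smul_comm z]
  refine cinner_character_ne_zero (f := f) fun hf => hv ?_
  have h1 : (1 : ℂ) • v = 0 := congrArg (fun k : IntertwiningMap (linearRep χ) ρ => k 1) hf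
  rwa [one_smul] at h1

theorem cinner_linear_eq_one [Finite G] {ρ : Representation ℂ G V} {χ : G →* ℂ}
    (h0 : cinner ρ.character χ ≠ 0) (e : V →ₗ[ℂ] ℂ)
    (he : ∀ v, (∀ g, ρ g v = χ g • v) → e v = 0 → v = 0) : cinner ρ.character χ = 1 := by
  rw [← linearRep_character] at h0 ⊢
  rw [cinner_character] at h0 ⊢
  have := finite_intertwiningMap (linearRep χ) ρ
  let E : IntertwiningMap (linearRep χ) ρ →ₗ[ℂ] ℂ :=
    { toFun := fun f => e (f 1)
      map_add' := fun f g => by simp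
      map_smul' := fun c f => by simp }
  have hE : Function.Injective E := by
    rw [← LinearMap.ker_eq_bot, Submodule.eq_bot_iff]
    intro f hf
    ext
    refine he (f 1) (fun g => ?_) hf
    have := f.isIntertwining _ _ g 1
    rw [← this, linearRep_apply, mul_one, ← map_smul, smul_eq_mul, mul_one]
  have hle := LinearMap.finrank_le_finrank_of_injective hE
  rw [finrank_self] at hle
  norm_cast at h0 ⊢
  omega

theorem cinner_character_nat [Finite G] (ρ : Representation ℂ G V) (χ : G →* ℂ) :
    ∃ m : ℕ, cinner ρ.character χ = m := by
  rw [← linearRep_character]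
  exact ⟨_, cinner_character _ _⟩

end RepresentationTheory

section SignedPermutations

variable {n : ℕ}

/-- The signed permutations: permutations of `{±1, …, ±n}` that commute with negation. -/
def signedPerm (n : ℕ) : Subgroup (PG n) where
  carrier := {π | ∀ x, π x.swap = (π x).swap}
  mul_mem' {π ρ} hπ hρ x := by
    rw [Perm.mul_apply, hρ, hπ, Perm.mul_apply]
  one_mem' x := rfl
  inv_mem' {π} hπ x := by
    rw [Perm.inv_eq_iff_eq, hπ, show π (π⁻¹ x) = x from π.apply_symm_apply x]

/-- The underlying index of a signed index. -/
def idx (x : Fin n ⊕ Fin n) : Fin n := Sum.elim id id x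

/-- The sign of a signed index. -/
def sgnOf (x : Fin n ⊕ Fin n) : ℂ := Sum.elim (fun _ => 1) (fun _ => -1) x

/-- The underlying map on indices of a signed permutation. -/
def ab (π : PG n) (i : Fin n) : Fin n := idx (π (Sum.inl i))

/-- The signs of a signed permutation. -/
def sg (π : PG n) (i : Fin n) : ℂ := sgnOf (π (Sum.inl i))

theorem sg_eq_one_or (π : PG n) (i : Fin n) : sg π i = 1 ∨ sg π i = -1 := by
  unfold sg sgnOf
  rcases π (Sum.inl i) with j | j <;> simp

theorem sg_mul_self (π : PG n) (i : Fin n) : sg π i * sg π i = 1 := by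
  rcases sg_eq_one_or π i with h | h <;> simp [h]

theorem apply_inl (π : PG n) (i : Fin n) :
    (π (Sum.inl i) = Sum.inl (ab π i) ∧ sg π i = 1) ∨
      (π (Sum.inl i) = Sum.inr (ab π i) ∧ sg π i = -1) := by
  unfold ab sg sgnOf idx
  rcases π (Sum.inl i) with j | j <;> simp

theorem idx_swap (x : Fin n ⊕ Fin n) : idx x.swap = idx x := by
  rcases x with j | j <;> rfl

theorem sgnOf_swap (x : Fin n ⊕ Fin n) : sgnOf x.swap = - sgnOf x := by
  rcases x with j | j <;> simp [sgnOf]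

theorem apply_inr {π : PG n} (hπ : π ∈ signedPerm n) (i : Fin n) :
    π (Sum.inr i) = (π (Sum.inl i)).swap := hπ (Sum.inl i)

theorem idx_apply {π : PG n} (hπ : π ∈ signedPerm n) (x : Fin n ⊕ Fin n) :
    idx (π x) = ab π (idx x) := by
  rcases x with j | j
  · rfl
  · rw [apply_inr hπ, idx_swap]
    rfl

theorem sgnOf_apply {π : PG n} (hπ : π ∈ signedPerm n) (x : Fin n ⊕ Fin n) :
    sgnOf (π x) = sgnOf x * sg π (idx x) := by
  rcases x with j | j
  · simp [sgnOf, sg, idx]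
  · rw [apply_inr hπ, sgnOf_swap]
    simp [sgnOf, sg, idx]

theorem ab_mul {π : PG n} (hπ : π ∈ signedPerm n) (ρ : PG n) (i : Fin n) :
    ab (π * ρ) i = ab π (ab ρ i) := idx_apply hπ _

theorem sg_mul {π : PG n} (hπ : π ∈ signedPerm n) (ρ : PG n) (i : Fin n) :
    sg (π * ρ) i = sg ρ i * sg π (ab ρ i) := sgnOf_apply hπ _

theorem ab_one (i : Fin n) : ab (1 : PG n) i = i := rfl

theorem sg_one (i : Fin n) : sg (1 : PG n) i = 1 := rfl

theorem ab_inv_ab {π : PG n} (hπ : π ∈ signedPerm n) (i : Fin n) : ab π⁻¹ (ab π i) = i := by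
  rw [← ab_mul (inv_mem hπ), inv_mul_cancel, ab_one]

theorem ab_ab_inv {π : PG n} (hπ : π ∈ signedPerm n) (i : Fin n) : ab π (ab π⁻¹ i) = i := by
  rw [← ab_mul hπ, mul_inv_cancel, ab_one]

theorem ab_bijective {π : PG n} (hπ : π ∈ signedPerm n) : Function.Bijective (ab π) :=
  Function.bijective_iff_has_inverse.2 ⟨ab π⁻¹, ab_inv_ab hπ, ab_ab_inv hπ⟩

theorem sg_inv {π : PG n} (hπ : π ∈ signedPerm n) (i : Fin n) :
    sg π⁻¹ (ab π i) = sg π i := by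
  have h := sg_mul (inv_mem hπ) π i
  rw [inv_mul_cancel, sg_one] at h
  have := sg_mul_self π i
  linear_combination (-sg π i) * h - sg π⁻¹ (ab π i) * this

theorem signedPerm_ext {π ρ : PG n} (hπ : π ∈ signedPerm n) (hρ : ρ ∈ signedPerm n)
    (h : ∀ i, ab π i = ab ρ i) (h' : ∀ i, sg π i = sg ρ i) : π = ρ := by
  have hl : ∀ i, π (Sum.inl i) = ρ (Sum.inl i) := by
    intro i
    have h1 := h' i
    rcases apply_inl π i with ⟨a, b⟩ | ⟨a, b⟩ <;> rcases apply_inl ρ i with ⟨c, d⟩ | ⟨c, d⟩ <;>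
      rw [a, c, h i] <;> rw [b, d] at h1 <;> norm_num at h1
  ext1 x
  rcases x with i | i
  · exact hl i
  · rw [apply_inr hπ, apply_inr hρ, hl]

theorem prod_sg_mul {π ρ : PG n} (hπ : π ∈ signedPerm n) (hρ : ρ ∈ signedPerm n) :
    ∏ i, sg (π * ρ) i = (∏ i, sg π i) * ∏ i, sg ρ i := by
  simp only [sg_mul hπ, Finset.prod_mul_distrib]
  rw [mul_comm, Fintype.prod_bijective (ab ρ) (ab_bijective hρ) (fun i => sg π (ab ρ i))
    (fun i => sg π i) fun i => rfl]

/-- A permutation of the indices, as a signed permutation. -/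
def lift (σ : Perm (Fin n)) : PG n := Equiv.sumCongr σ σ

theorem lift_mem (σ : Perm (Fin n)) : lift σ ∈ signedPerm n := by
  rintro (i | i) <;> rfl

@[simp] theorem ab_lift (σ : Perm (Fin n)) (i : Fin n) : ab (lift σ) i = σ i := rfl

@[simp] theorem sg_lift (σ : Perm (Fin n)) (i : Fin n) : sg (lift σ) i = 1 := rfl

theorem lift_mul (σ τ : Perm (Fin n)) : lift (σ * τ) = lift σ * lift τ := by
  ext1 x
  rcases x with i | i <;> rfl

theorem dsw_eq_lift (i j : Fin n) : dsw i j = lift (swap i j) := by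
  ext1 x
  rcases x with k | k <;> simp only [dsw, lift, Perm.mul_apply, Equiv.sumCongr_apply, Sum.map_inl,
    Sum.map_inr, swap_apply_def, Sum.inl.injEq, Sum.inr.injEq, reduceCtorEq, if_false] <;>
    split_ifs <;> simp_all

theorem dsw_mem (i j : Fin n) : dsw i j ∈ signedPerm n := by
  rw [dsw_eq_lift]
  exact lift_mem _

theorem ssw_mem (i : Fin n) : ssw i ∈ signedPerm n := by
  intro x
  rcases x with k | k <;> simp only [ssw, swap_apply_def, Sum.swap_inl, Sum.swap_inr,
    Sum.inl.injEq, Sum.inr.injEq, reduceCtorEq, if_false] <;> split_ifs <;> simp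

theorem ab_ssw (i j : Fin n) : ab (ssw i) j = j := by
  simp only [ab, ssw, swap_apply_def, Sum.inl.injEq, reduceCtorEq, if_false, idx]
  split_ifs <;> simp_all

theorem sg_ssw (i j : Fin n) : sg (ssw i) j = if j = i then -1 else 1 := by
  simp only [sg, ssw, swap_apply_def, Sum.inl.injEq, reduceCtorEq, if_false, sgnOf]
  split_ifs <;> simp_all

theorem msw_eq {i j : Fin n} (hij : i ≠ j) : msw i j = dsw i j * ssw i * ssw j := by
  ext1 x
  have hji := hij.symm
  rcases x with k | k <;> by_cases hi : k = i <;> by_cases hj : k = j <;>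
    simp [msw, dsw, ssw, swap_apply_def, hi, hj, hij, hji] at *

theorem msw_self (i : Fin n) : msw i i = 1 := by
  rw [msw, swap_comm (Sum.inr i), swap_mul_self]

theorem msw_mem (i j : Fin n) : msw i j ∈ signedPerm n := by
  by_cases hij : i = j
  · subst hij
    rw [msw_self]
    exact one_mem _
  · rw [msw_eq hij]
    exact mul_mem (mul_mem (dsw_mem i j) (ssw_mem i)) (ssw_mem j)

theorem prod_sg_ssw (i : Fin n) : ∏ j, sg (ssw i) j = -1 := by
  simp [sg_ssw]

theorem prod_sg_lift (σ : Perm (Fin n)) : ∏ j, sg (lift σ) j = 1 := by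
  simp

theorem prod_sg_dsw (i j : Fin n) : ∏ k, sg (dsw i j) k = 1 := by
  rw [dsw_eq_lift, prod_sg_lift]

theorem prod_sg_msw (i j : Fin n) : ∏ k, sg (msw i j) k = 1 := by
  by_cases hij : i = j
  · subst hij
    simp [msw_self, sg_one]
  · rw [msw_eq hij, prod_sg_mul (mul_mem (dsw_mem i j) (ssw_mem i)) (ssw_mem j),
      prod_sg_mul (dsw_mem i j) (ssw_mem i), prod_sg_ssw, prod_sg_ssw, prod_sg_dsw]
    norm_num

theorem ab_msw (i j k : Fin n) : ab (msw i j) k = swap i j k := by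
  by_cases hij : i = j
  · subst hij
    simp [msw_self, ab_one]
  · rw [msw_eq hij, ab_mul (mul_mem (dsw_mem i j) (ssw_mem i)), ab_mul (dsw_mem i j), ab_ssw,
      ab_ssw, dsw_eq_lift, ab_lift]

theorem sg_msw {i j : Fin n} (hij : i ≠ j) (k : Fin n) :
    sg (msw i j) k = if k = i ∨ k = j then -1 else 1 := by
  rw [msw_eq hij, sg_mul (mul_mem (dsw_mem i j) (ssw_mem i)), sg_mul (dsw_mem i j), ab_ssw,
    ab_ssw, dsw_eq_lift, sg_lift, sg_ssw, sg_ssw]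
  split_ifs <;> simp_all

theorem blkSub_le_signedPerm (f : Fin n → ℕ) (ty : Fin n → BTy) :
    blkSub n f ty ≤ signedPerm n := by
  refine (Subgroup.closure_le _).2 ?_
  rintro π ((⟨i, j, -, rfl⟩ | ⟨i, -, rfl⟩) | ⟨i, j, -, -, -, rfl⟩)
  exacts [dsw_mem i j, ssw_mem i, msw_mem i j]

theorem lift_mem_blkSub (f : Fin n → ℕ) (ty : Fin n → BTy) (σ : Perm (Fin n))
    (h : ∀ i, f (σ i) = f i) : lift σ ∈ blkSub n f ty := by
  induction hN : #σ.support using Nat.strong_induction_on generalizing σ with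
  | _ N ih =>
    by_cases hσ : σ = 1
    · subst hσ
      have : lift (1 : Perm (Fin n)) = 1 := by
        ext1 x
        rcases x with i | i <;> rfl
      rw [this]
      exact one_mem _
    · obtain ⟨x, hx⟩ : ∃ x, σ x ≠ x := by
        by_contra! h1
        exact hσ (Perm.ext h1)
      have h1 : σ = swap x (σ x) * (swap x (σ x) * σ) := by
        rw [← mul_assoc, swap_mul_self, one_mul]
      rw [h1, lift_mul, ← dsw_eq_lift]
      refine mul_mem (Subgroup.subset_closure (Or.inl (Or.inl ⟨_, _, (h x).symm, rfl⟩)))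
        (ih _ (hN ▸ Perm.card_support_swap_mul hx) _ (fun i => ?_) rfl)
      rw [Perm.mul_apply, swap_apply_def]
      split_ifs with h2 h3
      · rw [h x, ← h i, h2]
      · rw [← h i, h3, h x]
      · exact h i

theorem mem_blkSub_B_iff {f : Fin n → ℕ} {π : PG n} :
    π ∈ blkSub n f (fun _ => BTy.B) ↔ π ∈ signedPerm n ∧ ∀ i, f (ab π i) = f i := by
  constructor
  · intro h
    refine ⟨blkSub_le_signedPerm _ _ h, ?_⟩
    induction h using Subgroup.closure_induction with
    | mem π h =>
      rcases h with (⟨i, j, hij, rfl⟩ | ⟨i, -, rfl⟩) | ⟨i, j, hij, h1, h2, rfl⟩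
      · intro k
        rw [dsw_eq_lift, ab_lift, swap_apply_def]
        split_ifs <;> simp_all
      · intro k
        rw [ab_ssw]
      · simp at h1
    | one => exact fun i => rfl
    | mul π ρ hπ hρ h1 h2 =>
      intro i
      rw [ab_mul (blkSub_le_signedPerm _ _ hπ), h1, h2]
    | inv π hπ h1 =>
      intro i
      rw [← h1, ab_ab_inv (blkSub_le_signedPerm _ _ hπ)]
  · rintro ⟨h1, h2⟩
    induction hN : #{i | sg π i = -1} using Nat.strong_induction_on generalizing π with
    | _ N ih =>
      by_cases h3 : ∃ i, sg π i = -1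
      · obtain ⟨i, hi⟩ := h3
        have h4 : π = π * ssw i * ssw i := by
          rw [mul_assoc, ssw, swap_mul_self, mul_one]
        rw [h4]
        refine mul_mem (ih _ ?_ (mul_mem h1 (ssw_mem i)) (fun j => ?_) rfl)
          (Subgroup.subset_closure (Or.inl (Or.inr ⟨i, rfl, rfl⟩)))
        · rw [← hN]
          refine Finset.card_lt_card ⟨fun j => ?_, fun h => ?_⟩
          · simp only [Finset.mem_filter_univ, sg_mul h1, sg_ssw, ab_ssw]
            split_ifs with hji
            · rw [hji, hi]
              norm_num
            · simp
          · have := h (Finset.mem_filter_univ i |>.2 hi)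
            rw [Finset.mem_filter_univ, sg_mul h1, sg_ssw, ab_ssw, hi] at this
            norm_num at this
        · rw [ab_mul h1, ab_ssw, h2]
      · push Not at h3
        have h4 : π = lift (Equiv.ofBijective _ (ab_bijective h1)) :=
          signedPerm_ext h1 (lift_mem _) (fun i => rfl) fun i =>
            (sg_eq_one_or π i).resolve_right (h3 i)
        rw [h4]
        exact lift_mem_blkSub _ _ _ h2

theorem mem_BWn_iff {π : PG n} : π ∈ BWn n ↔ π ∈ signedPerm n := by
  simp [BWn, mem_blkSub_B_iff]

theorem blkSub_mem_of_no_B {f : Fin n → ℕ} {ty : Fin n → BTy} (g : ℕ → BTy)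
    (hg : ∀ i, ty i = g (f i)) (hB : ∀ i, ty i ≠ BTy.B) {π : PG n} (h : π ∈ blkSub n f ty) :
    (∀ i, f (ab π i) = f i) ∧ (∀ i, ty i ≠ BTy.D → sg π i = 1) ∧ ∏ i, sg π i = 1 := by
  induction h using Subgroup.closure_induction with
  | mem π h =>
    rcases h with (⟨i, j, hij, rfl⟩ | ⟨i, h1, rfl⟩) | ⟨i, j, hij, h1, h2, rfl⟩
    · refine ⟨fun k => ?_, fun k _ => by rw [dsw_eq_lift, sg_lift], prod_sg_dsw i j⟩
      rw [dsw_eq_lift, ab_lift, swap_apply_def]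
      split_ifs <;> simp_all
    · exact absurd h1 (hB i)
    · refine ⟨fun k => ?_, fun k hk => ?_, prod_sg_msw i j⟩
      · rw [ab_msw, swap_apply_def]
        split_ifs <;> simp_all
      · by_cases hij' : i = j
        · rw [hij', msw_self, sg_one]
        · rw [sg_msw hij', if_neg]
          rintro (rfl | rfl) <;> contradiction
  | one => exact ⟨fun i => rfl, fun i _ => rfl, by simp [sg_one]⟩
  | mul π ρ hπ hρ h1 h2 =>
    have hπ' := blkSub_le_signedPerm _ _ hπ
    refine ⟨fun i => ?_, fun i hi => ?_, ?_⟩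
    · rw [ab_mul hπ', h1.1, h2.1]
    · rw [sg_mul hπ', h2.2.1 i hi, h1.2.1 _ (by rw [hg, h2.1, ← hg]; exact hi), one_mul]
    · rw [prod_sg_mul hπ' (blkSub_le_signedPerm _ _ hρ), h1.2.2, h2.2.2, one_mul]
  | inv π hπ h1 =>
    have hπ' := blkSub_le_signedPerm _ _ hπ
    have h3 : ∀ i, f (ab π⁻¹ i) = f i := fun i => by rw [← h1.1, ab_ab_inv hπ']
    refine ⟨h3, fun i hi => ?_, ?_⟩
    · have := sg_inv hπ' (ab π⁻¹ i)
      rw [ab_ab_inv hπ'] at this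
      rw [this]
      exact h1.2.1 _ (by rw [hg, h3, ← hg]; exact hi)
    · have := prod_sg_mul hπ' (inv_mem hπ')
      rw [mul_inv_cancel, h1.2.2, one_mul] at this
      rw [← this]
      simp [sg_one]

theorem DWn_le_signedPerm : DWn n ≤ signedPerm n := blkSub_le_signedPerm _ _

theorem DWn_le_BWn : DWn n ≤ BWn n := fun _ h => mem_BWn_iff.2 (DWn_le_signedPerm h)

theorem prod_sg_of_mem_DWn {π : PG n} (h : π ∈ DWn n) : ∏ i, sg π i = 1 :=
  (blkSub_mem_of_no_B (fun _ => BTy.D) (fun _ => rfl) (by simp) h).2.2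

theorem lift_mem_DWn (σ : Perm (Fin n)) : lift σ ∈ DWn n :=
  lift_mem_blkSub _ _ _ fun _ => rfl

theorem blkSub_le_DWn {f : Fin n → ℕ} {ty : Fin n → BTy} (hB : ∀ i, ty i ≠ BTy.B) :
    blkSub n f ty ≤ DWn n := by
  refine (Subgroup.closure_le _).2 ?_
  rintro π ((⟨i, j, -, rfl⟩ | ⟨i, h, rfl⟩) | ⟨i, j, -, -, -, rfl⟩)
  · rw [dsw_eq_lift]
    exact lift_mem_DWn _
  · exact absurd h (hB i)
  · exact Subgroup.subset_closure (Or.inr ⟨i, j, rfl, rfl, rfl, rfl⟩)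

/-- The product of the sign changes at `i` and `j`. -/
def dsgn (i j : Fin n) : PG n := dsw i j * msw i j

theorem dsgn_mem_blkSub {f : Fin n → ℕ} {ty : Fin n → BTy} {i j : Fin n} (hij : f i = f j)
    (hi : ty i = BTy.D) (hj : ty j = BTy.D) : dsgn i j ∈ blkSub n f ty :=
  mul_mem (Subgroup.subset_closure (Or.inl (Or.inl ⟨i, j, hij, rfl⟩)))
    (Subgroup.subset_closure (Or.inr ⟨i, j, hij, hi, hj, rfl⟩))

theorem ab_dsgn (i j k : Fin n) : ab (dsgn i j) k = k := by
  rw [dsgn, ab_mul (dsw_mem i j), ab_msw, dsw_eq_lift, ab_lift, swap_apply_self]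

theorem sg_dsgn {i j : Fin n} (hij : i ≠ j) (k : Fin n) :
    sg (dsgn i j) k = if k = i ∨ k = j then -1 else 1 := by
  rw [dsgn, sg_mul (dsw_mem i j), dsw_eq_lift, sg_lift, mul_one, sg_msw hij]

theorem Mrefl_apply (π : PG n) (j i : Fin n) : Mrefl π j i = if ab π i = j then sg π i else 0 := by
  simp only [Mrefl, Matrix.of_apply]
  rcases apply_inl π i with ⟨a, b⟩ | ⟨a, b⟩ <;> rw [a, b] <;> simp
  split_ifs <;> simp

theorem reflChar_eq (π : PG n) : reflChar π = ∑ i, if ab π i = i then sg π i else 0 := by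
  simp [reflChar, Matrix.trace, Mrefl_apply]

theorem Mrefl_mul {π ρ : PG n} (hπ : π ∈ signedPerm n) :
    Mrefl (π * ρ) = Mrefl π * Mrefl ρ := by
  ext j i
  simp only [Matrix.mul_apply, Mrefl_apply, ab_mul hπ, sg_mul hπ, mul_ite, mul_zero]
  rw [Finset.sum_ite_eq]
  split_ifs <;> simp_all [mul_comm]

theorem sgnChar_mul {π ρ : PG n} (hπ : π ∈ signedPerm n) :
    sgnChar (π * ρ) = sgnChar π * sgnChar ρ := by
  rw [sgnChar, Mrefl_mul hπ, Matrix.det_mul]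
  rfl

theorem sgnChar_eq (π : PG n) (σ : Perm (Fin n)) (h : ∀ i, ab π i = σ i) :
    sgnChar π = ((Perm.sign σ : ℤ) : ℂ) * ∏ i, sg π i := by
  have h1 : (Mrefl π).submatrix σ id = Matrix.diagonal (sg π) := by
    ext i j
    rw [Matrix.submatrix_apply, Mrefl_apply, Matrix.diagonal_apply, id, h]
    by_cases hij : i = j
    · simp [hij]
    · rw [if_neg hij, if_neg (fun hσ => hij (σ.injective hσ).symm)]
  have h2 := Matrix.det_permute σ (Mrefl π)
  rw [h1, Matrix.det_diagonal] at h2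
  rw [h2, ← mul_assoc, ← Int.cast_mul, ← Units.val_mul, Int.units_mul_self]
  simp [sgnChar]

theorem sgnChar_dsw {i j : Fin n} (hij : i ≠ j) : sgnChar (dsw i j) = -1 := by
  rw [sgnChar_eq (dsw i j) (swap i j) fun k => by rw [dsw_eq_lift, ab_lift], prod_sg_dsw,
    Perm.sign_swap hij]
  simp

theorem sgnChar_of_ab_eq {π : PG n} (h : ∀ i, ab π i = i) : sgnChar π = ∏ i, sg π i := by
  rw [sgnChar_eq π 1 h]
  simp

theorem sgnChar_one : sgnChar (1 : PG n) = 1 := by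
  rw [sgnChar_of_ab_eq ab_one]
  simp [sg_one]

/-- The sign character of a group of signed permutations, as a homomorphism. -/
def sgnHom {K : Subgroup (PG n)} (hK : K ≤ signedPerm n) : K →* ℂ where
  toFun k := sgnChar (k : PG n)
  map_one' := sgnChar_one
  map_mul' k _ := sgnChar_mul (hK k.2)

theorem sgnHom_coe {K : Subgroup (PG n)} (hK : K ≤ signedPerm n) :
    ⇑(sgnHom hK) = resChar K sgnChar := rfl

theorem exists_perm_of_card_fiber_eq {C : Type*} [DecidableEq C] {f g : Fin n → C}
    (h : ∀ c, #{i | f i = c} = #{i | g i = c}) : ∃ σ : Perm (Fin n), ∀ i, g (σ i) = f i := by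
  have e : ∀ c, Nonempty ({i // f i = c} ≃ {i // g i = c}) := fun c =>
    Fintype.card_eq.1 (by rw [Fintype.card_subtype, Fintype.card_subtype, h])
  exact ⟨Equiv.ofFiberEquiv fun c => (e c).some, fun i => Equiv.ofFiberEquiv_map _ i⟩

theorem card_fiber_comp {C : Type*} [DecidableEq C] (f : Fin n → C) {u : Fin n → Fin n}
    (hu : Function.Bijective u) (c : C) : #{i | f (u i) = c} = #{i | f i = c} :=
  Finset.card_bijective u hu fun i => by simp

end SignedPermutations

section MonomialRepresentations

open Representation

variable {n : ℕ}

/-- The sign by which a signed permutation acts on the monomial with exponents `h`. -/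
def cocyc (π : PG n) (h : Fin n → ℕ) : ℂ := ∏ i, sg π i ^ h (ab π i)

theorem cocyc_mul {π ρ : PG n} (hπ : π ∈ signedPerm n) (hρ : ρ ∈ signedPerm n)
    (h : Fin n → ℕ) : cocyc (π * ρ) h = cocyc π h * cocyc ρ (h ∘ ab π) := by
  simp only [cocyc, sg_mul hπ, ab_mul hπ, mul_pow, Finset.prod_mul_distrib, Function.comp]
  rw [mul_comm]
  congr 1
  exact Fintype.prod_bijective (ab ρ) (ab_bijective hρ) _ _ fun i => rfl

theorem cocyc_one (h : Fin n → ℕ) : cocyc (1 : PG n) h = 1 := by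
  simp [cocyc, sg_one]

theorem cocyc_of_comp_eq {π : PG n} {h : Fin n → ℕ} (hh : h ∘ ab π = h) :
    cocyc π h = ∏ i, sg π i ^ h i :=
  Finset.prod_congr rfl fun i _ => by rw [← congrFun hh i]; rfl

theorem cocyc_dsgn {i j : Fin n} (hij : i ≠ j) (h : Fin n → ℕ) :
    cocyc (dsgn i j) h = (-1) ^ (h i + h j) := by
  simp only [cocyc, sg_dsgn hij, ab_dsgn]
  rw [← Finset.prod_subset (Finset.subset_univ {i, j}), Finset.prod_pair hij]
  · simp [pow_add]
  · intro k _ hk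
    rw [if_neg (by simpa using hk), one_pow]

theorem cocyc_lift (σ : Perm (Fin n)) (h : Fin n → ℕ) : cocyc (lift σ) h = 1 := by
  simp [cocyc]

/-- A set of exponent vectors is symmetric if it is closed under permuting the variables. -/
def IsSymmSet (Y : Finset (Fin n → ℕ)) : Prop := ∀ h ∈ Y, ∀ σ : Perm (Fin n), h ∘ σ ∈ Y

theorem IsSymmSet.comp_ab {Y : Finset (Fin n → ℕ)} (hY : IsSymmSet Y) {π : PG n}
    (hπ : π ∈ signedPerm n) {h : Fin n → ℕ} (hh : h ∈ Y) : h ∘ ab π ∈ Y :=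
  hY h hh (Equiv.ofBijective _ (ab_bijective hπ))

/-- The character of the span of the monomials with exponents in `Y`. -/
def monoChar (Y : Finset (Fin n → ℕ)) (π : PG n) : ℂ :=
  ∑ h ∈ Y with h ∘ ab π = h, ∏ i, sg π i ^ h i

/-- The representation of a group of signed permutations on the span of the monomials with
exponents in a symmetric set. -/
def monoRep {K : Subgroup (PG n)} (hK : K ≤ signedPerm n) {Y : Finset (Fin n → ℕ)}
    (hY : IsSymmSet Y) : Representation ℂ K (Y → ℂ) where
  toFun k :=
    { toFun := fun a h => cocyc (k : PG n) h * a ⟨h ∘ ab (k : PG n), hY.comp_ab (hK k.2) h.2⟩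
      map_add' := fun a b => by
        ext h
        simp [mul_add]
      map_smul' := fun c a => by
        ext h
        simp only [Pi.smul_apply, smul_eq_mul, RingHom.id_apply]
        ring }
  map_one' := by
    apply LinearMap.ext
    intro a
    funext h
    change cocyc (1 : PG n) h * a ⟨h ∘ ab 1, _⟩ = a h
    rw [cocyc_one, one_mul]
    rfl
  map_mul' k l := by
    apply LinearMap.ext
    intro a
    funext h
    change cocyc ((k : PG n) * (l : PG n)) h * a ⟨h ∘ ab ((k : PG n) * (l : PG n)), _⟩ =
      cocyc (k : PG n) h * (cocyc (l : PG n) (h ∘ ab (k : PG n)) *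
        a ⟨(h ∘ ab (k : PG n)) ∘ ab (l : PG n), _⟩)
    rw [cocyc_mul (hK k.2) (hK l.2), mul_assoc]
    congr 4
    funext i
    simp [ab_mul (hK k.2)]

theorem monoRep_apply {K : Subgroup (PG n)} (hK : K ≤ signedPerm n) {Y : Finset (Fin n → ℕ)}
    (hY : IsSymmSet Y) (k : K) (a : Y → ℂ) (h : Y) :
    monoRep hK hY k a h =
      cocyc (k : PG n) h * a ⟨h ∘ ab (k : PG n), hY.comp_ab (hK k.2) h.2⟩ := rfl

theorem monoRep_character {K : Subgroup (PG n)} (hK : K ≤ signedPerm n)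
    {Y : Finset (Fin n → ℕ)} (hY : IsSymmSet Y) :
    (monoRep hK hY).character = resChar K (monoChar Y) := by
  ext k
  rw [character, LinearMap.trace_eq_matrix_trace ℂ (Pi.basisFun ℂ Y), Matrix.trace, resChar,
    monoChar, Finset.sum_filter, ← Finset.sum_coe_sort Y]
  refine Finset.sum_congr rfl fun h _ => ?_
  rw [Matrix.diag_apply, LinearMap.toMatrix_apply, Pi.basisFun_apply, Pi.basisFun_repr,
    monoRep_apply, Pi.single_apply]
  simp only [Subtype.ext_iff]
  split_ifs with hh
  · rw [mul_one, cocyc_of_comp_eq hh]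
  · rw [mul_zero]

theorem exists_semiinvariant_monoRep {K : Subgroup (PG n)} (hK : K ≤ signedPerm n)
    {Y : Finset (Fin n → ℕ)} (hY : IsSymmSet Y) (χ : K →* ℂ) {h₀ : Fin n → ℕ} (hh : h₀ ∈ Y)
    (hst : ∀ k : K, h₀ ∘ ab (k : PG n) = h₀ → cocyc (k : PG n) h₀ = χ k) :
    ∃ v : Y → ℂ, v ≠ 0 ∧ ∀ k, monoRep hK hY k v = χ k • v := by
  classical
  have := Fintype.ofFinite K
  set e : Y → ℂ := Pi.single ⟨h₀, hh⟩ 1 with he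
  refine ⟨∑ k : K, χ k⁻¹ • monoRep hK hY k e, fun h0 => ?_, fun g => ?_⟩
  · have h1 := congrFun h0 ⟨h₀, hh⟩
    rw [Finset.sum_apply] at h1
    have h2 : ∀ k : K, (χ k⁻¹ • monoRep hK hY k e) ⟨h₀, hh⟩ =
        if h₀ ∘ ab (k : PG n) = h₀ then 1 else 0 := by
      intro k
      rw [Pi.smul_apply, monoRep_apply, he, Pi.single_apply]
      simp only [Subtype.ext_iff, smul_eq_mul]
      split_ifs with hk
      · rw [mul_one, hst k hk, ← map_mul, inv_mul_cancel, map_one]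
      · simp
    rw [Finset.sum_congr rfl fun k _ => h2 k, Finset.sum_boole] at h1
    have h3 : (1 : K) ∈ ({k : K | h₀ ∘ ab (k : PG n) = h₀} : Finset K) := by
      rw [Finset.mem_filter_univ]
      rfl
    have h4 := Finset.card_pos.2 ⟨_, h3⟩
    simp only [Pi.zero_apply, Nat.cast_eq_zero] at h1
    omega
  · rw [map_sum, Finset.smul_sum]
    refine Fintype.sum_equiv (Equiv.mulLeft g) _ _ fun k => ?_
    rw [Equiv.coe_mulLeft, map_smul, mul_inv_rev, map_mul χ, smul_smul, map_mul,
      Module.End.mul_apply,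
      mul_comm (χ k⁻¹), ← mul_assoc, ← map_mul χ g, mul_inv_cancel, map_one, one_mul]

theorem semiinvariant_apply {K : Subgroup (PG n)} {hK : K ≤ signedPerm n}
    {Y : Finset (Fin n → ℕ)} {hY : IsSymmSet Y} {χ : K →* ℂ} {v : Y → ℂ}
    (hv : ∀ k, monoRep hK hY k v = χ k • v) (k : K) (h : Y) :
    cocyc (k : PG n) h * v ⟨h ∘ ab (k : PG n), hY.comp_ab (hK k.2) h.2⟩ = χ k * v h := by
  rw [← monoRep_apply hK hY, hv]
  rfl

/-- A sign-semi-invariant is supported on monomials whose exponents are distinct on every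
block. -/
theorem ne_of_semiinvariant_ne_zero {f : Fin n → ℕ} {ty : Fin n → BTy}
    {hK : blkSub n f ty ≤ signedPerm n} {Y : Finset (Fin n → ℕ)} {hY : IsSymmSet Y} {v : Y → ℂ}
    (hv : ∀ k, monoRep hK hY k v = sgnHom hK k • v) {h : Y} (h0 : v h ≠ 0) {i j : Fin n}
    (hf : f i = f j) (hij : i ≠ j) : (h : Fin n → ℕ) i ≠ (h : Fin n → ℕ) j := by
  intro heq
  have h1 := semiinvariant_apply hv
    ⟨dsw i j, Subgroup.subset_closure (Or.inl (Or.inl ⟨i, j, hf, rfl⟩))⟩ h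
  have h2 : (h : Fin n → ℕ) ∘ ab (dsw i j) = h := by
    funext k
    simp only [Function.comp, dsw_eq_lift, ab_lift, swap_apply_def]
    split_ifs <;> simp_all
  simp only [h2, sgnHom, MonoidHom.coe_mk, OneHom.coe_mk, sgnChar_dsw hij] at h1
  have h3 : cocyc (dsw i j) (h : Fin n → ℕ) = 1 := by rw [dsw_eq_lift, cocyc_lift]
  apply h0
  change _ * v h = -1 * v h at h1
  rw [h3] at h1
  linear_combination h1 / 2

/-- A sign-semi-invariant is supported on monomials whose exponents have constant parity on
every block of type `D`. -/
theorem parity_of_semiinvariant_ne_zero {f : Fin n → ℕ} {ty : Fin n → BTy}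
    {hK : blkSub n f ty ≤ signedPerm n} {Y : Finset (Fin n → ℕ)} {hY : IsSymmSet Y} {v : Y → ℂ}
    (hv : ∀ k, monoRep hK hY k v = sgnHom hK k • v) {h : Y} (h0 : v h ≠ 0) {i j : Fin n}
    (hf : f i = f j) (hi : ty i = BTy.D) (hj : ty j = BTy.D) :
    Even ((h : Fin n → ℕ) i + (h : Fin n → ℕ) j) := by
  by_cases hij : i = j
  · subst hij
    exact ⟨_, rfl⟩
  have h1 := semiinvariant_apply hv ⟨dsgn i j, dsgn_mem_blkSub hf hi hj⟩ h
  have h2 : (h : Fin n → ℕ) ∘ ab (dsgn i j) = h := by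
    funext k
    simp [ab_dsgn]
  have h3 : sgnChar (dsgn i j) = 1 := by
    rw [sgnChar_of_ab_eq (ab_dsgn i j), dsgn, prod_sg_mul (dsw_mem i j) (msw_mem i j),
      prod_sg_dsw, prod_sg_msw, one_mul]
  simp only [h2, sgnHom, MonoidHom.coe_mk, OneHom.coe_mk, h3, cocyc_dsgn hij] at h1
  change _ * v h = 1 * v h at h1
  by_contra hne
  rw [Nat.not_even_iff_odd] at hne
  rw [hne.neg_one_pow] at h1
  apply h0
  linear_combination -h1 / 2

end MonomialRepresentations

section InducedPieces

variable {n : ℕ}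

/-- Averaging over the orbit of a coloring under a group of signed permutations containing all
permutations. -/
theorem sum_comp_ab {C : Type*} [DecidableEq C] {K : Subgroup (PG n)} [Fintype K]
    (hK : K ≤ signedPerm n) (hlift : ∀ σ, lift σ ∈ K) (f : Fin n → C) (S : Finset (Fin n → C))
    (hS : ∀ h, h ∈ S ↔ ∀ c, #{i | h i = c} = #{i | f i = c}) (F : (Fin n → C) → ℂ) :
    ∑ x : K, F (f ∘ ab (x : PG n)) = #{k : K | f ∘ ab (k : PG n) = f} * ∑ h ∈ S, F h := by
  have hmaps : ∀ x ∈ (Finset.univ : Finset K), f ∘ ab (x : PG n) ∈ S := fun x _ =>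
    (hS _).2 fun c => card_fiber_comp f (ab_bijective (hK x.2)) c
  rw [← Finset.sum_fiberwise_of_maps_to hmaps, Finset.mul_sum]
  refine Finset.sum_congr rfl fun h hh => ?_
  obtain ⟨σ, hσ⟩ := exists_perm_of_card_fiber_eq ((hS h).1 hh)
  have h1 : ∑ x ∈ ({x | f ∘ ab (x : PG n) = h} : Finset K), F (f ∘ ab (x : PG n)) =
      ∑ x ∈ ({x | f ∘ ab (x : PG n) = h} : Finset K), F h :=
    Finset.sum_congr rfl fun x hx => by rw [(Finset.mem_filter_univ x).1 hx]
  rw [h1, Finset.sum_const, nsmul_eq_mul]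
  congr 2
  symm
  refine Finset.card_bijective (fun k => k * ⟨lift σ, hlift σ⟩) (Group.mulRight_bijective _) ?_
  intro k
  simp only [Finset.mem_filter_univ]
  have h2 : f ∘ ab ((k * ⟨lift σ, hlift σ⟩ : K) : PG n) = (f ∘ ab (k : PG n)) ∘ σ := by
    funext i
    simp [ab_mul (hK k.2)]
  have h3 : h = f ∘ σ := funext fun i => (hσ i).symm
  rw [h2, h3]
  exact (σ.surjective.injective_comp_right.eq_iff).symm

/-- The exponent vectors in which the exponent `2i` occurs `c i` times and the exponent `2i+1`
occurs `d i` times. -/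
def contentSet (n : ℕ) {r : ℕ} (c d : Fin r → ℤ) : Finset (Fin n → ℕ) :=
  {h ∈ Fintype.piFinset fun _ => Finset.range (2 * r) |
    ∀ i : Fin r, (#{x | h x = 2 * (i : ℕ)} : ℤ) = c i ∧ (#{x | h x = 2 * (i : ℕ) + 1} : ℤ) = d i}

theorem mem_contentSet {r : ℕ} {c d : Fin r → ℤ} {h : Fin n → ℕ} :
    h ∈ contentSet n c d ↔ (∀ x, h x < 2 * r) ∧ ∀ i : Fin r,
      (#{x | h x = 2 * (i : ℕ)} : ℤ) = c i ∧ (#{x | h x = 2 * (i : ℕ) + 1} : ℤ) = d i := by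
  simp [contentSet]

theorem card_fiber_of_lt {r : ℕ} {h : Fin n → ℕ} (hr : ∀ x, h x < 2 * r) {t : ℕ}
    (ht : 2 * r ≤ t) : #{x | h x = t} = 0 := by
  rw [Finset.card_eq_zero, Finset.filter_eq_empty_iff]
  intro x _ hx
  have := hr x
  omega

theorem mem_contentSet_iff_of_mem {r : ℕ} {c d : Fin r → ℤ} {f : Fin n → ℕ}
    (hf : f ∈ contentSet n c d) (h : Fin n → ℕ) :
    h ∈ contentSet n c d ↔ ∀ t, #{x | h x = t} = #{x | f x = t} := by
  rw [mem_contentSet] at hf ⊢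
  constructor
  · rintro ⟨h1, h2⟩ t
    by_cases ht : t < 2 * r
    · rcases Nat.even_or_odd' t with ⟨k, rfl | rfl⟩
      · have a := (h2 ⟨k, by omega⟩).1
        rw [← (hf.2 ⟨k, by omega⟩).1] at a
        exact_mod_cast a
      · have a := (h2 ⟨k, by omega⟩).2
        rw [← (hf.2 ⟨k, by omega⟩).2] at a
        exact_mod_cast a
    · rw [card_fiber_of_lt h1 (by omega), card_fiber_of_lt hf.1 (by omega)]
  · intro h1
    refine ⟨fun x => ?_, fun i => ?_⟩
    · by_contra hx
      have h2 := h1 (h x)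
      rw [card_fiber_of_lt hf.1 (by omega), Finset.card_eq_zero, Finset.filter_eq_empty_iff] at h2
      exact h2 (Finset.mem_univ x) rfl
    · rw [h1, h1]
      exact hf.2 i

theorem isSymmSet_contentSet {r : ℕ} (c d : Fin r → ℤ) : IsSymmSet (contentSet n c d) := by
  intro h hh σ
  exact (mem_contentSet_iff_of_mem hh _).2 fun t => card_fiber_comp h σ.bijective t

theorem sum_content {r : ℕ} {h : Fin n → ℕ} (hr : ∀ x, h x < 2 * r) {M : Type*} [AddCommMonoid M]
    (F : ℕ → M) : ∑ x, F (h x) = ∑ i : Fin r, (#{x | h x = 2 * (i : ℕ)} • F (2 * i) +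
      #{x | h x = 2 * (i : ℕ) + 1} • F (2 * i + 1)) := by
  have h1 : ∑ x, F (h x) = ∑ t ∈ Finset.range (2 * r), #{x | h x = t} • F t := by
    rw [← Finset.sum_fiberwise_of_maps_to (t := Finset.range (2 * r)) (g := h)
      fun x _ => Finset.mem_range.2 (hr x)]
    refine Finset.sum_congr rfl fun t _ => ?_
    rw [← Finset.sum_const]
    exact Finset.sum_congr rfl fun x hx => by rw [(Finset.mem_filter_univ x).1 hx]
  rw [h1, Fin.sum_univ_eq_sum_range (fun i => #{x | h x = 2 * i} • F (2 * i) +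
    #{x | h x = 2 * i + 1} • F (2 * i + 1)) r]
  clear h1 hr
  induction r with
  | zero => simp
  | succ r ih =>
    rw [Finset.sum_range_succ, ← ih, mul_add_one, Finset.sum_range_succ, Finset.sum_range_succ,
      add_assoc]

theorem blockOf_add {N : ℕ} {c : ℕ → ℕ} {b j : ℕ} (hb : b < N) (hj : j < c b) :
    blockOf N c (∑ b' ∈ Finset.range b, c b' + j) = b := by
  have hmono : Monotone fun b => ∑ b' ∈ Finset.range b, c b' :=
    monotone_nat_of_le_succ fun k => by
      rw [Finset.sum_range_succ]
      exact Nat.le_add_right _ _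
  rw [blockOf]
  conv_rhs => rw [← Finset.card_range b]
  congr 1
  ext b'
  rw [Finset.mem_filter, Finset.mem_range, Finset.mem_range]
  constructor
  · rintro ⟨-, h⟩
    by_contra hlt
    have h1 : ∑ b' ∈ Finset.range (b + 1), c b' ≤ ∑ k ∈ Finset.range (b' + 1), c k :=
      hmono (by omega)
    rw [Finset.sum_range_succ] at h1
    omega
  · intro h
    have h1 : ∑ k ∈ Finset.range (b' + 1), c k ≤ ∑ b' ∈ Finset.range b, c b' := hmono h
    exact ⟨by omega, by omega⟩

theorem sum_blockOf {N : ℕ} {c : ℕ → ℕ} (hn : ∑ b ∈ Finset.range N, c b = n) {M : Type*}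
    [AddCommMonoid M] (F : ℕ → ℕ → M) :
    ∑ i : Fin n, F (blockOf N c i) (i - ∑ b ∈ Finset.range (blockOf N c i), c b) =
      ∑ b ∈ Finset.range N, ∑ j ∈ Finset.range (c b), F b j := by
  rw [Fin.sum_univ_eq_sum_range
    (fun i => F (blockOf N c i) (i - ∑ b ∈ Finset.range (blockOf N c i), c b)) n, ← hn]
  have key : ∀ k ≤ N, ∑ i ∈ Finset.range (∑ b ∈ Finset.range k, c b),
      F (blockOf N c i) (i - ∑ b ∈ Finset.range (blockOf N c i), c b) =
      ∑ b ∈ Finset.range k, ∑ j ∈ Finset.range (c b), F b j := by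
    intro k hk
    induction k with
    | zero => simp
    | succ k ih =>
      rw [Finset.sum_range_succ c, Finset.sum_range_add, ih (by omega), Finset.sum_range_succ]
      congr 1
      refine Finset.sum_congr rfl fun j hj => ?_
      rw [blockOf_add (by omega) (Finset.mem_range.1 hj), Nat.add_sub_cancel_left]
  exact key N le_rfl

theorem card_blockOf {N : ℕ} {c : ℕ → ℕ} (hn : ∑ b ∈ Finset.range N, c b = n) {b : ℕ}
    (hb : b < N) : #{i : Fin n | blockOf N c i = b} = c b := by
  rw [Finset.card_filter, sum_blockOf hn (fun b' _ => if b' = b then 1 else 0)]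
  simp [hb]

theorem blockOf_lt {N : ℕ} {c : ℕ → ℕ} (hn : ∑ b ∈ Finset.range N, c b = n) (i : Fin n) :
    blockOf N c i < N := by
  have h := sum_blockOf hn (fun b _ => if b < N then 0 else 1)
  have h1 : ∑ b ∈ Finset.range N, ∑ j ∈ Finset.range (c b), (if b < N then 0 else 1) = 0 :=
    Finset.sum_eq_zero fun b hb => Finset.sum_eq_zero fun _ _ => if_pos (Finset.mem_range.1 hb)
  rw [h1, Finset.sum_eq_zero_iff] at h
  have := h i (Finset.mem_univ i)
  by_contra hlt
  simp [hlt] at this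

theorem epsOn_eq (T : Set (Fin n)) [DecidablePred (· ∈ T)] (π : PG n) :
    epsOn T π = ∏ i, if i ∈ T then sg π i else 1 := by
  rw [epsOn, finprod_eq_prod_of_fintype]
  refine Finset.prod_congr rfl fun i _ => ?_
  rcases apply_inl π i with ⟨a, b⟩ | ⟨a, b⟩ <;> rw [a, b] <;> simp

theorem sg_pow_even (π : PG n) (i : Fin n) (k : ℕ) : sg π i ^ (2 * k) = 1 := by
  rw [pow_mul, pow_two, sg_mul_self, one_pow]

theorem sg_pow_odd (π : PG n) (i : Fin n) (k : ℕ) : sg π i ^ (2 * k + 1) = sg π i := by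
  rw [pow_succ, sg_pow_even, one_mul]

theorem cocyc_conj {x w : PG n} (hx : x ∈ signedPerm n) (hw : w ∈ signedPerm n) {f : Fin n → ℕ}
    (h : (f ∘ ab x) ∘ ab w = f ∘ ab x) : cocyc (x * w * x⁻¹) f = cocyc w (f ∘ ab x) := by
  have h1 : f ∘ ab (x * w) = f ∘ ab x := by
    rw [← h]
    funext i
    simp [ab_mul hx]
  have h2 := cocyc_mul hx (inv_mem hx) f
  rw [mul_inv_cancel, cocyc_one] at h2
  rw [cocyc_mul (mul_mem hx hw) (inv_mem hx), h1, cocyc_mul hx hw]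
  linear_combination (-cocyc w (f ∘ ab x)) * h2

theorem comp_ab_conj_iff {C : Type*} {x w : PG n} (hx : x ∈ signedPerm n)
    (hw : w ∈ signedPerm n) {f : Fin n → C} :
    f ∘ ab (x * w * x⁻¹) = f ↔ (f ∘ ab x) ∘ ab w = f ∘ ab x := by
  have h1 : f ∘ ab (x * w * x⁻¹) = ((f ∘ ab x) ∘ ab w) ∘ ab x⁻¹ := by
    funext i
    simp [ab_mul (mul_mem hx hw), ab_mul hx]
  have h2 : f = (f ∘ ab x) ∘ ab x⁻¹ := by
    funext i
    simp [ab_ab_inv hx]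
  rw [h1]
  conv_lhs => rhs; rw [h2]
  exact (ab_bijective (inv_mem hx)).surjective.injective_comp_right.eq_iff

theorem indChar_blkSub_eq_monoChar {r : ℕ} {c d : Fin r → ℤ} (f f' : Fin n → ℕ)
    (T : Set (Fin n)) (hff : ∀ i j, f' i = f' j ↔ f i = f j)
    (hT : ∀ i, i ∈ T ↔ Odd (f' i)) (hf : f' ∈ contentSet n c d) (w : BWn n) :
    indChar (blkSub n f (fun _ => BTy.B)) (BWn n) (resChar _ (epsOn T)) w =
      monoChar (contentSet n c d) w := by
  classical
  have := Fintype.ofFinite (BWn n)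
  have hw := mem_BWn_iff.1 w.2
  rw [indChar, finsum_eq_sum_of_fintype]
  have hmem : ∀ π, π ∈ blkSub n f (fun _ => BTy.B) ↔ π ∈ signedPerm n ∧ f' ∘ ab π = f' := by
    intro π
    rw [mem_blkSub_B_iff, funext_iff]
    simp only [Function.comp, hff]
  have heps : ∀ π, f' ∘ ab π = f' → epsOn T π = cocyc π f' := by
    intro π hπ
    rw [epsOn_eq, cocyc_of_comp_eq hπ]
    refine Finset.prod_congr rfl fun i _ => ?_
    rcases Nat.even_or_odd' (f' i) with ⟨k, hk | hk⟩
    · rw [if_neg (by rw [hT, hk]; simp), hk, sg_pow_even]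
    · rw [if_pos (by rw [hT, hk]; simp), hk, sg_pow_odd]
  have hterm : ∀ x : BWn n, (if h : ((x : PG n) * w * (x : PG n)⁻¹) ∈
      blkSub n f (fun _ => BTy.B) then resChar (blkSub n f (fun _ => BTy.B)) (epsOn T) ⟨_, h⟩
      else 0) = (fun h : Fin n → ℕ => if h ∘ ab (w : PG n) = h then cocyc (w : PG n) h else 0)
        (f' ∘ ab (x : PG n)) := by
    intro x
    have hx := mem_BWn_iff.1 x.2
    dsimp only
    split_ifs with h1 h2 h2
    · have h3 := ((hmem _).1 h1).2
      rw [resChar, heps _ h3, cocyc_conj hx hw h2]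
    · exact absurd ((comp_ab_conj_iff hx hw).1 ((hmem _).1 h1).2) h2
    · exact absurd ((hmem _).2 ⟨mul_mem (mul_mem hx hw) (inv_mem hx),
        (comp_ab_conj_iff hx hw).2 h2⟩) h1
    · rfl
  rw [Finset.sum_congr rfl fun x _ => hterm x,
    sum_comp_ab (fun _ h => mem_BWn_iff.1 h) (fun σ => mem_BWn_iff.2 (lift_mem σ)) f'
      (contentSet n c d) (mem_contentSet_iff_of_mem hf)
      (fun h => if h ∘ ab (w : PG n) = h then cocyc (w : PG n) h else 0)]
  have hcard : (Nat.card (blkSub n f (fun _ => BTy.B)) : ℂ) =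
      #{k : BWn n | f' ∘ ab (k : PG n) = f'} := by
    have h1 : Nat.card (blkSub n f (fun _ => BTy.B)) =
        Nat.card {k : BWn n // f' ∘ ab (k : PG n) = f'} :=
      Nat.card_congr
        { toFun := fun k => ⟨⟨k, mem_BWn_iff.2 ((hmem _).1 k.2).1⟩, ((hmem _).1 k.2).2⟩
          invFun := fun k => ⟨k.1, (hmem _).2 ⟨mem_BWn_iff.1 k.1.2, k.2⟩⟩
          left_inv := fun k => rfl
          right_inv := fun k => rfl }
    rw [h1, Nat.card_eq_fintype_card, Fintype.card_subtype]
  rw [hcard, ← mul_assoc, inv_mul_cancel₀, one_mul, monoChar, Finset.sum_filter]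
  · refine Finset.sum_congr rfl fun h _ => ?_
    split_ifs with h1
    · rw [cocyc_of_comp_eq h1]
    · rfl
  · have : (1 : BWn n) ∈ ({k : BWn n | f' ∘ ab (k : PG n) = f'} : Finset (BWn n)) := by
      rw [Finset.mem_filter_univ]
      rfl
    exact_mod_cast (Finset.card_pos.2 ⟨_, this⟩).ne'

theorem indPiece_eq_monoChar {r : ℕ} (c d : Fin r → ℤ) (w : BWn n) :
    indPiece n r r c d w = monoChar (contentSet n c d) w := by
  rw [indPiece]
  split_ifs with h
  · obtain ⟨hc, hd, hcd⟩ := h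
    set cs : ℕ → ℕ := fun b =>
      if hb : b < r then (c ⟨b, hb⟩).toNat
      else if hb' : b - r < r then (d ⟨b - r, hb'⟩).toNat else 0 with hcs
    have hcs1 : ∀ i : Fin r, (cs i : ℤ) = c i := fun i => by simp [hcs, hc]
    have hcs2 : ∀ i : Fin r, (cs (r + i) : ℤ) = d i := fun i => by simp [hcs, hd]
    have hsum : ∑ b ∈ Finset.range (r + r), cs b = n := by
      rw [Finset.sum_range_add, ← Fin.sum_univ_eq_sum_range, ← Fin.sum_univ_eq_sum_range]
      zify
      rw [← hcd, Finset.sum_congr rfl fun i _ => hcs1 i, Finset.sum_congr rfl fun i _ => hcs2 i]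
    set f : Fin n → ℕ := fun i => blockOf (r + r) cs i with hf
    have hlt : ∀ i, f i < r + r := fun i => blockOf_lt hsum i
    refine indChar_blkSub_eq_monoChar f
      (fun i => if f i < r then 2 * f i else 2 * (f i - r) + 1) _ (fun i j => ?_) (fun i => ?_)
      (mem_contentSet.2 ⟨fun x => ?_, fun i => ⟨?_, ?_⟩⟩) w
    · have := hlt i
      have := hlt j
      split_ifs <;> omega
    · rw [Set.mem_ofPred_eq]
      split_ifs with h1
      · simp only [Nat.not_odd_iff_even.2 (even_two_mul _), iff_false]
        omega
      · simp only [odd_two_mul_add_one, iff_true]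
        omega
    · have := hlt x
      split_ifs <;> omega
    · rw [← hcs1, ← card_blockOf hsum (by omega : (i : ℕ) < r + r)]
      congr 2
      ext x
      rw [Finset.mem_filter_univ, Finset.mem_filter_univ]
      change _ ↔ f x = i
      split_ifs <;> omega
    · rw [← hcs2, ← card_blockOf hsum (by omega : r + (i : ℕ) < r + r)]
      congr 2
      ext x
      rw [Finset.mem_filter_univ, Finset.mem_filter_univ]
      change _ ↔ f x = r + i
      split_ifs <;> omega
  · have hempty : contentSet n c d = ∅ := by
      rw [Finset.eq_empty_iff_forall_notMem]
      intro x hx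
      rw [mem_contentSet] at hx
      refine h ⟨fun i => ?_, fun i => ?_, ?_⟩
      · rw [← (hx.2 i).1]
        positivity
      · rw [← (hx.2 i).2]
        positivity
      · have h1 := sum_content hx.1 (fun _ => (1 : ℤ))
        simp only [Finset.sum_const, Finset.card_univ, Fintype.card_fin, nsmul_eq_mul, mul_one,
          (hx.2 _).1, (hx.2 _).2, Finset.sum_add_distrib] at h1
        rw [h1]
    rw [hempty, monoChar]
    simp

theorem chiB_eq_sum {r : ℕ} (α β : Fin r → ℤ) (w : BWn n) :
    chiB n r r α β w = ∑ σ : Perm (Fin r) × Perm (Fin r),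
      ((Perm.sign σ.1 * Perm.sign σ.2 : ℤˣ) : ℤ) • monoChar
        (contentSet n (fun i => α i - (i : ℕ) + (σ.1 i : ℕ)) fun i => β i - (i : ℕ) + (σ.2 i : ℕ))
        (w : PG n) := by
  rw [chiB, finsum_eq_sum_of_fintype, Fintype.sum_prod_type]
  refine Finset.sum_congr rfl fun σ _ => ?_
  rw [finsum_eq_sum_of_fintype]
  refine Finset.sum_congr rfl fun τ _ => ?_
  rw [indPiece_eq_monoChar, zsmul_eq_mul, Units.val_mul]

end InducedPieces

section SymmetricPowers

variable {n : ℕ}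

theorem symChar_resChar {G : Type} [Group G] (K : Subgroup G) (χ : G → ℂ) (d : ℕ) (g : K) :
    symChar (resChar K χ) d g = symChar χ d (g : G) := by
  induction d using Nat.strong_induction_on with
  | _ d ih =>
    rcases d with _ | d
    · simp [symChar]
    · rw [symChar, symChar]
      congr 1
      refine Finset.sum_congr rfl fun k _ => ?_
      rw [ih (d - k) (by omega)]
      rfl

theorem ab_pow {w : PG n} (hw : w ∈ signedPerm n) (k : ℕ) (i : Fin n) :
    ab (w ^ k) i = (ab w)^[k] i := by
  induction k with
  | zero => rfl
  | succ k ih => rw [pow_succ', ab_mul hw, ih, Function.iterate_succ_apply']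

theorem sg_pow {w : PG n} (hw : w ∈ signedPerm n) (k : ℕ) (i : Fin n) :
    sg (w ^ k) i = ∏ j ∈ Finset.range k, sg w ((ab w)^[j] i) := by
  induction k with
  | zero => rfl
  | succ k ih => rw [pow_succ', sg_mul hw, ih, ab_pow hw, Finset.prod_range_succ]

/-- The orbit of an index under the powers of a signed permutation. -/
def cycleOf (w : PG n) (i : Fin n) : Finset (Fin n) :=
  (Finset.range (Function.minimalPeriod (ab w) i)).image fun j => (ab w)^[j] i

theorem minimalPeriod_ab_pos {w : PG n} (hw : w ∈ signedPerm n) (i : Fin n) :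
    0 < Function.minimalPeriod (ab w) i :=
  Function.minimalPeriod_pos_of_mem_periodicPts
    ((ab_bijective hw).injective.mem_periodicPts i)

theorem iterate_injOn_minimalPeriod (w : PG n) (i : Fin n) :
    Set.InjOn (fun j => (ab w)^[j] i) (Finset.range (Function.minimalPeriod (ab w) i)) := by
  rw [Finset.coe_range]
  exact Function.iterate_injOn_Iio_minimalPeriod

theorem card_cycleOf (w : PG n) (i : Fin n) :
    #(cycleOf w i) = Function.minimalPeriod (ab w) i := by
  rw [cycleOf, Finset.card_image_of_injOn (iterate_injOn_minimalPeriod w i), Finset.card_range]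

theorem self_mem_cycleOf {w : PG n} (hw : w ∈ signedPerm n) (i : Fin n) : i ∈ cycleOf w i :=
  Finset.mem_image.2 ⟨0, Finset.mem_range.2 (minimalPeriod_ab_pos hw i), rfl⟩

theorem iterate_mem_cycleOf {w : PG n} (hw : w ∈ signedPerm n) (i : Fin n) (k : ℕ) :
    (ab w)^[k] i ∈ cycleOf w i :=
  Finset.mem_image.2 ⟨k % Function.minimalPeriod (ab w) i,
    Finset.mem_range.2 (Nat.mod_lt _ (minimalPeriod_ab_pos hw i)),
    Function.iterate_mod_minimalPeriod_eq⟩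

theorem ab_mem_cycleOf_iff {w : PG n} (hw : w ∈ signedPerm n) (i x : Fin n) :
    ab w x ∈ cycleOf w i ↔ x ∈ cycleOf w i := by
  have h1 : (cycleOf w i).image (ab w) = cycleOf w i := by
    refine Finset.eq_of_subset_of_card_le ?_
      (Finset.card_image_of_injective _ (ab_bijective hw).injective).ge
    intro y hy
    obtain ⟨x, hx, rfl⟩ := Finset.mem_image.1 hy
    obtain ⟨j, -, rfl⟩ := Finset.mem_image.1 hx
    rw [← Function.iterate_succ_apply' (ab w)]
    exact iterate_mem_cycleOf hw i _
  conv_lhs => rw [← h1]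
  exact (ab_bijective hw).injective.mem_finset_image

theorem eq_of_mem_cycleOf {C : Type*} {w : PG n} {h : Fin n → C} (hh : h ∘ ab w = h)
    {i x : Fin n} (hx : x ∈ cycleOf w i) : h x = h i := by
  obtain ⟨j, -, rfl⟩ := Finset.mem_image.1 hx
  clear hx
  induction j with
  | zero => rfl
  | succ j ih =>
    rw [← ih, ← congrFun hh ((ab w)^[j] i), Function.comp, Function.iterate_succ_apply' (ab w)]

theorem sg_pow_mul_minimalPeriod {w : PG n} (hw : w ∈ signedPerm n) (i : Fin n) (m : ℕ) :
    sg (w ^ (m * Function.minimalPeriod (ab w) i)) i = (∏ x ∈ cycleOf w i, sg w x) ^ m := by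
  rw [sg_pow hw, cycleOf, Finset.prod_image (iterate_injOn_minimalPeriod w i)]
  induction m with
  | zero => simp
  | succ m ih =>
    rw [add_one_mul, Finset.prod_range_add, ih, pow_succ]
    congr 1
    refine Finset.prod_congr rfl fun j _ => ?_
    rw [add_comm, Function.iterate_add_apply]
    congr 2
    exact ((Function.isPeriodicPt_minimalPeriod (ab w) i).const_mul m)

theorem sum_monomials_eq (d : ℕ) {w : PG n} (hw : w ∈ signedPerm n) (i : Fin n) :
    ∑ h ∈ Finset.piAntidiag Finset.univ (d + 1) with h ∘ ab w = h,
        ∑ _m ∈ Finset.range (h i), ∏ x, sg w x ^ h x =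
      ∑ k ∈ Finset.range (d + 1) with ab (w ^ (k + 1)) i = i,
        ∑ h ∈ Finset.piAntidiag Finset.univ (d - k) with h ∘ ab w = h,
          sg (w ^ (k + 1)) i * ∏ x, sg w x ^ h x := by
  set O := cycleOf w i with hO
  set L := Function.minimalPeriod (ab w) i with hL
  have hLpos : 0 < L := minimalPeriod_ab_pos hw i
  have hiO : i ∈ O := self_mem_cycleOf hw i
  have hper : ∀ k, ab (w ^ k) i = i ↔ L ∣ k := fun k => by
    rw [ab_pow hw]
    exact Function.isPeriodicPt_iff_minimalPeriod_dvd
  have hind : (fun x => if x ∈ O then 1 else 0 : Fin n → ℕ) ∘ ab w =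
      fun x => if x ∈ O then 1 else 0 := by
    funext x
    simp only [Function.comp, hO, ab_mem_cycleOf_iff hw]
  have hsumO : ∀ m : ℕ, ∑ x : Fin n, (if x ∈ O then m else 0) = m * L := fun m => by
    rw [Finset.sum_ite_mem, Finset.univ_inter, Finset.sum_const, hO, card_cycleOf, smul_eq_mul,
      mul_comm]
  rw [Finset.sum_sigma', Finset.sum_sigma']
  refine Finset.sum_bij'
    (fun p _ => ⟨(p.2 + 1) * L - 1, fun x => p.1 x - if x ∈ O then p.2 + 1 else 0⟩)
    (fun p _ => ⟨fun x => p.2 x + if x ∈ O then (p.1 + 1) / L else 0, (p.1 + 1) / L - 1⟩)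
    ?_ ?_ ?_ ?_ ?_
  · rintro ⟨h, m⟩ hp
    simp only [Finset.mem_sigma, Finset.mem_filter, Finset.mem_piAntidiag, Finset.mem_range] at hp
    obtain ⟨⟨⟨hs, -⟩, hinv⟩, hm⟩ := hp
    have hpos : 0 < (m + 1) * L := by positivity
    have hle : ∀ x, (if x ∈ O then m + 1 else 0) ≤ h x := by
      intro x
      split_ifs with hx
      · rw [eq_of_mem_cycleOf hinv hx]
        omega
      · omega
    have hsub : ∑ x, (h x - if x ∈ O then m + 1 else 0) + (m + 1) * L = d + 1 := by
      rw [← hs, ← hsumO, ← Finset.sum_add_distrib]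
      exact Finset.sum_congr rfl fun x _ => Nat.sub_add_cancel (hle x)
    simp only [Finset.mem_sigma, Finset.mem_filter, Finset.mem_piAntidiag, Finset.mem_range]
    refine ⟨⟨by omega, ?_⟩, ⟨by omega, by simp⟩, ?_⟩
    · rw [Nat.sub_add_cancel hpos, hper]
      exact dvd_mul_left _ _
    · funext x
      have h1 := congrFun hinv x
      simp only [Function.comp] at h1 ⊢
      rw [h1]
      simp only [hO, ab_mem_cycleOf_iff hw]
  · rintro ⟨k, h⟩ hp
    simp only [Finset.mem_sigma, Finset.mem_filter, Finset.mem_piAntidiag, Finset.mem_range] at hp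
    obtain ⟨⟨hk, hp⟩, ⟨hs, -⟩, hinv⟩ := hp
    obtain ⟨m, hm⟩ := (hper _).1 hp
    have hdiv : (k + 1) / L = m := by rw [hm, Nat.mul_div_cancel_left _ hLpos]
    have hmpos : 0 < m := by
      rcases Nat.eq_zero_or_pos m with h0 | h0
      · rw [h0] at hm
        omega
      · exact h0
    simp only [Finset.mem_sigma, Finset.mem_filter, Finset.mem_piAntidiag, Finset.mem_range, hdiv,
      if_pos hiO]
    refine ⟨⟨⟨?_, by simp⟩, ?_⟩, by omega⟩
    · rw [Finset.sum_add_distrib, hs, hsumO, mul_comm, ← hm]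
      omega
    · funext x
      have h1 := congrFun hinv x
      simp only [Function.comp] at h1 ⊢
      rw [h1]
      simp only [hO, ab_mem_cycleOf_iff hw]
  · rintro ⟨h, m⟩ hp
    simp only [Finset.mem_sigma, Finset.mem_filter, Finset.mem_piAntidiag, Finset.mem_range] at hp
    obtain ⟨⟨⟨hs, -⟩, hinv⟩, hm⟩ := hp
    have hpos : 0 < (m + 1) * L := by positivity
    have hdiv : ((m + 1) * L - 1 + 1) / L = m + 1 := by
      rw [Nat.sub_add_cancel hpos, Nat.mul_div_cancel _ hLpos]
    simp only [hdiv, Nat.add_sub_cancel]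
    congr 1
    funext x
    split_ifs with hx
    · rw [eq_of_mem_cycleOf hinv hx]
      omega
    · rfl
  · rintro ⟨k, h⟩ hp
    simp only [Finset.mem_sigma, Finset.mem_filter, Finset.mem_piAntidiag, Finset.mem_range] at hp
    obtain ⟨⟨hk, hp⟩, ⟨hs, -⟩, hinv⟩ := hp
    obtain ⟨m, hm⟩ := (hper _).1 hp
    have hdiv : (k + 1) / L = m := by rw [hm, Nat.mul_div_cancel_left _ hLpos]
    have hmpos : 0 < m := by
      rcases Nat.eq_zero_or_pos m with h0 | h0
      · rw [h0] at hm
        omega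
      · exact h0
    have hm1 : m - 1 + 1 = m := by omega
    simp only [hdiv, hm1]
    congr 1
    · rw [mul_comm, ← hm, Nat.add_sub_cancel]
    · funext x
      exact Nat.add_sub_cancel _ _
  · rintro ⟨h, m⟩ hp
    simp only [Finset.mem_sigma, Finset.mem_filter, Finset.mem_piAntidiag, Finset.mem_range] at hp
    obtain ⟨⟨⟨hs, -⟩, hinv⟩, hm⟩ := hp
    have hpos : 0 < (m + 1) * L := by positivity
    dsimp only
    rw [Nat.sub_add_cancel hpos, sg_pow_mul_minimalPeriod hw, ← Finset.prod_pow, ← hO,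
      ← Finset.univ_inter O, ← Finset.prod_ite_mem, ← Finset.prod_mul_distrib]
    refine Finset.prod_congr rfl fun x _ => ?_
    rw [Finset.univ_inter]
    split_ifs with hx
    · rw [← pow_add, eq_of_mem_cycleOf hinv hx]
      congr 1
      omega
    · rw [one_mul, Nat.sub_zero]

/-- The symmetric powers of the reflection representation are spanned by monomials. -/
theorem symChar_reflChar (d : ℕ) {w : PG n} (hw : w ∈ signedPerm n) :
    symChar reflChar d w = monoChar (Finset.piAntidiag Finset.univ d) w := by
  induction d using Nat.strong_induction_on with
  | _ d ih =>
    rcases d with _ | d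
    · rw [symChar, monoChar, Finset.piAntidiag_zero, Finset.filter_singleton,
        if_pos (by rfl)]
      simp
    · rw [symChar, inv_mul_eq_iff_eq_mul₀ (by exact_mod_cast d.succ_ne_zero)]
      have h1 : ∀ k ∈ Finset.range (d + 1), reflChar (w ^ (k + 1)) * symChar reflChar (d - k) w =
          ∑ i, if ab (w ^ (k + 1)) i = i then
            ∑ h ∈ Finset.piAntidiag Finset.univ (d - k) with h ∘ ab w = h,
              sg (w ^ (k + 1)) i * ∏ x, sg w x ^ h x else 0 := by
        intro k _
        rw [ih (d - k) (by omega), reflChar_eq, Finset.sum_mul, monoChar]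
        refine Finset.sum_congr rfl fun i _ => ?_
        rw [ite_mul, zero_mul, Finset.mul_sum]
      rw [Finset.sum_congr rfl h1, Finset.sum_comm]
      simp only [← Finset.sum_filter]
      rw [Finset.sum_congr rfl fun i _ => (sum_monomials_eq d hw i).symm, Finset.sum_comm, monoChar,
        Finset.mul_sum]
      refine Finset.sum_congr rfl fun h hh => ?_
      rw [Finset.mem_filter, Finset.mem_piAntidiag] at hh
      simp only [Finset.sum_const, Finset.card_range, nsmul_eq_mul]
      rw [← Finset.sum_mul, ← Nat.cast_sum, hh.1.1]
      push_cast
      rfl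

theorem isSymmSet_piAntidiag (d : ℕ) :
    IsSymmSet (Finset.piAntidiag (Finset.univ : Finset (Fin n)) d) := by
  intro h hh σ
  rw [Finset.mem_piAntidiag] at hh ⊢
  exact ⟨by rw [← hh.1]; exact Equiv.sum_comp σ h, by simp⟩

end SymmetricPowers

section MinimalDegree

variable {n : ℕ}

theorem sum_range_card_le_sum (T : Finset ℕ) :
    ∑ j ∈ Finset.range #T, j ≤ ∑ t ∈ T, t ∧
      (∑ t ∈ T, t = ∑ j ∈ Finset.range #T, j → T = Finset.range #T) := by
  induction hN : #T generalizing T with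
  | zero =>
    rw [Finset.card_eq_zero] at hN
    simp [hN]
  | succ N ih =>
    have hne : T.Nonempty := Finset.card_pos.1 (by omega)
    set m := T.max' hne with hm
    have hmT : m ∈ T := T.max'_mem hne
    have hsub : T ⊆ Finset.range (m + 1) := fun t ht =>
      Finset.mem_range.2 (Nat.lt_succ_of_le (T.le_max' t ht))
    have hcard := Finset.card_le_card hsub
    rw [Finset.card_range] at hcard
    have h1 := ih (T.erase m) (by rw [Finset.card_erase_of_mem hmT]; omega)
    have h2 := Finset.add_sum_erase T (fun t => t) hmT
    rw [Finset.sum_range_succ]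
    refine ⟨by omega, fun h => ?_⟩
    have h3 : m = N := by omega
    exact Finset.eq_of_subset_of_card_le (by rwa [h3] at hsub) (by simp [hN])

theorem le_sum_of_injOn {s : Finset (Fin n)} {h : Fin n → ℕ} (hinj : Set.InjOn h s) :
    ∑ j ∈ Finset.range #s, j ≤ ∑ i ∈ s, h i ∧
      (∑ i ∈ s, h i = ∑ j ∈ Finset.range #s, j → s.image h = Finset.range #s) := by
  have h1 := sum_range_card_le_sum (s.image h)
  rwa [Finset.card_image_of_injOn hinj, Finset.sum_image hinj] at h1

theorem le_sum_of_injOn_of_parity {s : Finset (Fin n)} {h : Fin n → ℕ} (hinj : Set.InjOn h s)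
    (hpar : ∀ i ∈ s, ∀ j ∈ s, Even (h i + h j)) :
    ∑ j ∈ Finset.range #s, 2 * j ≤ ∑ i ∈ s, h i ∧
      (∑ i ∈ s, h i = ∑ j ∈ Finset.range #s, 2 * j →
        s.image h = (Finset.range #s).image fun j => 2 * j) := by
  rcases s.eq_empty_or_nonempty with rfl | ⟨i₀, hi₀⟩
  · simp
  have hmod : ∀ i ∈ s, h i = 2 * (h i / 2) + h i₀ % 2 := fun i hi => by
    have := hpar i hi i₀ hi₀
    rw [Nat.even_iff] at this
    omega
  have hinj' : Set.InjOn (fun i => h i / 2) s := fun i hi j hj hij => hinj hi hj (by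
    dsimp only at hij
    rw [hmod i hi, hmod j hj, hij])
  have h1 := le_sum_of_injOn hinj'
  have h2 : ∑ i ∈ s, h i = 2 * ∑ i ∈ s, h i / 2 + #s * (h i₀ % 2) := by
    rw [Finset.sum_congr rfl hmod, Finset.sum_add_distrib, Finset.mul_sum, Finset.sum_const,
      smul_eq_mul]
  have hpos : 0 < #s := Finset.card_pos.2 ⟨_, hi₀⟩
  rw [← Finset.mul_sum, h2]
  refine ⟨by omega, fun h3 => ?_⟩
  have h4 : #s * (h i₀ % 2) = 0 := by omega
  have h5 : h i₀ % 2 = 0 := by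
    rcases Nat.mul_eq_zero.1 h4 with h5 | h5
    · omega
    · exact h5
  rw [← h1.2 (by omega), Finset.image_image]
  refine Finset.image_congr fun i hi => ?_
  have h6 := hmod i hi
  rw [h5, add_zero] at h6
  exact h6

/-- The step between consecutive exponents in the minimal sign-semi-invariant of a block. -/
def stepOf : BTy → ℕ
  | BTy.D => 2
  | _ => 1

/-- The least degree of a sign-semi-invariant for consecutive blocks of sizes `c`. -/
def minDegree (N : ℕ) (c : ℕ → ℕ) (g : ℕ → BTy) : ℕ :=
  ∑ b ∈ Finset.range N, ∑ j ∈ Finset.range (c b), stepOf (g b) * j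

/-- The exponents of the leading monomial of the minimal sign-semi-invariant. -/
def minExponent (n N : ℕ) (c : ℕ → ℕ) (g : ℕ → BTy) (i : Fin n) : ℕ :=
  stepOf (g (blockOf N c i)) * (i - ∑ b ∈ Finset.range (blockOf N c i), c b)

variable {N : ℕ} {c : ℕ → ℕ} {g : ℕ → BTy}

theorem sum_minExponent (hn : ∑ b ∈ Finset.range N, c b = n) :
    ∑ i, minExponent n N c g i = minDegree N c g :=
  sum_blockOf hn fun b j => stepOf (g b) * j

theorem card_minExponent (hn : ∑ b ∈ Finset.range N, c b = n) (t : ℕ) :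
    #{i | minExponent n N c g i = t} =
      ∑ b ∈ Finset.range N, #{j ∈ Finset.range (c b) | stepOf (g b) * j = t} := by
  rw [Finset.card_filter]
  exact (sum_blockOf hn fun b j => if stepOf (g b) * j = t then 1 else 0).trans
    (Finset.sum_congr rfl fun b _ => (Finset.card_filter _ _).symm)

/-- Exponents that are admissible for a sign-semi-invariant: distinct on the blocks, and of
constant parity on blocks of type `D`. -/
def Admissible (f : Fin n → ℕ) (g : ℕ → BTy) (h : Fin n → ℕ) : Prop :=
  (∀ i j, f i = f j → i ≠ j → h i ≠ h j) ∧
    ∀ i j, f i = f j → g (f i) = BTy.D → Even (h i + h j)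

theorem stepOf_pos (t : BTy) : 0 < stepOf t := by
  cases t <;> simp [stepOf]

theorem blockOf_spec (hn : ∑ b ∈ Finset.range N, c b = n) (i : Fin n) :
    ∑ b ∈ Finset.range (blockOf N c i), c b ≤ i := by
  set s := ∑ b ∈ Finset.range (blockOf N c i), c b with hs
  by_contra hlt
  push Not at hlt
  have hN := blockOf_lt hn i
  have h1 : blockOf N c i = #{b ∈ Finset.range N | ∑ b' ∈ Finset.range (b + 1), c b' ≤ (i : ℕ)} :=
    rfl
  have hmono : Monotone fun b => ∑ b' ∈ Finset.range b, c b' :=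
    monotone_nat_of_le_succ fun k => by
      rw [Finset.sum_range_succ]
      exact Nat.le_add_right _ _
  have h2 : ({b ∈ Finset.range N | ∑ b' ∈ Finset.range (b + 1), c b' ≤ (i : ℕ)} : Finset ℕ) ⊆
      Finset.range (blockOf N c i - 1) := by
    intro b hb
    rw [Finset.mem_filter] at hb
    rw [Finset.mem_range]
    by_contra hb'
    have : s ≤ ∑ b' ∈ Finset.range (b + 1), c b' := hmono (by omega)
    omega
  have h3 := Finset.card_le_card h2
  rw [Finset.card_range, ← h1] at h3
  have h4 : blockOf N c i = 0 := by omega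
  rw [hs, h4] at hlt
  simp at hlt

theorem admissible_minExponent (hn : ∑ b ∈ Finset.range N, c b = n) :
    Admissible (fun i : Fin n => blockOf N c i) g (minExponent n N c g) := by
  refine ⟨fun i j hf hij h => hij ?_, fun i j hf hD => ?_⟩
  · dsimp only at hf
    have hi := blockOf_spec hn i
    have hj := blockOf_spec hn j
    rw [minExponent, minExponent, hf] at h
    rw [hf] at hi
    have := Nat.eq_of_mul_eq_mul_left (stepOf_pos _) h
    exact Fin.ext (by omega)
  · dsimp only at hf hD
    rw [minExponent, minExponent, ← hf, hD, stepOf, ← mul_add]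
    exact even_two_mul _

theorem Admissible.le_sum (hn : ∑ b ∈ Finset.range N, c b = n) {h : Fin n → ℕ}
    (ha : Admissible (fun i : Fin n => blockOf N c i) g h) :
    minDegree N c g ≤ ∑ i, h i ∧ (∑ i, h i = minDegree N c g → ∀ b < N,
      Finset.image h {i : Fin n | blockOf N c i = b} =
        (Finset.range (c b)).image fun j => stepOf (g b) * j) := by
  have hblock : ∀ b ∈ Finset.range N,
      ∑ j ∈ Finset.range (c b), stepOf (g b) * j ≤
        ∑ i ∈ ({i | blockOf N c i = b} : Finset (Fin n)), h i ∧
      (∑ i ∈ ({i | blockOf N c i = b} : Finset (Fin n)), h i =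
        ∑ j ∈ Finset.range (c b), stepOf (g b) * j →
        Finset.image h {i : Fin n | blockOf N c i = b} =
        (Finset.range (c b)).image fun j => stepOf (g b) * j) := by
    intro b hb
    have hinj : Set.InjOn h ({i | blockOf N c i = b} : Finset (Fin n)) := by
      intro i hi j hj hij
      rw [Finset.mem_coe, Finset.mem_filter_univ] at hi hj
      by_contra hne
      exact ha.1 i j (hi.trans hj.symm) hne hij
    rw [← card_blockOf hn (Finset.mem_range.1 hb)]
    by_cases hD : g b = BTy.D
    · rw [hD]
      refine le_sum_of_injOn_of_parity hinj fun i hi j hj => ?_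
      rw [Finset.mem_filter_univ] at hi hj
      exact ha.2 i j (hi.trans hj.symm) (by dsimp only; rw [hi, hD])
    · have h1 : stepOf (g b) = 1 := by
        cases hg : g b <;> simp_all [stepOf]
      simp only [h1, one_mul, Finset.image_id']
      exact le_sum_of_injOn hinj
  have hsum : ∑ i, h i = ∑ b ∈ Finset.range N,
      ∑ i ∈ ({i | blockOf N c i = b} : Finset (Fin n)), h i :=
    (Finset.sum_fiberwise_of_maps_to (fun i _ => Finset.mem_range.2 (blockOf_lt hn i)) h).symm
  rw [hsum]
  refine ⟨Finset.sum_le_sum fun b hb => (hblock b hb).1, fun heq b hb => ?_⟩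
  have h1 := (Finset.sum_eq_sum_iff_of_le fun b hb => (hblock b hb).1).1 heq.symm
  exact (hblock b (Finset.mem_range.2 hb)).2 (h1 b (Finset.mem_range.2 hb)).symm

/-- Admissible exponents of minimal degree are unique up to permutations within the blocks. -/
theorem exists_perm_of_admissible (hn : ∑ b ∈ Finset.range N, c b = n) {h h' : Fin n → ℕ}
    (ha : Admissible (fun i : Fin n => blockOf N c i) g h)
    (ha' : Admissible (fun i : Fin n => blockOf N c i) g h')
    (hs : ∑ i, h i = minDegree N c g) (hs' : ∑ i, h' i = minDegree N c g) :
    ∃ σ : Perm (Fin n), (∀ i, blockOf N c (σ i) = blockOf N c i) ∧ ∀ i, h' (σ i) = h i := by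
  have hcard : ∀ {k : Fin n → ℕ}, Admissible (fun i : Fin n => blockOf N c i) g k →
      ∑ i, k i = minDegree N c g → ∀ p : ℕ × ℕ, #{i : Fin n | (blockOf N c i, k i) = p} =
        if p.1 < N ∧ p.2 ∈ (Finset.range (c p.1)).image (fun j => stepOf (g p.1) * j)
          then 1 else 0 := by
    rintro k hk hks ⟨b, t⟩
    split_ifs with hp
    · rw [← (hk.le_sum hn).2 hks b hp.1, Finset.mem_image] at hp
      obtain ⟨-, i, hi, hit⟩ := hp
      rw [Finset.mem_filter_univ] at hi
      dsimp only at hit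
      rw [Finset.card_eq_one]
      refine ⟨i, ?_⟩
      ext j
      rw [Finset.mem_filter_univ, Finset.mem_singleton, Prod.mk.injEq]
      constructor
      · rintro ⟨h1, h2⟩
        by_contra hne
        exact hk.1 j i (h1.trans hi.symm) hne (by rw [h2, hit])
      · rintro rfl
        exact ⟨hi, hit⟩
    · rw [Finset.card_eq_zero, Finset.filter_eq_empty_iff]
      intro i _ hi
      rw [Prod.mk.injEq] at hi
      have hb : b < N := hi.1 ▸ blockOf_lt hn i
      refine hp ⟨hb, ?_⟩
      rw [← (hk.le_sum hn).2 hks b hb]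
      exact Finset.mem_image.2 ⟨i, by rw [Finset.mem_filter_univ]; exact hi.1, hi.2⟩
  obtain ⟨σ, hσ⟩ := exists_perm_of_card_fiber_eq
    (f := fun i : Fin n => (blockOf N c i, h i)) (g := fun i : Fin n => (blockOf N c i, h' i))
    fun p => by rw [hcard ha hs, hcard ha' hs']
  simp only [Prod.mk.injEq] at hσ
  exact ⟨σ, fun i => (hσ i).1, fun i => (hσ i).2⟩

/-- The product of the type `A` and type `D` reflection groups on consecutive blocks. -/
abbrev blkGroup (n N : ℕ) (c : ℕ → ℕ) (g : ℕ → BTy) : Subgroup (PG n) :=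
  blkSub n (fun i => blockOf N c i) fun i => g (blockOf N c i)

theorem admissible_of_semiinvariant {hK : blkGroup n N c g ≤ signedPerm n}
    {Y : Finset (Fin n → ℕ)} {hY : IsSymmSet Y} {v : Y → ℂ}
    (hv : ∀ k, monoRep hK hY k v = sgnHom hK k • v) {h : Y} (h0 : v h ≠ 0) :
    Admissible (fun i : Fin n => blockOf N c i) g h := by
  refine ⟨fun i j hf hij => ne_of_semiinvariant_ne_zero hv h0 hf hij, fun i j hf hD =>
    parity_of_semiinvariant_ne_zero hv h0 hf hD ?_⟩
  dsimp only at hf hD ⊢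
  rw [← hf, hD]

theorem cinner_monoChar_sgn_eq_zero (hn : ∑ b ∈ Finset.range N, c b = n)
    {Y : Finset (Fin n → ℕ)} (hY : IsSymmSet Y) (hdeg : ∀ h ∈ Y, ∑ i, h i < minDegree N c g) :
    cinner (resChar (blkGroup n N c g) (monoChar Y)) (resChar _ sgnChar) = 0 := by
  have hK : blkGroup n N c g ≤ signedPerm n := blkSub_le_signedPerm _ _
  by_contra hne
  rw [← monoRep_character hK hY, ← sgnHom_coe hK] at hne
  obtain ⟨v, hv0, hv⟩ := exists_semiinvariant hne
  refine hv0 (funext fun h => ?_)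
  by_contra h0
  have h1 := ((admissible_of_semiinvariant hv h0).le_sum hn).1
  have h2 := hdeg h h.2
  omega

theorem cinner_monoChar_sgn_ne_zero (hn : ∑ b ∈ Finset.range N, c b = n)
    (hB : ∀ b, g b ≠ BTy.B) {Y : Finset (Fin n → ℕ)} (hY : IsSymmSet Y)
    (hmem : minExponent n N c g ∈ Y) :
    cinner (resChar (blkGroup n N c g) (monoChar Y)) (resChar _ sgnChar) ≠ 0 := by
  have hK : blkGroup n N c g ≤ signedPerm n := blkSub_le_signedPerm _ _
  rw [← monoRep_character hK hY, ← sgnHom_coe hK]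
  obtain ⟨v, hv0, hv⟩ := exists_semiinvariant_monoRep hK hY (sgnHom hK) hmem fun k hk => by
    obtain ⟨h1, h2, h3⟩ := blkSub_mem_of_no_B g (fun _ => rfl) (fun i => hB _) k.2
    have hab : ∀ i, ab (k : PG n) i = i := fun i => by
      by_contra hne
      exact (admissible_minExponent hn).1 _ _ (h1 i) hne (congrFun hk i)
    change _ = sgnChar (k : PG n)
    rw [cocyc_of_comp_eq hk, sgnChar_of_ab_eq hab, h3]
    refine Finset.prod_eq_one fun i _ => ?_
    by_cases hD : g (blockOf N c i) = BTy.D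
    · rw [minExponent, hD, stepOf, sg_pow_even]
    · rw [h2 i hD, one_pow]
  exact cinner_ne_zero_of_semiinvariant hv0 hv

theorem cinner_monoChar_sgn_eq_one (hn : ∑ b ∈ Finset.range N, c b = n)
    (hB : ∀ b, g b ≠ BTy.B) {Y : Finset (Fin n → ℕ)} (hY : IsSymmSet Y)
    (hmem : minExponent n N c g ∈ Y) (hdeg : ∀ h ∈ Y, ∑ i, h i = minDegree N c g) :
    cinner (resChar (blkGroup n N c g) (monoChar Y)) (resChar _ sgnChar) = 1 := by
  have h0 := cinner_monoChar_sgn_ne_zero hn hB hY hmem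
  have hK : blkGroup n N c g ≤ signedPerm n := blkSub_le_signedPerm _ _
  rw [← monoRep_character hK hY, ← sgnHom_coe hK] at h0 ⊢
  refine cinner_linear_eq_one h0 (LinearMap.proj ⟨_, hmem⟩) fun v hv hv0 => funext fun h => ?_
  by_contra hne
  obtain ⟨σ, hσ, hσh⟩ := exists_perm_of_admissible hn (admissible_minExponent hn)
    (admissible_of_semiinvariant hv hne) (sum_minExponent hn) (hdeg h h.2)
  have h1 := semiinvariant_apply hv ⟨lift σ, lift_mem_blkSub _ _ σ hσ⟩ h
  have h2 : (h : Fin n → ℕ) ∘ ab (lift σ) = minExponent n N c g := funext hσh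
  simp only [h2, cocyc_lift, one_mul] at h1
  rw [LinearMap.proj_apply] at hv0
  rw [hv0] at h1
  have h3 := sgnChar_eq (lift σ) σ fun _ => rfl
  rw [prod_sg_lift, mul_one] at h3
  change 0 = sgnChar (lift σ) * v h at h1
  rw [h3] at h1
  rcases mul_eq_zero.1 h1.symm with h4 | h4
  · norm_cast at h4
    exact (Perm.sign σ).ne_zero h4
  · exact hne h4

end MinimalDegree

section CauchyDeterminant

open Matrix

/-- Cauchy's determinant identity, for the matrix of the inverses of `1 - x i * y j`. -/
theorem det_cauchy {R : Type*} [CommRing R] : ∀ {r : ℕ} (x y : Fin r → R)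
    (g : Matrix (Fin r) (Fin r) R), (∀ i j, g i j * (1 - x i * y j) = 1) →
    g.det = (vandermonde x).det * (vandermonde y).det * ∏ i, ∏ j, g i j
  | 0, x, y, g, _ => by simp
  | r + 1, x, y, g, hg => by
    have ih := det_cauchy (fun i => x i.succ) (fun i => y i.succ)
      (Matrix.of fun i j => g i.succ j.succ) fun i j => hg _ _
    set B : Matrix (Fin (r + 1)) (Fin (r + 1)) R :=
      Matrix.of fun i j => Fin.cases 1 (fun i' => y j * g i'.succ j) i with hB
    set u : Fin (r + 1) → R := Fin.cases 1 fun i => x i.succ - x 0 with hu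
    have h1 : g.det = (Matrix.of fun i j => u i * (g 0 j * B i j) : Matrix _ _ R).det := by
      refine det_eq_of_forall_row_eq_smul_add_const (Fin.cases 0 fun _ => 1) 0 rfl fun i j => ?_
      refine Fin.cases ?_ (fun i => ?_) i
      · simp [hB, hu]
      · simp only [hB, hu, Matrix.of_apply, Fin.cases_succ, Fin.cases_zero]
        linear_combination g 0 j * hg i.succ j - g i.succ j * hg 0 j
    have h2 : (Matrix.of fun i j => u i * (g 0 j * B i j) : Matrix _ _ R).det =
        (∏ i, u i) * ((∏ j, g 0 j) * B.det) := by
      rw [← det_mul_row, ← det_mul_column]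
      rfl
    have h3 : B.det = (Matrix.of fun i j =>
        Fin.cases (Fin.cases (1 : R) (fun _ => 0) j)
          (fun i' => Fin.cases (y 0 * g i'.succ 0)
            (fun j' => (y j'.succ - y 0) * (g i'.succ 0 * g i'.succ j'.succ)) j) i :
          Matrix (Fin (r + 1)) (Fin (r + 1)) R).det := by
      rw [← det_transpose, ← det_transpose (Matrix.of _)]
      refine det_eq_of_forall_row_eq_smul_add_const (Fin.cases 0 fun _ => 1) 0 rfl fun j i => ?_
      refine Fin.cases ?_ (fun i => ?_) i <;> refine Fin.cases ?_ (fun j => ?_) j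
      · simp [hB]
      · simp [hB]
      · simp [hB]
      · simp only [hB, Matrix.transpose_apply, Matrix.of_apply, Fin.cases_succ, Fin.cases_zero]
        linear_combination y 0 * g i.succ 0 * hg i.succ j.succ -
          y j.succ * g i.succ j.succ * hg i.succ 0
    have h4 : (Matrix.of fun i j =>
        Fin.cases (Fin.cases (1 : R) (fun _ => 0) j)
          (fun i' => Fin.cases (y 0 * g i'.succ 0)
            (fun j' => (y j'.succ - y 0) * (g i'.succ 0 * g i'.succ j'.succ)) j) i :
          Matrix (Fin (r + 1)) (Fin (r + 1)) R).det =
        (∏ j : Fin r, (y j.succ - y 0)) * ((∏ i : Fin r, g i.succ 0) *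
          (Matrix.of fun i j : Fin r => g i.succ j.succ).det) := by
      rw [det_succ_row_zero, Fin.sum_univ_succ, Finset.sum_eq_zero fun j _ => by simp, add_zero,
        ← det_mul_column, ← det_mul_row]
      simp only [Fin.val_zero, pow_zero, one_mul, Matrix.of_apply, Fin.cases_zero]
      rfl
    rw [h1, h2, h3, h4, ih, det_vandermonde, det_vandermonde, det_vandermonde, det_vandermonde]
    simp only [Fin.prod_univ_succ, Fin.prod_Ioi_zero, Fin.prod_Ioi_succ, hu, Fin.cases_succ,
      Fin.cases_zero, Matrix.of_apply, Finset.prod_mul_distrib]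
    ring

end CauchyDeterminant

section MatrixCount

open MvPolynomial

variable {r : ℕ}

theorem coeff_prod_X_pow (u v l : Fin r → ℕ) :
    coeff (Finsupp.equivFunOnFinite.symm (Sum.elim l l))
      ((∏ i, X (Sum.inl i) ^ u i) * ∏ j, X (Sum.inr j) ^ v j :
        MvPolynomial (Fin r ⊕ Fin r) ℤ) = if u = l ∧ v = l then 1 else 0 := by
  have h1 : ((∏ i, X (Sum.inl i) ^ u i) * ∏ j, X (Sum.inr j) ^ v j :
      MvPolynomial (Fin r ⊕ Fin r) ℤ) =
      monomial (Finsupp.equivFunOnFinite.symm (Sum.elim u v)) 1 := by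
    rw [monomial_eq, map_one, one_mul, Finsupp.prod_fintype _ _ fun _ => pow_zero _,
      Fintype.prod_sum_type]
    rfl
  have h2 : Finsupp.equivFunOnFinite.symm (Sum.elim u v) =
      Finsupp.equivFunOnFinite.symm (Sum.elim l l) ↔ u = l ∧ v = l := by
    rw [EmbeddingLike.apply_eq_iff_eq]
    exact ⟨fun h => ⟨funext fun i => congrFun h (Sum.inl i),
      funext fun i => congrFun h (Sum.inr i)⟩,
      fun h => by rw [h.1, h.2]⟩
  rw [h1, coeff_monomial]
  exact if_congr h2 rfl rfl

/-- The truncated geometric series in `x i * y j`. -/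
def truncGeom (r M : ℕ) : Matrix (Fin r) (Fin r) (MvPolynomial (Fin r ⊕ Fin r) ℤ) :=
  Matrix.of fun i j => ∑ k ∈ Finset.range M, (X (Sum.inl i) * X (Sum.inr j)) ^ k

theorem coeff_det_truncGeom {M : ℕ} {l : Fin r → ℕ} (hl : Function.Injective l)
    (hM : ∀ i, l i < M) :
    coeff (Finsupp.equivFunOnFinite.symm (Sum.elim l l)) (truncGeom r M).det = 1 := by
  have h1 : ∀ π : Perm (Fin r), coeff (Finsupp.equivFunOnFinite.symm (Sum.elim l l))
      (∏ i, truncGeom r M (π i) i) = if π = 1 then 1 else 0 := by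
    intro π
    simp only [truncGeom, Matrix.of_apply]
    rw [Finset.prod_univ_sum, coeff_sum]
    have h2 : ∀ k : Fin r → ℕ, (∏ i, (X (Sum.inl (π i)) * X (Sum.inr i)) ^ k i :
        MvPolynomial (Fin r ⊕ Fin r) ℤ) =
        (∏ i, X (Sum.inl i) ^ (k ∘ π.symm) i) * ∏ j, X (Sum.inr j) ^ k j := by
      intro k
      simp only [mul_pow, Finset.prod_mul_distrib]
      congr 1
      exact Fintype.prod_equiv π _ _ fun i => by simp
    simp only [h2, coeff_prod_X_pow]
    rw [Finset.sum_eq_single l]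
    · have h3 : l ∘ π.symm = l ↔ π = 1 := by
        constructor
        · intro h
          ext i
          have h4 := congrFun h (π i)
          rw [Function.comp_apply, Equiv.symm_apply_apply] at h4
          rw [← hl h4, Perm.one_apply]
        · rintro rfl
          rfl
      exact if_congr (by rw [h3, and_iff_left rfl]) rfl rfl
    · intro k _ hk
      rw [if_neg fun h => hk h.2]
    · intro h
      exact absurd (Fintype.mem_piFinset.2 fun i => Finset.mem_range.2 (hM i)) h
  rw [Matrix.det_apply, coeff_sum]
  simp only [Units.smul_def, coeff_smul, h1]
  simp

theorem coeff_eq_of_sub_mem {M : ℕ} {l : Fin r → ℕ} (hM : ∀ i, l i < M)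
    {f g : MvPolynomial (Fin r ⊕ Fin r) ℤ}
    (h : f - g ∈ Ideal.span ((fun s => monomial s (1 : ℤ)) ''
      Set.range fun i : Fin r => Finsupp.single (Sum.inl i : Fin r ⊕ Fin r) M)) :
    coeff (Finsupp.equivFunOnFinite.symm (Sum.elim l l)) f =
      coeff (Finsupp.equivFunOnFinite.symm (Sum.elim l l)) g := by
  rw [← sub_eq_zero, ← coeff_sub]
  by_contra hne
  obtain ⟨_, ⟨i, rfl⟩, hle⟩ := mem_ideal_span_monomial_image.1 h _ (mem_support_iff.2 hne)
  have h1 := hle (Sum.inl i)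
  rw [Finsupp.single_eq_same] at h1
  exact absurd h1 (not_le.2 (hM i))

theorem det_truncGeom_sub_mem (M : ℕ) :
    (truncGeom r M).det - (Matrix.vandermonde fun i => X (Sum.inl i)).det *
      (Matrix.vandermonde fun i => X (Sum.inr i)).det * ∏ i, ∏ j, truncGeom r M i j ∈
      Ideal.span ((fun s => monomial s (1 : ℤ)) ''
        Set.range fun i : Fin r => Finsupp.single (Sum.inl i : Fin r ⊕ Fin r) M) := by
  set I := Ideal.span ((fun s => monomial s (1 : ℤ)) ''
    Set.range fun i : Fin r => Finsupp.single (Sum.inl i : Fin r ⊕ Fin r) M) with hI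
  rw [← Ideal.Quotient.eq]
  have h1 := det_cauchy (fun i : Fin r => Ideal.Quotient.mk I (X (Sum.inl i)))
    (fun i => Ideal.Quotient.mk I (X (Sum.inr i)))
    ((Ideal.Quotient.mk I).mapMatrix (truncGeom r M)) fun i j => by
      rw [RingHom.mapMatrix_apply, Matrix.map_apply, ← map_mul, ← map_one (Ideal.Quotient.mk I),
        ← map_sub, ← map_mul, truncGeom, Matrix.of_apply, geom_sum_mul_neg, Ideal.Quotient.eq,
        sub_sub_cancel_left, neg_mem_iff, mul_pow]
      refine Ideal.mul_mem_right _ _ (Ideal.subset_span ⟨_, ⟨i, rfl⟩, ?_⟩)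
      simp only [X_pow_eq_monomial]
  have h2 : ∀ v : Fin r → MvPolynomial (Fin r ⊕ Fin r) ℤ,
      (Matrix.vandermonde fun i => Ideal.Quotient.mk I (v i)).det =
        Ideal.Quotient.mk I (Matrix.vandermonde v).det := by
    intro v
    rw [RingHom.map_det]
    congr 1
  rw [← RingHom.map_det, h2, h2] at h1
  rw [h1, map_mul, map_mul, map_prod]
  simp only [map_prod]
  rfl

/-- Nonnegative integer matrices with bounded entries and given row and column sums. -/
def matSet (M : ℕ) (c c' : Fin r → ℤ) : Finset (Fin r × Fin r → ℕ) :=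
  {A ∈ Fintype.piFinset fun _ => Finset.range M |
    (∀ i, ∑ j, (A (i, j) : ℤ) = c i) ∧ ∀ j, ∑ i, (A (i, j) : ℤ) = c' j}

theorem det_vandermonde_eq_sum {R : Type*} [CommRing R] (v : Fin r → R) :
    (Matrix.vandermonde v).det = ∑ σ : Perm (Fin r), Perm.sign σ • ∏ i, v i ^ (σ i : ℕ) := by
  rw [← Matrix.det_transpose, Matrix.det_apply]
  rfl

theorem sum_sign_card_matSet {M : ℕ} {l : Fin r → ℕ} (hl : Function.Injective l)
    (hM : ∀ i, l i < M) :
    ∑ σ : Perm (Fin r), ∑ ρ : Perm (Fin r), ((Perm.sign σ * Perm.sign ρ : ℤˣ) : ℤ) *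
      #(matSet M (fun i => l i - (σ i : ℕ)) fun i => l i - (ρ i : ℕ)) = 1 := by
  rw [← coeff_det_truncGeom hl hM, coeff_eq_of_sub_mem hM (det_truncGeom_sub_mem M),
    det_vandermonde_eq_sum, det_vandermonde_eq_sum, Finset.sum_mul_sum]
  simp only [Finset.sum_mul, coeff_sum]
  refine Finset.sum_congr rfl fun σ _ => Finset.sum_congr rfl fun ρ _ => ?_
  have h1 : (∏ i, ∏ j, truncGeom r M i j) =
      ∑ A ∈ Fintype.piFinset fun _ : Fin r × Fin r => Finset.range M,
        (∏ i, X (Sum.inl i) ^ (∑ j, A (i, j))) * ∏ j, X (Sum.inr j) ^ (∑ i, A (i, j)) := by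
    rw [← Fintype.prod_prod_type' fun i j => truncGeom r M i j]
    simp only [truncGeom, Matrix.of_apply]
    rw [Finset.prod_univ_sum]
    refine Finset.sum_congr rfl fun A _ => ?_
    simp only [mul_pow, Finset.prod_mul_distrib, ← Finset.prod_pow_eq_pow_sum]
    rw [Fintype.prod_prod_type, Fintype.prod_prod_type_right]
  rw [h1, Units.smul_def, Units.smul_def, smul_mul_smul_comm, smul_mul_assoc, coeff_smul,
    Finset.mul_sum, coeff_sum, smul_eq_mul, Units.val_mul, matSet, Finset.card_filter,
    Nat.cast_sum]
  congr 1
  refine Finset.sum_congr rfl fun A _ => ?_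
  have h2 : ((∏ i, X (Sum.inl i) ^ (σ i : ℕ)) * ∏ i, X (Sum.inr i) ^ (ρ i : ℕ)) *
      ((∏ i, X (Sum.inl i) ^ (∑ j, A (i, j))) * ∏ j, X (Sum.inr j) ^ (∑ i, A (i, j)) :
        MvPolynomial (Fin r ⊕ Fin r) ℤ) =
      (∏ i, X (Sum.inl i) ^ ((σ i : ℕ) + ∑ j, A (i, j))) *
        ∏ j, X (Sum.inr j) ^ ((ρ j : ℕ) + ∑ i, A (i, j)) := by
    simp only [pow_add, Finset.prod_mul_distrib]
    ring
  rw [h2, coeff_prod_X_pow, Nat.cast_ite, Nat.cast_one, Nat.cast_zero]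
  refine if_congr ?_ rfl rfl
  simp only [funext_iff]
  refine and_congr (forall_congr' fun i => ?_) (forall_congr' fun i => ?_) <;>
  · rw [← Nat.cast_sum]
    omega

theorem sum_sign_card_matSet_of_antitone {α : Fin r → ℤ} (hα : Antitone α) (h0 : ∀ i, 0 ≤ α i)
    {M : ℕ} (hM : ∀ i, α i + r ≤ M) :
    ∑ σ : Perm (Fin r), ∑ ρ : Perm (Fin r), ((Perm.sign σ * Perm.sign ρ : ℤˣ) : ℤ) *
      #(matSet M (fun i => α i - (i : ℕ) + (σ i : ℕ)) fun i => α i - (i : ℕ) + (ρ i : ℕ)) = 1 := by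
  have hl : Function.Injective fun i : Fin r => (α i).toNat + (r - 1 - i) := by
    refine StrictAnti.injective fun i j hij => ?_
    have h1 := hα hij.le
    have h2 := h0 i
    have h3 := h0 j
    have h4 : (i : ℕ) < j := hij
    omega
  rw [← sum_sign_card_matSet hl (M := M) fun i => by
    have h1 := h0 i
    have h2 := hM i
    omega]
  refine Fintype.sum_equiv (Equiv.mulLeft Fin.revPerm) _ _ fun σ =>
    Fintype.sum_equiv (Equiv.mulLeft Fin.revPerm) _ _ fun ρ => ?_
  have h1 : ∀ π : Perm (Fin r), (fun i => ((((α i).toNat + (r - 1 - i) : ℕ) : ℤ) -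
      ((Equiv.mulLeft Fin.revPerm π i : Fin r) : ℕ))) = fun i => α i - (i : ℕ) + (π i : ℕ) := by
    intro π
    funext i
    have h2 := h0 i
    have h3 := (π i).isLt
    have h4 := i.isLt
    rw [Equiv.coe_mulLeft, Perm.mul_apply, Fin.revPerm_apply, Fin.val_rev]
    omega
  rw [h1, h1, Equiv.coe_mulLeft, Perm.sign_mul, Perm.sign_mul, mul_mul_mul_comm,
    Int.units_mul_self, one_mul]

end MatrixCount

section MonomialPairing

variable {n : ℕ}

theorem monoChar_inv {π : PG n} (hπ : π ∈ signedPerm n) (Y : Finset (Fin n → ℕ)) :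
    monoChar Y π⁻¹ = monoChar Y π := by
  have h1 : ∀ h : Fin n → ℕ, h ∘ ab π⁻¹ = h ↔ h ∘ ab π = h := by
    intro h
    constructor <;> intro hh <;> funext i
    · exact (congrFun hh (ab π i)).symm.trans (by dsimp only [Function.comp]; rw [ab_inv_ab hπ])
    · exact (congrFun hh (ab π⁻¹ i)).symm.trans (by dsimp only [Function.comp]; rw [ab_ab_inv hπ])
  rw [monoChar, monoChar]
  simp only [h1]
  refine Finset.sum_congr rfl fun h hh => ?_
  rw [Finset.mem_filter] at hh
  refine (Fintype.prod_bijective _ (ab_bijective hπ) _ _ fun i => ?_).symm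
  rw [sg_inv hπ, ← congrFun hh.2 i]
  rfl

theorem cinner_monoChar_monoChar {K : Subgroup (PG n)} [Fintype K] (hK : K ≤ signedPerm n)
    (Y Y' : Finset (Fin n → ℕ)) :
    cinner (resChar K (monoChar Y)) (resChar K (monoChar Y')) =
      ∑ p ∈ Y ×ˢ Y', (Nat.card K : ℂ)⁻¹ * ∑ x : K,
        if p.1 ∘ ab (x : PG n) = p.1 ∧ p.2 ∘ ab (x : PG n) = p.2 then
          ∏ i, sg (x : PG n) i ^ (p.1 i + p.2 i) else 0 := by
  rw [cinner_eq_sum, ← Finset.mul_sum, Finset.sum_comm]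
  congr 1
  refine Finset.sum_congr rfl fun x _ => ?_
  have h1 : resChar K (monoChar Y') x⁻¹ = monoChar Y' x := monoChar_inv (hK x.2) Y'
  rw [h1, resChar, monoChar, monoChar, Finset.sum_mul_sum, Finset.sum_product, Finset.sum_filter]
  refine Finset.sum_congr rfl fun h _ => ?_
  split_ifs with hh
  · rw [Finset.sum_filter]
    refine Finset.sum_congr rfl fun h' _ => ?_
    simp only [hh, true_and, pow_add, Finset.prod_mul_distrib]
  · simp [hh]

theorem sum_stabilizer_eq [Fintype (DWn n)] (u v : Fin n → ℕ) :
    (∑ x : DWn n, if u ∘ ab (x : PG n) = u ∧ v ∘ ab (x : PG n) = v then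
      ∏ i, sg (x : PG n) i ^ (u i + v i) else 0) =
    if ∀ i j, Even (u i + v i + (u j + v j)) then
      (#{x : DWn n | u ∘ ab (x : PG n) = u ∧ v ∘ ab (x : PG n) = v} : ℂ) else 0 := by
  split_ifs with hpar
  · rw [Finset.card_filter, Nat.cast_sum]
    refine Finset.sum_congr rfl fun x _ => ?_
    rw [Nat.cast_ite, Nat.cast_one, Nat.cast_zero]
    congr 1
    by_cases h : ∀ i, Even (u i + v i)
    · refine Finset.prod_eq_one fun i _ => ?_
      obtain ⟨k, hk⟩ := h i
      rw [hk, ← two_mul, sg_pow_even]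
    · push Not at h
      obtain ⟨i₀, h0⟩ := h
      rw [← prod_sg_of_mem_DWn x.2]
      refine Finset.prod_congr rfl fun i _ => ?_
      have h1 : Odd (u i + v i) := by
        have := hpar i i₀
        rw [Nat.even_add] at this
        rwa [← Nat.not_even_iff_odd, this]
      obtain ⟨k, hk⟩ := h1
      rw [hk, sg_pow_odd]
  · push Not at hpar
    obtain ⟨i, j, hij⟩ := hpar
    have hne : i ≠ j := by
      rintro rfl
      exact hij ⟨_, rfl⟩
    have hd : dsgn i j ∈ DWn n := dsgn_mem_blkSub rfl rfl rfl
    have key : (∑ x : DWn n, if u ∘ ab (x : PG n) = u ∧ v ∘ ab (x : PG n) = v then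
        ∏ i, sg (x : PG n) i ^ (u i + v i) else 0) =
        ∑ x : DWn n, -(if u ∘ ab (x : PG n) = u ∧ v ∘ ab (x : PG n) = v then
          ∏ i, sg (x : PG n) i ^ (u i + v i) else 0) := by
      refine (Fintype.sum_equiv (Equiv.mulRight (⟨dsgn i j, hd⟩ : DWn n)) _ _ fun x => ?_).symm
      have hx := DWn_le_signedPerm x.2
      have hab : ab ((x : PG n) * dsgn i j) = ab (x : PG n) := by
        funext k
        rw [ab_mul hx, ab_dsgn]
      have hsg : ∏ k, sg ((x : PG n) * dsgn i j) k ^ (u k + v k) =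
          -∏ k, sg (x : PG n) k ^ (u k + v k) := by
        have h1 := cocyc_dsgn hne fun k => u k + v k
        simp only [cocyc, ab_dsgn] at h1
        simp only [sg_mul hx, ab_dsgn, mul_pow, Finset.prod_mul_distrib]
        rw [h1, Odd.neg_one_pow (Nat.not_even_iff_odd.1 hij), neg_one_mul]
      simp only [Equiv.coe_mulRight, Subgroup.coe_mul, hab, hsg]
      split_ifs <;> simp
    rw [Finset.sum_neg_distrib] at key
    exact self_eq_neg.1 key

/-- The number of positions at which `u` is `2 * i + e` and `v` is `2 * j + e`. -/
def pairCount (r e : ℕ) (u v : Fin n → ℕ) (q : Fin r × Fin r) : ℕ :=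
  #{x | u x = 2 * (q.1 : ℕ) + e ∧ v x = 2 * (q.2 : ℕ) + e}

theorem pairCount_swap (r e : ℕ) (u v : Fin n → ℕ) (i j : Fin r) :
    pairCount r e u v (i, j) = pairCount r e v u (j, i) := by
  simp only [pairCount, and_comm]

theorem sum_pairCount {r e : ℕ} {u v : Fin n → ℕ} (i : Fin r)
    (h : ∀ x, u x = 2 * (i : ℕ) + e → ∃ j : Fin r, v x = 2 * (j : ℕ) + e) :
    ∑ j, pairCount r e u v (i, j) = #{x | u x = 2 * (i : ℕ) + e} := by
  simp only [pairCount, Finset.card_filter]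
  rw [Finset.sum_comm]
  refine Finset.sum_congr rfl fun x _ => ?_
  by_cases hx : u x = 2 * (i : ℕ) + e
  · obtain ⟨j, hj⟩ := h x hx
    rw [Finset.sum_eq_single j]
    · rw [if_pos ⟨hx, hj⟩, if_pos hx]
    · intro j' _ hne
      rw [if_neg]
      rintro ⟨-, h2⟩
      exact hne (Fin.ext (by omega))
    · simp
  · simp [hx]

theorem exists_coloring {C : Type*} [Fintype C] [DecidableEq C] (m : C → ℕ) (hm : ∑ c, m c = n) :
    ∃ f : Fin n → C, ∀ c, #{x | f x = c} = m c := by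
  have e : Fin n ≃ Σ c, Fin (m c) := Fintype.equivOfCardEq (by simp [hm])
  refine ⟨fun x => (e x).1, fun c => ?_⟩
  have h1 : #{x | (e x).1 = c} = #{y : Σ c, Fin (m c) | y.1 = c} :=
    Finset.card_equiv e fun x => by simp
  rw [h1, ← Fintype.card_subtype]
  exact (Fintype.card_congr (Equiv.sigmaSubtype c)).trans (Fintype.card_fin _)

theorem even_add_or_odd_add {r : ℕ} {c d c' d' : Fin r → ℤ} {u v : Fin n → ℕ}
    (hu : u ∈ contentSet n c d) (hv : v ∈ contentSet n c' d') (hne : ∑ i, c i ≠ ∑ i, d' i)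
    (h : ∀ i j, Even (u i + v i + (u j + v j))) (x : Fin n) : Even (u x + v x) := by
  by_contra h0
  refine hne ?_
  rw [mem_contentSet] at hu hv
  have h1 : ∑ y, (if Even (u y) then 1 else 0) = ∑ y, if Even (v y) then 0 else 1 := by
    refine Finset.sum_congr rfl fun y _ => ?_
    have h2 := h x y
    rw [Nat.even_add, iff_false_left h0, Nat.even_add] at h2
    split_ifs <;> simp_all
  rw [sum_content hu.1 fun t => if Even t then 1 else 0,
    sum_content hv.1 fun t => if Even t then 0 else 1] at h1
  simp only [even_two_mul, if_true, Nat.not_even_two_mul_add_one, if_false, smul_eq_mul, mul_one,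
    mul_zero, add_zero, zero_add] at h1
  rw [← Finset.sum_congr rfl fun i _ => (hu.2 i).1, ← Finset.sum_congr rfl fun i _ => (hv.2 i).2]
  exact_mod_cast h1

/-- Pairs of exponent vectors of given contents whose entries have pairwise the same parity. -/
def evenPairs (n : ℕ) {r : ℕ} (c d c' d' : Fin r → ℤ) : Finset ((Fin n → ℕ) × (Fin n → ℕ)) :=
  {p ∈ contentSet n c d ×ˢ contentSet n c' d' | ∀ x, Even (p.1 x + p.2 x)}

theorem mem_evenPairs {r : ℕ} {c d c' d' : Fin r → ℤ} {p : (Fin n → ℕ) × (Fin n → ℕ)} :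
    p ∈ evenPairs n c d c' d' ↔ (p.1 ∈ contentSet n c d ∧ p.2 ∈ contentSet n c' d') ∧
      ∀ x, Even (p.1 x + p.2 x) := by
  rw [evenPairs, Finset.mem_filter, Finset.mem_product]

theorem exists_eq_two_mul_add {r e t s : ℕ} (he : e < 2) (hs : s < 2 * r) (h : Even (t + s))
    {i : ℕ} (ht : t = 2 * i + e) : ∃ j : Fin r, s = 2 * (j : ℕ) + e := by
  rw [Nat.even_iff] at h
  exact ⟨⟨s / 2, by omega⟩, by dsimp only; omega⟩

theorem pairCount_mem_matSet {r M : ℕ} (hM : n < M) {c d c' d' : Fin r → ℤ}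
    {p : (Fin n → ℕ) × (Fin n → ℕ)} (hp : p ∈ evenPairs n c d c' d') :
    (pairCount r 0 p.1 p.2, pairCount r 1 p.1 p.2) ∈ matSet M c c' ×ˢ matSet M d d' := by
  rw [mem_evenPairs, mem_contentSet, mem_contentSet] at hp
  obtain ⟨⟨⟨h1, h2⟩, h3, h4⟩, h5⟩ := hp
  have hlt : ∀ e q, pairCount r e p.1 p.2 q < M := fun e q =>
    (Finset.card_le_univ _).trans_lt (by simpa using hM)
  have hrow : ∀ e < 2, ∀ i, ∑ j, (pairCount r e p.1 p.2 (i, j) : ℤ) =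
      #{x | p.1 x = 2 * (i : ℕ) + e} := fun e he i => by
    rw [← sum_pairCount i fun x hx => exists_eq_two_mul_add he (h3 x) (h5 x) hx, Nat.cast_sum]
  have hcol : ∀ e < 2, ∀ j, ∑ i, (pairCount r e p.1 p.2 (i, j) : ℤ) =
      #{x | p.2 x = 2 * (j : ℕ) + e} := fun e he j => by
    rw [← sum_pairCount (v := p.1) j fun x hx => exists_eq_two_mul_add he (h1 x)
      (by rw [add_comm]; exact h5 x) hx, Nat.cast_sum]
    simp only [pairCount_swap]
  rw [Finset.mem_product, matSet, matSet, Finset.mem_filter, Finset.mem_filter,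
    Fintype.mem_piFinset, Fintype.mem_piFinset]
  refine ⟨⟨fun q => Finset.mem_range.2 (hlt 0 q), fun i => ?_, fun j => ?_⟩,
    ⟨fun q => Finset.mem_range.2 (hlt 1 q), fun i => ?_, fun j => ?_⟩⟩
  · rw [hrow 0 (by omega)]
    exact (h2 i).1
  · rw [hcol 0 (by omega)]
    exact (h4 j).1
  · rw [hrow 1 (by omega)]
    exact (h2 i).2
  · rw [hcol 1 (by omega)]
    exact (h4 j).2

theorem exists_evenPair {r M : ℕ} {c d c' d' : Fin r → ℤ} (hn : ∑ i, c i + ∑ i, d i = n)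
    {A B : Fin r × Fin r → ℕ} (hA : A ∈ matSet M c c') (hB : B ∈ matSet M d d') :
    ∃ p ∈ evenPairs n c d c' d', (pairCount r 0 p.1 p.2, pairCount r 1 p.1 p.2) = (A, B) := by
  rw [matSet, Finset.mem_filter] at hA hB
  obtain ⟨-, hA1, hA2⟩ := hA
  obtain ⟨-, hB1, hB2⟩ := hB
  obtain ⟨f, hf⟩ := exists_coloring (n := n) (Sum.elim A B) (by
    rw [Fintype.sum_sum_type, Fintype.sum_prod_type, Fintype.sum_prod_type]
    zify
    rw [← hn, Finset.sum_congr rfl fun i _ => (hA1 i).symm,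
      Finset.sum_congr rfl fun i _ => (hB1 i).symm]
    rfl)
  set u : Fin n → ℕ := fun x => Sum.elim (fun q => 2 * (q.1 : ℕ)) (fun q => 2 * (q.1 : ℕ) + 1) (f x)
    with hu
  set v : Fin n → ℕ := fun x => Sum.elim (fun q => 2 * (q.2 : ℕ)) (fun q => 2 * (q.2 : ℕ) + 1) (f x)
    with hv
  have heven : ∀ x, Even (u x + v x) := fun x => by
    rw [Nat.even_iff]
    rcases hx : f x with q | q <;> simp only [hu, hv, hx, Sum.elim_inl, Sum.elim_inr] <;> omega
  have hur : ∀ x, u x < 2 * r := fun x => by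
    rcases hx : f x with q | q <;> simp only [hu, hx, Sum.elim_inl, Sum.elim_inr] <;> omega
  have hvr : ∀ x, v x < 2 * r := fun x => by
    rcases hx : f x with q | q <;> simp only [hv, hx, Sum.elim_inl, Sum.elim_inr] <;> omega
  have h0 : pairCount r 0 u v = A := funext fun q => by
    rw [pairCount, ← Sum.elim_inl A B q, ← hf]
    congr 1
    refine Finset.filter_congr fun x _ => ?_
    rcases hx : f x with q' | q' <;>
      simp only [hu, hv, hx, Sum.elim_inl, Sum.elim_inr, Sum.inl.injEq, Prod.ext_iff, Fin.ext_iff,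
        reduceCtorEq, iff_false] <;> omega
  have h1 : pairCount r 1 u v = B := funext fun q => by
    rw [pairCount, ← Sum.elim_inr A B q, ← hf]
    congr 1
    refine Finset.filter_congr fun x _ => ?_
    rcases hx : f x with q' | q' <;>
      simp only [hu, hv, hx, Sum.elim_inl, Sum.elim_inr, Sum.inr.injEq, Prod.ext_iff, Fin.ext_iff,
        reduceCtorEq, iff_false] <;> omega
  have hrow : ∀ e < 2, ∀ i : Fin r, (#{x | u x = 2 * (i : ℕ) + e} : ℤ) =
      ∑ j, (pairCount r e u v (i, j) : ℤ) := fun e he i => by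
    rw [← sum_pairCount i fun x hx => exists_eq_two_mul_add he (hvr x) (heven x) hx, Nat.cast_sum]
  have hcol : ∀ e < 2, ∀ j : Fin r, (#{x | v x = 2 * (j : ℕ) + e} : ℤ) =
      ∑ i, (pairCount r e u v (i, j) : ℤ) := fun e he j => by
    rw [← sum_pairCount (v := u) j fun x hx => exists_eq_two_mul_add he (hur x)
      (by rw [add_comm]; exact heven x) hx, Nat.cast_sum]
    simp only [pairCount_swap]
  refine ⟨(u, v), mem_evenPairs.2 ⟨⟨mem_contentSet.2 ⟨hur, fun i => ⟨?_, ?_⟩⟩,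
    mem_contentSet.2 ⟨hvr, fun i => ⟨?_, ?_⟩⟩⟩, heven⟩, Prod.ext h0 h1⟩
  · rw [← hA1, ← h0]
    exact hrow 0 (by omega) i
  · rw [← hB1, ← h1]
    exact hrow 1 (by omega) i
  · rw [← hA2, ← h0]
    exact hcol 0 (by omega) i
  · rw [← hB2, ← h1]
    exact hcol 1 (by omega) i

end MonomialPairing

section ContentPairing

variable {n : ℕ}

theorem card_joint_eq {r : ℕ} {c d c' d' : Fin r → ℤ} {p q : (Fin n → ℕ) × (Fin n → ℕ)}
    (hp : p ∈ evenPairs n c d c' d') (hq : q ∈ evenPairs n c d c' d')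
    (h0 : pairCount r 0 p.1 p.2 = pairCount r 0 q.1 q.2)
    (h1 : pairCount r 1 p.1 p.2 = pairCount r 1 q.1 q.2) (t : ℕ × ℕ) :
    #{x | (p.1 x, p.2 x) = t} = #{x | (q.1 x, q.2 x) = t} := by
  obtain ⟨a, b⟩ := t
  by_cases hab : a < 2 * r ∧ b < 2 * r ∧ Even (a + b)
  · obtain ⟨ha, hb, he⟩ := hab
    rw [Nat.even_iff] at he
    rcases Nat.mod_two_eq_zero_or_one a with ha' | ha'
    · have h2 := congrFun h0 (⟨a / 2, by omega⟩, ⟨b / 2, by omega⟩)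
      simp only [pairCount, add_zero, show 2 * (a / 2) = a by omega,
        show 2 * (b / 2) = b by omega] at h2
      simpa only [Prod.mk.injEq] using h2
    · have h2 := congrFun h1 (⟨a / 2, by omega⟩, ⟨b / 2, by omega⟩)
      simp only [pairCount, show 2 * (a / 2) + 1 = a by omega,
        show 2 * (b / 2) + 1 = b by omega] at h2
      simpa only [Prod.mk.injEq] using h2
  · have key : ∀ p ∈ evenPairs n c d c' d', #{x | (p.1 x, p.2 x) = (a, b)} = 0 := by
      intro p hp
      rw [mem_evenPairs, mem_contentSet, mem_contentSet] at hp
      rw [Finset.card_eq_zero, Finset.filter_eq_empty_iff]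
      rintro x - hx
      rw [Prod.mk.injEq] at hx
      exact hab ⟨hx.1 ▸ hp.1.1.1 x, hx.2 ▸ hp.1.2.1 x, hx.1 ▸ hx.2 ▸ hp.2 x⟩
    rw [key p hp, key q hq]

/-- Orbit counting on the pairs of exponent vectors with prescribed joint multiplicities. -/
theorem sum_card_stabilizer [Fintype (DWn n)] {r : ℕ} {c d c' d' : Fin r → ℤ}
    {p₀ : (Fin n → ℕ) × (Fin n → ℕ)} (hp₀ : p₀ ∈ evenPairs n c d c' d') :
    ∑ p ∈ evenPairs n c d c' d' with
      (pairCount r 0 p.1 p.2, pairCount r 1 p.1 p.2) =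
        (pairCount r 0 p₀.1 p₀.2, pairCount r 1 p₀.1 p₀.2),
      (Nat.card (DWn n) : ℂ)⁻¹ *
        #{x : DWn n | p.1 ∘ ab (x : PG n) = p.1 ∧ p.2 ∘ ab (x : PG n) = p.2} = 1 := by
  set Z := (evenPairs n c d c' d').filter fun p =>
    (pairCount r 0 p.1 p.2, pairCount r 1 p.1 p.2) =
      (pairCount r 0 p₀.1 p₀.2, pairCount r 1 p₀.1 p₀.2) with hZ
  have hinj : Function.Injective fun (p : (Fin n → ℕ) × (Fin n → ℕ)) x => (p.1 x, p.2 x) := by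
    intro p q h
    exact Prod.ext (funext fun x => congrArg Prod.fst (congrFun h x))
      (funext fun x => congrArg Prod.snd (congrFun h x))
  have hcard : (Nat.card (DWn n) : ℂ) ≠ 0 := by exact_mod_cast Nat.card_pos.ne'
  have hstab : ∀ p ∈ Z, (Nat.card (DWn n) : ℂ) =
      #{x : DWn n | p.1 ∘ ab (x : PG n) = p.1 ∧ p.2 ∘ ab (x : PG n) = p.2} * #Z := by
    intro p hp
    rw [hZ, Finset.mem_filter, Prod.mk.injEq] at hp
    have h1 := sum_comp_ab DWn_le_signedPerm lift_mem_DWn (fun x => (p.1 x, p.2 x))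
      (Z.image fun p x => (p.1 x, p.2 x)) (fun H => ?_) fun _ => 1
    · rw [Finset.sum_const, Finset.sum_const, Finset.card_image_of_injective _ hinj,
        nsmul_one, nsmul_one, Finset.card_univ, ← Nat.card_eq_fintype_card] at h1
      rw [h1]
      congr 2
      refine congrArg _ (Finset.filter_congr fun x _ => ?_)
      simp only [funext_iff, Function.comp, Prod.mk.injEq, forall_and]
    · rw [Finset.mem_image]
      constructor
      · rintro ⟨q, hq, rfl⟩ t
        rw [hZ, Finset.mem_filter, Prod.mk.injEq] at hq
        exact card_joint_eq hq.1 hp.1 (hq.2.1.trans hp.2.1.symm) (hq.2.2.trans hp.2.2.symm) t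
      · intro h
        obtain ⟨σ, hσ⟩ := exists_perm_of_card_fiber_eq h
        refine ⟨(p.1 ∘ σ, p.2 ∘ σ), ?_, funext hσ⟩
        have hcount : ∀ e, pairCount r e (p.1 ∘ σ) (p.2 ∘ σ) = pairCount r e p.1 p.2 := by
          intro e
          funext q
          have h2 := card_fiber_comp (fun x => (p.1 x, p.2 x)) σ.bijective
            (2 * (q.1 : ℕ) + e, 2 * (q.2 : ℕ) + e)
          simpa only [pairCount, Function.comp, Prod.mk.injEq] using h2
        rw [mem_evenPairs] at hp
        rw [hZ, Finset.mem_filter, Prod.mk.injEq, mem_evenPairs, hcount, hcount]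
        exact ⟨⟨⟨isSymmSet_contentSet _ _ _ hp.1.1.1 σ, isSymmSet_contentSet _ _ _ hp.1.1.2 σ⟩,
          fun x => hp.1.2 (σ x)⟩, hp.2⟩
  have hZ0 : (#Z : ℂ) ≠ 0 := by
    have : p₀ ∈ Z := Finset.mem_filter.2 ⟨hp₀, rfl⟩
    exact_mod_cast (Finset.card_pos.2 ⟨_, this⟩).ne'
  have hval : ∀ p ∈ Z, (Nat.card (DWn n) : ℂ)⁻¹ *
      #{x : DWn n | p.1 ∘ ab (x : PG n) = p.1 ∧ p.2 ∘ ab (x : PG n) = p.2} = (#Z : ℂ)⁻¹ := by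
    intro p hp
    have h1 := hstab p hp
    field_simp
    exact h1.symm
  rw [Finset.sum_congr rfl hval, Finset.sum_const, nsmul_eq_mul, mul_inv_cancel₀ hZ0]

theorem cinner_contentSet {r M : ℕ} (hM : n < M) {c d c' d' : Fin r → ℤ}
    (hn : ∑ i, c i + ∑ i, d i = n) (hne : ∑ i, c i ≠ ∑ i, d' i) :
    cinner (resChar (DWn n) (monoChar (contentSet n c d)))
      (resChar (DWn n) (monoChar (contentSet n c' d'))) =
      #(matSet M c c') * #(matSet M d d') := by
  have := Fintype.ofFinite (DWn n)
  rw [cinner_monoChar_monoChar DWn_le_signedPerm]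
  simp only [sum_stabilizer_eq]
  have h1 : ∀ p ∈ contentSet n c d ×ˢ contentSet n c' d', (Nat.card (DWn n) : ℂ)⁻¹ *
      (if ∀ i j, Even (p.1 i + p.2 i + (p.1 j + p.2 j)) then
        (#{x : DWn n | p.1 ∘ ab (x : PG n) = p.1 ∧ p.2 ∘ ab (x : PG n) = p.2} : ℂ) else 0) =
      if ∀ x, Even (p.1 x + p.2 x) then (Nat.card (DWn n) : ℂ)⁻¹ *
        (#{x : DWn n | p.1 ∘ ab (x : PG n) = p.1 ∧ p.2 ∘ ab (x : PG n) = p.2} : ℂ) else 0 := by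
    intro p hp
    rw [Finset.mem_product] at hp
    have h2 : (∀ i j, Even (p.1 i + p.2 i + (p.1 j + p.2 j))) ↔ ∀ x, Even (p.1 x + p.2 x) :=
      ⟨even_add_or_odd_add hp.1 hp.2 hne, fun h i j => (h i).add (h j)⟩
    simp only [h2, mul_ite, mul_zero]
  rw [Finset.sum_congr rfl h1, ← Finset.sum_filter]
  change ∑ p ∈ evenPairs n c d c' d', _ = _
  rw [← Finset.sum_fiberwise_of_maps_to fun p hp => pairCount_mem_matSet hM hp]
  rw [← Nat.cast_mul, ← Finset.card_product, Finset.card_eq_sum_ones, Nat.cast_sum]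
  refine Finset.sum_congr rfl fun T hT => ?_
  rw [Finset.mem_product] at hT
  obtain ⟨p₀, hp₀, rfl⟩ : ∃ p ∈ evenPairs n c d c' d',
      (pairCount r 0 p.1 p.2, pairCount r 1 p.1 p.2) = T := exists_evenPair hn hT.1 hT.2
  rw [sum_card_stabilizer hp₀, Nat.cast_one]

end ContentPairing

/-! ### The virtual characters given by the determinantal formula -/

theorem isChar_sum {G : Type} [Group G] {ι : Type*} (s : Finset ι) {φ : ι → G → ℂ}
    (h : ∀ i ∈ s, IsChar (φ i)) : IsChar (∑ i ∈ s, φ i) := by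
  classical
  induction s using Finset.induction_on with
  | empty =>
    refine ⟨PUnit, inferInstance, inferInstance, 1, inferInstance, fun g => ?_⟩
    rw [Subsingleton.elim ((1 : Representation ℂ G PUnit) g) 0, map_zero]
    simp
  | insert a s ha ih =>
    obtain ⟨V, _, _, ρ, hV, hρ⟩ := h a (Finset.mem_insert_self a s)
    obtain ⟨W, _, _, ρ', hW, hρ'⟩ := ih fun i hi => h i (Finset.mem_insert_of_mem hi)
    refine ⟨V × W, inferInstance, inferInstance, ρ.prod ρ', inferInstance, fun g => ?_⟩
    rw [Finset.sum_insert ha, Pi.add_apply, hρ, hρ']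
    exact (LinearMap.trace_prodMap' (ρ g) (ρ' g)).symm

variable {n : ℕ} {r : ℕ}

theorem isChar_monoChar {K : Subgroup (PG n)} (hK : K ≤ signedPerm n) {Y : Finset (Fin n → ℕ)}
    (hY : IsSymmSet Y) : IsChar (resChar K (monoChar Y)) :=
  ⟨Y → ℂ, inferInstance, inferInstance, monoRep hK hY, inferInstance,
    fun g => (congrFun (monoRep_character hK hY) g).symm⟩

/-- The row of the determinantal formula selected by a permutation. -/
def shift (α : Fin r → ℤ) (σ : Perm (Fin r)) (i : Fin r) : ℤ := α i - (i : ℕ) + (σ i : ℕ)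

theorem sum_shift (α : Fin r → ℤ) (σ : Perm (Fin r)) : ∑ i, shift α σ i = ∑ i, α i := by
  have h := Equiv.sum_comp σ fun i : Fin r => ((i : ℕ) : ℤ)
  simp only [shift, Finset.sum_add_distrib, Finset.sum_sub_distrib, h]
  ring

theorem shift_one (α : Fin r → ℤ) : shift α 1 = α := by
  ext i
  simp [shift]

/-- The sign attached to a pair of permutations. -/
def pairSign (σ : Perm (Fin r) × Perm (Fin r)) : ℤ :=
  ((Perm.sign σ.1 * Perm.sign σ.2 : ℤˣ) : ℤ)

/-- The piece of the determinantal formula, on `W'_n`, selected by a pair of permutations. -/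
def detPiece (n : ℕ) (α β : Fin r → ℤ) (σ : Perm (Fin r) × Perm (Fin r)) : DWn n → ℂ :=
  resChar (DWn n) (monoChar (contentSet n (shift α σ.1) (shift β σ.2)))

/-- The determinantal formula on `W'_n`. -/
def detChar (n : ℕ) (α β : Fin r → ℤ) : DWn n → ℂ :=
  ∑ σ : Perm (Fin r) × Perm (Fin r), (pairSign σ : ℂ) • detPiece n α β σ

theorem cinner_detChar_left (α β : Fin r → ℤ) (ψ : DWn n → ℂ) :
    cinner (detChar n α β) ψ = ∑ σ, (pairSign σ : ℂ) * cinner (detPiece n α β σ) ψ := by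
  simp only [detChar, cinner_sum_left, cinner_smul_left]

theorem cinner_detChar_self {α β : Fin r → ℤ} (hα : Antitone α) (hβ : Antitone β)
    (hα0 : ∀ i, 0 ≤ α i) (hβ0 : ∀ i, 0 ≤ β i) (hn : ∑ i, α i + ∑ i, β i = n)
    (hne : ∑ i, α i ≠ ∑ i, β i) : cinner (detChar n α β) (detChar n α β) = 1 := by
  obtain ⟨M, hM, hMα, hMβ⟩ : ∃ M : ℕ, n < M ∧ (∀ i, α i + r ≤ M) ∧ ∀ i, β i + r ≤ M := by
    refine ⟨n + 1 + r, by omega, fun i => ?_, fun i => ?_⟩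
    · have h1 := Finset.single_le_sum (fun i _ => hα0 i) (Finset.mem_univ i)
      have h2 := Finset.sum_nonneg fun i (_ : i ∈ Finset.univ) => hβ0 i
      push_cast
      linarith
    · have h1 := Finset.single_le_sum (fun i _ => hβ0 i) (Finset.mem_univ i)
      have h2 := Finset.sum_nonneg fun i (_ : i ∈ Finset.univ) => hα0 i
      push_cast
      linarith
  have key : ∀ σ ρ : Perm (Fin r) × Perm (Fin r),
      cinner (detPiece n α β σ) (detPiece n α β ρ) =
        (((#(matSet M (shift α σ.1) (shift α ρ.1)) * #(matSet M (shift β σ.2) (shift β ρ.2)) :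
          ℕ) : ℤ) : ℂ) := by
    intro σ ρ
    rw [detPiece, detPiece, cinner_contentSet hM (by simpa only [sum_shift] using hn)
      (by simpa only [sum_shift] using hne)]
    push_cast
    rfl
  have key' : ∀ σ, cinner (detPiece n α β σ) (detChar n α β) = ∑ ρ, (pairSign ρ : ℂ) *
      (((#(matSet M (shift α σ.1) (shift α ρ.1)) * #(matSet M (shift β σ.2) (shift β ρ.2)) :
          ℕ) : ℤ) : ℂ) := fun σ => by
    rw [cinner_comm, cinner_detChar_left]
    exact Finset.sum_congr rfl fun ρ _ => by rw [cinner_comm, key]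
  rw [cinner_detChar_left, Finset.sum_congr rfl fun σ _ => by rw [key' σ]]
  have hA := sum_sign_card_matSet_of_antitone hα hα0 hMα
  have hB := sum_sign_card_matSet_of_antitone hβ hβ0 hMβ
  norm_cast
  rw [← one_mul (1 : ℤ)]
  nth_rewrite 1 [← hA]
  rw [← hB]
  rw [Finset.sum_mul_sum]
  simp only [Fintype.sum_prod_type]
  refine Finset.sum_congr rfl fun σ _ => Finset.sum_congr rfl fun σ' _ => ?_
  rw [Finset.sum_mul_sum, Finset.mul_sum]
  simp only [Finset.mul_sum]
  refine Finset.sum_congr rfl fun ρ _ => Finset.sum_congr rfl fun ρ' _ => ?_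
  have hs : ∀ (γ : Fin r → ℤ) (σ : Perm (Fin r)),
      shift γ σ = fun i : Fin r => γ i - (i : ℕ) + (σ i : ℕ) := fun _ _ => rfl
  simp only [pairSign, hs]
  push_cast
  ring

theorem exists_irreducible_detChar {α β : Fin r → ℤ} (hα : Antitone α) (hβ : Antitone β)
    (hα0 : ∀ i, 0 ≤ α i) (hβ0 : ∀ i, 0 ≤ β i) (hn : ∑ i, α i + ∑ i, β i = n)
    (hne : ∑ i, α i ≠ ∑ i, β i) :
    ∃ (U : Type) (_ : AddCommGroup U) (_ : Module ℂ U) (_ : FiniteDimensional ℂ U)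
      (π : Representation ℂ (DWn n) U), π.IsIrreducible ∧
      (detChar n α β = π.character ∨ detChar n α β = -π.character) := by
  have hc : ∀ s : Finset (Perm (Fin r) × Perm (Fin r)), IsChar (∑ σ ∈ s, detPiece n α β σ) :=
    fun s => isChar_sum s fun σ _ =>
      isChar_monoChar DWn_le_signedPerm (isSymmSet_contentSet _ _)
  obtain ⟨V, _, _, ρ, hV, hρ⟩ := hc {σ | pairSign σ = 1}
  obtain ⟨W, _, _, ρ', hW, hρ'⟩ := hc {σ | ¬ pairSign σ = 1}
  have heq : detChar n α β = ρ.character - ρ'.character := by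
    have h1 : ρ.character = ∑ σ with pairSign σ = 1, detPiece n α β σ :=
      funext fun g => (hρ g).symm
    have h2 : ρ'.character = ∑ σ with ¬ pairSign σ = 1, detPiece n α β σ :=
      funext fun g => (hρ' g).symm
    rw [h1, h2, detChar, ← Finset.sum_filter_add_sum_filter_not _ fun σ => pairSign σ = 1,
      sub_eq_add_neg, ← Finset.sum_neg_distrib]
    congr 1
    · refine Finset.sum_congr rfl fun σ hσ => ?_
      rw [(Finset.mem_filter.1 hσ).2]
      simp
    · refine Finset.sum_congr rfl fun σ hσ => ?_
      have : pairSign σ = -1 :=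
        (Int.isUnit_iff.1 (Units.isUnit _)).resolve_left (Finset.mem_filter.1 hσ).2
      rw [this]
      simp
  have h1 := cinner_detChar_self hα hβ hα0 hβ0 hn hne
  rw [heq] at h1 ⊢
  obtain ⟨U, _, _, _, π, hπ, -, h⟩ := exists_irreducible_of_virtual _ V W ρ ρ' le_rfl h1
  exact ⟨U, _, _, inferInstance, π, hπ, h⟩

/-! ### Reciprocity and truncated induction of the sign character -/

section Reciprocity

variable {G : Type} [Group G]

theorem cinner_indChar [Finite G] {H K : Subgroup G} (hle : H ≤ K) {χ : K → ℂ}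
    (hχ : ∀ x g, χ (x * g * x⁻¹) = χ g) (φ : H → ℂ) :
    cinner χ (indChar H K φ) = cinner (χ ∘ Subgroup.inclusion hle) φ := by
  classical
  have := Fintype.ofFinite G
  have := Fintype.ofFinite H
  have := Fintype.ofFinite K
  set ψ : K → ℂ := fun g => if h : (g : G) ∈ H then φ ⟨_, h⟩ else 0 with hψ
  have h1 : ∀ g, indChar H K φ g = (Nat.card H : ℂ)⁻¹ * ∑ x : K, ψ (x * g * x⁻¹) := by
    intro g
    rw [indChar, finsum_eq_sum_of_fintype]
    simp [hψ]
  have h2 : ∑ g : K, χ g * ψ g⁻¹ = ∑ h : H, χ (Subgroup.inclusion hle h) * φ h⁻¹ := by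
    rw [← Finset.sum_filter_of_ne (p := fun g : K => (g : G) ∈ H)]
    · refine (Finset.sum_bij (fun (h : H) _ => Subgroup.inclusion hle h) ?_ ?_ ?_ ?_).symm
      · intro h _
        simp
      · intro h _ h' _ heq
        exact Subgroup.inclusion_injective hle heq
      · intro g hg
        exact ⟨⟨g, (Finset.mem_filter.1 hg).2⟩, Finset.mem_univ _, rfl⟩
      · intro h _
        have : ((Subgroup.inclusion hle h)⁻¹ : K) = Subgroup.inclusion hle h⁻¹ := rfl
        rw [this, hψ]
        simp
        exact Or.inl rfl
    · intro g _ hg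
      by_contra hne
      refine hg ?_
      rw [hψ]
      simp [hne]
  rw [cinner_eq_sum, cinner_eq_sum]
  simp only [h1, Function.comp_apply, ← h2]
  have hK : (Nat.card K : ℂ) ≠ 0 := Nat.cast_ne_zero.2 Nat.card_pos.ne'
  have h3 : ∑ g : K, χ g * ((Nat.card H : ℂ)⁻¹ * ∑ x : K, ψ (x * g⁻¹ * x⁻¹)) =
      (Nat.card H : ℂ)⁻¹ * ((Nat.card K : ℂ) * ∑ g : K, χ g * ψ g⁻¹) := by
    have h4 : ∀ x : K, ∑ g : K, χ g * ψ (x * g⁻¹ * x⁻¹) = ∑ g : K, χ g * ψ g⁻¹ := fun x =>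
      Fintype.sum_equiv (MulAut.conj x).toEquiv _ _ fun g => by
        change _ = χ (x * g * x⁻¹) * ψ (x * g * x⁻¹)⁻¹
        rw [hχ]
        simp only [mul_inv_rev, inv_inv, mul_assoc]
    calc _ = (Nat.card H : ℂ)⁻¹ * ∑ x : K, ∑ g : K, χ g * ψ (x * g⁻¹ * x⁻¹) := by
          rw [Finset.sum_comm, Finset.mul_sum]
          refine Finset.sum_congr rfl fun g _ => ?_
          rw [← Finset.mul_sum]
          ring
      _ = _ := by
          simp only [h4, Finset.sum_const, Finset.card_univ, Nat.card_eq_fintype_card, nsmul_eq_mul]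
  rw [h3]
  field_simp

theorem cinner_comp_inclusion_ne_zero [Finite G] {H K : Subgroup G} (hle : H ≤ K) {U V : Type}
    [AddCommGroup U] [Module ℂ U] [FiniteDimensional ℂ U] [AddCommGroup V] [Module ℂ V]
    [FiniteDimensional ℂ V] {π : Representation ℂ K U} {ρ : Representation ℂ K V}
    (hπ : π.IsIrreducible) {χ : H →* ℂ}
    (hχ : cinner (π.character ∘ Subgroup.inclusion hle) χ ≠ 0)
    (hρ : cinner ρ.character π.character ≠ 0) :
    cinner (ρ.character ∘ Subgroup.inclusion hle) χ ≠ 0 := by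
  obtain ⟨f, hf⟩ := exists_intertwiningMap_ne_zero hρ
  have hinj : Function.Injective f := (hπ.injective_or_eq_zero f).resolve_right hf
  obtain ⟨v, hv0, hv⟩ := exists_semiinvariant
    (ρ := π.comp (Subgroup.inclusion hle)) (χ := χ) hχ
  refine cinner_ne_zero_of_semiinvariant (ρ := ρ.comp (Subgroup.inclusion hle)) (v := f v)
    (fun h => hv0 (hinj (h.trans (map_zero f).symm))) fun g => ?_
  have h1 := f.isIntertwining _ _ (Subgroup.inclusion hle g) v
  change ρ (Subgroup.inclusion hle g) (f v) = _
  rw [← h1, ← map_smul, ← hv g]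
  rfl

end Reciprocity

variable {n : ℕ} {r : ℕ}

theorem sum_mul_perm_le (σ : Perm (Fin r)) :
    ∑ i : Fin r, ((i : ℕ) : ℤ) * (σ i : ℕ) ≤ ∑ i : Fin r, ((i : ℕ) : ℤ) * (i : ℕ) ∧
      (σ ≠ 1 → ∑ i : Fin r, ((i : ℕ) : ℤ) * (σ i : ℕ) < ∑ i : Fin r, ((i : ℕ) : ℤ) * (i : ℕ)) := by
  have h1 := Equiv.sum_comp σ fun i : Fin r => ((i : ℕ) : ℤ) * (i : ℕ)
  have h2 : ∑ i : Fin r, (((i : ℕ) : ℤ) - (σ i : ℕ)) ^ 2 =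
      2 * ∑ i : Fin r, ((i : ℕ) : ℤ) * (i : ℕ) - 2 * ∑ i : Fin r, ((i : ℕ) : ℤ) * (σ i : ℕ) := by
    have : 2 * ∑ i : Fin r, ((i : ℕ) : ℤ) * (i : ℕ) = ∑ i : Fin r, ((i : ℕ) : ℤ) * (i : ℕ) +
        ∑ i : Fin r, ((σ i : ℕ) : ℤ) * (σ i : ℕ) := by rw [h1]; ring
    rw [this, Finset.mul_sum, ← Finset.sum_add_distrib, ← Finset.sum_sub_distrib]
    exact Finset.sum_congr rfl fun i _ => by ring
  refine ⟨?_, fun hne => ?_⟩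
  · have h3 := Finset.sum_nonneg fun (i : Fin r) (_ : i ∈ Finset.univ) =>
      sq_nonneg (((i : ℕ) : ℤ) - (σ i : ℕ))
    linarith
  · obtain ⟨i, hi⟩ : ∃ i, σ i ≠ i := by
      by_contra! h
      exact hne (Equiv.ext h)
    have h3 : 0 < ∑ i : Fin r, (((i : ℕ) : ℤ) - (σ i : ℕ)) ^ 2 := by
      refine Finset.sum_pos' (fun i _ => sq_nonneg _) ⟨i, Finset.mem_univ i, ?_⟩
      refine sq_pos_of_ne_zero fun h => hi (Fin.ext ?_)
      omega
    linarith

theorem sum_of_mem_contentSet {c d : Fin r → ℤ} {h : Fin n → ℕ} (hh : h ∈ contentSet n c d) :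
    ((∑ i, h i : ℕ) : ℤ) = 2 * ∑ i : Fin r, ((i : ℕ) : ℤ) * c i +
      (2 * ∑ i : Fin r, ((i : ℕ) : ℤ) * d i + ∑ i, d i) := by
  obtain ⟨hr, hc⟩ := mem_contentSet.1 hh
  push_cast
  have h1 := sum_content hr fun x : ℕ => (x : ℤ)
  rw [h1, Finset.mul_sum, Finset.mul_sum, ← Finset.sum_add_distrib, ← Finset.sum_add_distrib]
  refine Finset.sum_congr rfl fun i _ => ?_
  rw [nsmul_eq_mul, nsmul_eq_mul, (hc i).1, (hc i).2]
  push_cast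
  ring

theorem sum_lt_of_mem_contentSet_shift {α β : Fin r → ℤ} {σ : Perm (Fin r) × Perm (Fin r)}
    (hσ : σ ≠ 1) {h h' : Fin n → ℕ} (hh : h ∈ contentSet n (shift α σ.1) (shift β σ.2))
    (hh' : h' ∈ contentSet n α β) : ∑ i, h i < ∑ i, h' i := by
  have h1 := sum_of_mem_contentSet hh
  have h2 := sum_of_mem_contentSet hh'
  have h3 : ∀ (γ : Fin r → ℤ) (ρ : Perm (Fin r)), ∑ i : Fin r, ((i : ℕ) : ℤ) * shift γ ρ i =
      ∑ i : Fin r, ((i : ℕ) : ℤ) * γ i - ∑ i : Fin r, ((i : ℕ) : ℤ) * (i : ℕ) +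
        ∑ i : Fin r, ((i : ℕ) : ℤ) * (ρ i : ℕ) := fun γ ρ => by
    rw [← Finset.sum_sub_distrib, ← Finset.sum_add_distrib]
    exact Finset.sum_congr rfl fun i _ => by rw [shift]; ring
  rw [h3, h3, sum_shift] at h1
  obtain ⟨h4, h5⟩ := sum_mul_perm_le σ.1
  obtain ⟨h6, h7⟩ := sum_mul_perm_le σ.2
  by_cases hσ1 : σ.1 = 1
  · have hσ2 : σ.2 ≠ 1 := fun h => hσ (Prod.ext hσ1 h)
    have := h7 hσ2
    omega
  · have := h5 hσ1
    omega

theorem sum_eq_of_mem_contentSet {c d : Fin r → ℤ} {h h' : Fin n → ℕ}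
    (hh : h ∈ contentSet n c d) (hh' : h' ∈ contentSet n c d) : ∑ i, h i = ∑ i, h' i := by
  have h1 := sum_of_mem_contentSet hh
  have h2 := sum_of_mem_contentSet hh'
  omega

theorem monoChar_eq_add {Y Z : Finset (Fin n → ℕ)} (hYZ : Y ⊆ Z) :
    monoChar Z = monoChar Y + monoChar (Z \ Y) := by
  ext π
  simp only [monoChar, Pi.add_apply, Finset.sum_filter]
  rw [add_comm, Finset.sum_sdiff hYZ]

theorem IsSymmSet.sdiff {Y Z : Finset (Fin n → ℕ)} (hZ : IsSymmSet Z) (hY : IsSymmSet Y) :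
    IsSymmSet (Z \ Y) := by
  intro h hh σ
  rw [Finset.mem_sdiff] at hh ⊢
  refine ⟨hZ h hh.1 σ, fun h1 => hh.2 ?_⟩
  have h2 := hY _ h1 σ⁻¹
  convert h2 using 1
  ext i
  simp

theorem resChar_symChar_reflChar {K : Subgroup (PG n)} (hK : K ≤ signedPerm n) (d : ℕ) :
    symChar (resChar K reflChar) d =
      resChar K (monoChar (Finset.piAntidiag Finset.univ d)) := by
  ext g
  rw [symChar_resChar, symChar_reflChar d (hK g.2)]
  rfl

variable {N : ℕ} {c : ℕ → ℕ} {g : ℕ → BTy}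

theorem isBAt_sgnChar (hn : ∑ b ∈ Finset.range N, c b = n) (hB : ∀ b, g b ≠ BTy.B) :
    IsBAt (resChar (blkGroup n N c g) reflChar) (resChar _ sgnChar) (minDegree N c g) ∧
      bMult (resChar (blkGroup n N c g) reflChar) (resChar _ sgnChar) (minDegree N c g) = 1 := by
  have h1 : bMult (resChar (blkGroup n N c g) reflChar) (resChar _ sgnChar)
      (minDegree N c g) = 1 := by
    rw [bMult, resChar_symChar_reflChar (blkSub_le_signedPerm _ _), cinner_comm]
    refine cinner_monoChar_sgn_eq_one hn hB (isSymmSet_piAntidiag _) ?_ fun h hh => ?_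
    · rw [Finset.mem_piAntidiag]
      exact ⟨sum_minExponent hn, fun _ _ => Finset.mem_univ _⟩
    · exact (Finset.mem_piAntidiag.1 hh).1
  refine ⟨⟨by rw [h1]; exact one_ne_zero, fun d hd => ?_⟩, h1⟩
  rw [bMult, resChar_symChar_reflChar (blkSub_le_signedPerm _ _), cinner_comm]
  refine cinner_monoChar_sgn_eq_zero hn (isSymmSet_piAntidiag _) fun h hh => ?_
  rwa [(Finset.mem_piAntidiag.1 hh).1]

theorem cinner_detPiece_sgn {α β : Fin r → ℤ} (hn : ∑ b ∈ Finset.range N, c b = n)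
    (hB : ∀ b, g b ≠ BTy.B) (hmem : minExponent n N c g ∈ contentSet n α β)
    (hle : blkGroup n N c g ≤ DWn n) (σ : Perm (Fin r) × Perm (Fin r)) :
    cinner (detPiece n α β σ ∘ Subgroup.inclusion hle) (resChar _ sgnChar) =
      if σ = 1 then 1 else 0 := by
  change cinner (resChar (blkGroup n N c g)
    (monoChar (contentSet n (shift α σ.1) (shift β σ.2)))) (resChar _ sgnChar) = _
  split_ifs with hσ
  · rw [hσ, Prod.fst_one, Prod.snd_one, shift_one, shift_one]
    refine cinner_monoChar_sgn_eq_one hn hB (isSymmSet_contentSet _ _) hmem fun h hh => ?_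
    rw [sum_eq_of_mem_contentSet hh hmem, sum_minExponent hn]
  · refine cinner_monoChar_sgn_eq_zero hn (isSymmSet_contentSet _ _) fun h hh => ?_
    rw [← sum_minExponent hn]
    exact sum_lt_of_mem_contentSet_shift hσ hh hmem

theorem isJInd_detChar {α β : Fin r → ℤ} (hα : Antitone α) (hβ : Antitone β)
    (hα0 : ∀ i, 0 ≤ α i) (hβ0 : ∀ i, 0 ≤ β i) (hαβ : ∑ i, α i + ∑ i, β i = n)
    (hne : ∑ i, α i ≠ ∑ i, β i) (hn : ∑ b ∈ Finset.range N, c b = n)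
    (hB : ∀ b, g b ≠ BTy.B) (hmem : minExponent n N c g ∈ contentSet n α β) :
    IsJInd (reflChar (n := n)) (blkGroup n N c g) (DWn n) (resChar _ sgnChar)
      (detChar n α β) := by
  have hK : blkGroup n N c g ≤ signedPerm n := blkSub_le_signedPerm _ _
  have hle : blkGroup n N c g ≤ DWn n := blkSub_le_DWn fun i => hB _
  have hself := cinner_detChar_self hα hβ hα0 hβ0 hαβ hne
  have hsgn : cinner (detChar n α β ∘ Subgroup.inclusion hle) (resChar _ sgnChar) = 1 := by
    have h1 : detChar n α β ∘ Subgroup.inclusion hle = ∑ σ : Perm (Fin r) × Perm (Fin r),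
        (pairSign σ : ℂ) • (detPiece n α β σ ∘ Subgroup.inclusion hle) := by
      ext x
      simp [detChar, Finset.sum_apply]
    rw [h1, cinner_sum_left]
    simp only [cinner_smul_left, cinner_detPiece_sgn hn hB hmem hle]
    simp [pairSign]
  obtain ⟨U, _, _, _, π, hπ, h | h⟩ := exists_irreducible_detChar hα hβ hα0 hβ0 hαβ hne
  swap
  · obtain ⟨m, hm⟩ := cinner_character_nat (π.comp (Subgroup.inclusion hle)) (sgnHom hK)
    have h1 : detChar n α β ∘ Subgroup.inclusion hle =
        -(Representation.character (π.comp (Subgroup.inclusion hle))) := by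
      rw [h]
      rfl
    rw [h1, cinner_neg_left, ← sgnHom_coe hK, hm] at hsgn
    have h2 : ((m + 1 : ℕ) : ℂ) = 0 := by
      push_cast
      linear_combination -hsgn
    exact absurd (Nat.cast_eq_zero.1 h2) (Nat.succ_ne_zero m)
  have hπsgn : cinner (π.character ∘ Subgroup.inclusion hle) (sgnHom hK) ≠ 0 := by
    rw [← h, sgnHom_coe, hsgn]
    exact one_ne_zero
  have hvanish : ∀ {Y : Finset (Fin n → ℕ)}, IsSymmSet Y →
      cinner (resChar (blkGroup n N c g) (monoChar Y)) (resChar _ sgnChar) = 0 →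
      cinner (resChar (DWn n) (monoChar Y)) (detChar n α β) = 0 := by
    intro Y hY h0
    by_contra hne
    rw [h, ← monoRep_character DWn_le_signedPerm hY] at hne
    refine cinner_comp_inclusion_ne_zero hle hπ hπsgn hne ?_
    rw [monoRep_character]
    exact h0
  have hone : cinner (detPiece n α β 1) (detChar n α β) = 1 := by
    rw [cinner_detChar_left, Finset.sum_eq_single 1] at hself
    · rw [← hself]
      simp [pairSign]
    · intro σ _ hσ
      rw [detPiece, hvanish (isSymmSet_contentSet _ _), mul_zero]
      have h1 := cinner_detPiece_sgn hn hB hmem hle σ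
      rw [if_neg hσ] at h1
      exact h1
    · simp
  obtain ⟨hb, hb1⟩ := isBAt_sgnChar hn hB
  refine ⟨⟨⟨U, _, _, π, inferInstance, fun x => congrFun h x⟩, hself⟩, ?_, minDegree N c g, hb,
    hb1, ?_, fun d hd => ?_⟩
  · rw [cinner_indChar hle (fun x y => ?_), hsgn]
    · exact one_ne_zero
    · rw [h, Representation.char_conj]
  · have hsub : contentSet n α β ⊆ Finset.piAntidiag Finset.univ (minDegree N c g) := by
      intro y hy
      rw [Finset.mem_piAntidiag]
      exact ⟨by rw [sum_eq_of_mem_contentSet hy hmem, sum_minExponent hn],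
        fun _ _ => Finset.mem_univ _⟩
    have hrest := (isSymmSet_piAntidiag (n := n) (minDegree N c g)).sdiff
      (isSymmSet_contentSet α β)
    rw [bMult, resChar_symChar_reflChar DWn_le_signedPerm, cinner_comm, monoChar_eq_add hsub]
    change cinner (resChar (DWn n) (monoChar (contentSet n α β)) +
      resChar (DWn n) (monoChar _)) _ ≠ 0
    have h1 : resChar (DWn n) (monoChar (contentSet n α β)) = detPiece n α β 1 := by
      rw [detPiece, Prod.fst_one, Prod.snd_one, shift_one, shift_one]
    rw [cinner_add_left, h1, hone, h, ← monoRep_character DWn_le_signedPerm hrest,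
      cinner_character]
    norm_cast
    omega
  · rw [bMult, resChar_symChar_reflChar DWn_le_signedPerm, cinner_comm]
    refine hvanish (isSymmSet_piAntidiag _) (cinner_monoChar_sgn_eq_zero hn
      (isSymmSet_piAntidiag _) fun y hy => ?_)
    rwa [(Finset.mem_piAntidiag.1 hy).1]

/-! ### The partition combinatorics of the symbol -/

section Partition

theorem sum_univ_two_mul {M : Type*} [AddCommMonoid M] (f : ℕ → M) (m : ℕ) :
    ∑ i : Fin m, (f (2 * i) + f (2 * i + 1)) = ∑ t ∈ Finset.range (2 * m), f t := by
  rw [Fin.sum_univ_eq_sum_range fun i => f (2 * i) + f (2 * i + 1)]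
  induction m with
  | zero => simp
  | succ m ih => rw [Finset.sum_range_succ, ih, Nat.mul_succ, Finset.sum_range_succ,
      Finset.sum_range_succ, add_assoc]

/-- The size of the block `b`: the columns of the partition, longest last, with the longest
column cut into two halves. -/
def blockSize (k m : ℕ) (q : ℕ → ℕ) (b : ℕ) : ℕ := if b + 2 ≤ k then q (k - b) else m

/-- The type of the block `b`: all blocks but the last two are symmetric groups. -/
def blockType (k b : ℕ) : BTy := if b + 2 ≤ k then BTy.S else BTy.D

theorem sum_blocks {M : Type*} [AddCommMonoid M] (k m : ℕ) (q : ℕ → ℕ) (F : ℕ → BTy → M) :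
    ∑ b ∈ Finset.range (k + 2), F (blockSize (k + 1) m q b) (blockType (k + 1) b) =
      ∑ j ∈ Finset.range k, F (q (j + 2)) BTy.S + (F m BTy.D + F m BTy.D) := by
  rw [Finset.sum_range_succ, Finset.sum_range_succ, add_assoc,
    ← Finset.sum_range_reflect (fun j => F (q (j + 2)) BTy.S)]
  congr 1
  · refine Finset.sum_congr rfl fun b hb => ?_
    have hb' := Finset.mem_range.1 hb
    rw [blockSize, blockType, if_pos (by omega), if_pos (by omega)]
    congr 2
    omega
  · simp [blockSize, blockType]

variable {m k : ℕ} {P q : ℕ → ℕ}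

theorem lt_column_iff (hP : Antitone P) (hP0 : ∀ t, 2 * m ≤ t → P t = 0)
    (hq : ∀ v, q v = #{t ∈ Finset.range (2 * m) | v ≤ P t}) {v : ℕ} (hv : 1 ≤ v) (t : ℕ) :
    t < q v ↔ v ≤ P t := by
  rw [hq]
  constructor
  · intro h
    by_contra hlt
    have hsub : {t ∈ Finset.range (2 * m) | v ≤ P t} ⊆ Finset.range t := by
      intro s hs
      rw [Finset.mem_range]
      by_contra hts
      have h1 := hP (not_lt.1 hts)
      have h2 := (Finset.mem_filter.1 hs).2
      omega
    have := Finset.card_le_card hsub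
    rw [Finset.card_range] at this
    omega
  · intro h
    have hsub : Finset.range (t + 1) ⊆ {t ∈ Finset.range (2 * m) | v ≤ P t} := by
      intro s hs
      have h1 : P t ≤ P s := hP (Nat.lt_succ_iff.1 (Finset.mem_range.1 hs))
      rw [Finset.mem_filter, Finset.mem_range]
      refine ⟨?_, by omega⟩
      by_contra hms
      have := hP0 s (not_lt.1 hms)
      omega
    have := Finset.card_le_card hsub
    rw [Finset.card_range] at this
    omega

theorem card_range_filter_add_lt (k j x : ℕ) :
    #{i ∈ Finset.range k | i + j < x} = min k (x - j) := by
  have : {i ∈ Finset.range k | i + j < x} = Finset.range (min k (x - j)) := by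
    ext i
    rw [Finset.mem_filter, Finset.mem_range, Finset.mem_range]
    omega
  rw [this, Finset.card_range]

theorem sum_blockSize (hq1 : q 1 = 2 * m) (hP0 : P 0 = k + 1) (hP : Antitone P)
    (hq : ∀ v, q v = #{t ∈ Finset.range (2 * m) | v ≤ P t}) :
    ∑ b ∈ Finset.range (k + 2), blockSize (k + 1) m q b = ∑ t ∈ Finset.range (2 * m), P t := by
  have h1 : ∑ t ∈ Finset.range (2 * m), P t = ∑ v ∈ Finset.range (k + 1), q (v + 1) := by
    simp only [hq, Finset.card_filter]
    rw [Finset.sum_comm]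
    refine Finset.sum_congr rfl fun t _ => ?_
    have h2 := card_range_filter_add_lt (k + 1) 0 (P t)
    have h3 := hP (Nat.zero_le t)
    rw [Finset.card_filter, min_eq_right (by omega)] at h2
    exact h2.symm
  rw [h1, Finset.sum_range_succ' (fun v => q (v + 1)), zero_add, hq1, two_mul]
  exact sum_blocks k m q fun s _ => s

theorem minExponent_mem_contentSet {n : ℕ} (hPm : ∀ t, P t = 0 ↔ 2 * m ≤ t)
    (hP0 : P 0 = k + 1) (hP : Antitone P)
    (hq : ∀ v, q v = #{t ∈ Finset.range (2 * m) | v ≤ P t})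
    (hn : ∑ b ∈ Finset.range (k + 2), blockSize (k + 1) m q b = n) :
    minExponent n (k + 2) (blockSize (k + 1) m q) (blockType (k + 1)) ∈
      contentSet n (fun i : Fin m => (P (2 * i) : ℤ) + 1)
        (fun i : Fin m => (P (2 * i + 1) : ℤ) - 1) := by
  have hcard : ∀ t, #{i | minExponent n (k + 2) (blockSize (k + 1) m q) (blockType (k + 1)) i = t}
      = (P t - 1) + 2 * #{j ∈ Finset.range m | 2 * j = t} := by
    intro t
    rw [card_minExponent hn,
      sum_blocks k m q fun s ty => #{j ∈ Finset.range s | stepOf ty * j = t}, two_mul]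
    congr 1
    have h1 := card_range_filter_add_lt k 1 (P t)
    have h2 := hP (Nat.zero_le t)
    rw [min_eq_right (by omega)] at h1
    rw [← h1, Finset.card_filter]
    refine Finset.sum_congr rfl fun j _ => ?_
    have h3 := lt_column_iff hP (fun t => (hPm t).2) hq (v := j + 2) (by omega) t
    simp only [stepOf, one_mul, Finset.filter_eq', Finset.mem_range]
    split_ifs <;> first | rfl | omega
  have heven : ∀ i, #{j ∈ Finset.range m | 2 * j = 2 * i} = if i < m then 1 else 0 := by
    intro i
    simp only [Nat.mul_right_inj two_ne_zero, Finset.filter_eq', Finset.mem_range]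
    split_ifs <;> rfl
  have hodd : ∀ i, #{j ∈ Finset.range m | 2 * j = 2 * i + 1} = 0 := by
    intro i
    rw [Finset.card_eq_zero, Finset.filter_eq_empty_iff]
    intro j _
    omega
  rw [mem_contentSet]
  refine ⟨fun x => ?_, fun i => ⟨?_, ?_⟩⟩
  · set t := minExponent n (k + 2) (blockSize (k + 1) m q) (blockType (k + 1)) x with ht
    by_contra hlt
    have h1 := hcard t
    have h2 := (hPm t).2 (not_lt.1 hlt)
    have h3 : {j ∈ Finset.range m | 2 * j = t} = ∅ := by
      rw [Finset.filter_eq_empty_iff]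
      intro j hj
      have := Finset.mem_range.1 hj
      omega
    rw [h2, h3, Finset.card_empty, Finset.card_eq_zero, Finset.filter_eq_empty_iff] at h1
    exact h1 (Finset.mem_univ x) ht.symm
  · have h1 := (hPm (2 * i)).not.2 (by omega)
    rw [hcard, heven, if_pos i.2]
    omega
  · have h1 := (hPm (2 * i + 1)).not.2 (by omega)
    rw [hcard, hodd]
    omega

end Partition

theorem chiDSymbol_eq {n m : ℕ} {row1 row2 : Fin m → ℕ} {α β : Fin m → ℤ}
    (hα : ∀ i : Fin m, (row1 ⟨m - 1 - (i : ℕ), by omega⟩ : ℤ) - ((m - 1 - (i : ℕ) : ℕ) : ℤ) = α i)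
    (hβ : ∀ i : Fin m, (row2 ⟨m - 1 - (i : ℕ), by omega⟩ : ℤ) - ((m - 1 - (i : ℕ) : ℕ) : ℤ) = β i) :
    chiDSymbol n m row1 row2 = detChar n α β := by
  ext w
  rw [chiDSymbol, funext hα, funext hβ, resSub, dif_pos (DWn_le_BWn w.2), chiB_eq_sum, detChar,
    Finset.sum_apply]
  refine Finset.sum_congr rfl fun σ _ => ?_
  rw [zsmul_eq_mul]
  rfl

/-- 3.2(i): let `p₁ ≥ … ≥ p_σ ≥ 1` with `σ = 2τ` even,
`∑ pₜ = n`, conjugate partition `p̄`, `k = p₁` (so that `p̄₁ = σ` is even).  Then in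
the Weyl group `W'_n` of type `D_n`,
`j_{S_{p̄ₖ} × … × S_{p̄₂} × W'_{p̄₁/2} × W'_{p̄₁/2}}^{W'_n}(sgn)` equals the
irreducible representation with symbol
`[(p_{σ-1}+1 < p_{σ-3}+2 < … < p₁+τ), (p_σ-1 < p_{σ-2} < … < p₂+τ-2)]`.
(Here `p` is 0-indexed: the paper's `pₜ` is `p (t-1)`.) -/
theorem stmt14 (σ τ n kk : ℕ) (hσ : 0 < σ) (hστ : σ = 2 * τ) (p : Fin σ → ℕ)
    (hmono : Antitone p) (hp1 : ∀ t, 1 ≤ p t) (hsum : ∑ t, p t = n)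
    (hkk : kk = p ⟨0, hσ⟩)
    (pbar : ℕ → ℕ)
    (hpbar : ∀ i, pbar i = (Finset.univ.filter (fun t : Fin σ => i ≤ p t)).card)
    (hpbar1 : pbar 1 = σ) :
    IsJInd (reflChar (n := n))
      (blkSub n
        (fun i => blockOf (kk + 1)
          (fun b => if b + 2 ≤ kk then pbar (kk - b) else τ) (i : ℕ))
        (fun i => if blockOf (kk + 1)
            (fun b => if b + 2 ≤ kk then pbar (kk - b) else τ) (i : ℕ) + 2 ≤ kk
          then BTy.S else BTy.D))
      (DWn n) (resChar _ sgnChar)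
      (chiDSymbol n τ
        (fun u => p ⟨σ - 2 - 2 * (u : ℕ), by omega⟩ + (u : ℕ) + 1)
        (fun u => p ⟨σ - 1 - 2 * (u : ℕ), by omega⟩ + (u : ℕ) - 1)) := by
  subst hστ
  set P : ℕ → ℕ := fun t => if h : t < 2 * τ then p ⟨t, h⟩ else 0 with hPdef
  have hPp : ∀ t (h : t < 2 * τ), p ⟨t, h⟩ = P t := fun t h => by simp only [hPdef, dif_pos h]
  have hPm : ∀ t, P t = 0 ↔ 2 * τ ≤ t := by
    intro t
    by_cases h : t < 2 * τ
    · have := hp1 ⟨t, h⟩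
      rw [hPp] at this
      omega
    · simp [hPdef, h, not_lt.1 h]
  have hP : Antitone P := by
    intro s t hst
    by_cases h : t < 2 * τ
    · rw [← hPp t h, ← hPp s (by omega)]
      exact hmono hst
    · rw [(hPm t).2 (not_lt.1 h)]
      exact Nat.zero_le _
  have hsumP : ∑ t ∈ Finset.range (2 * τ), P t = n := by
    rw [← Fin.sum_univ_eq_sum_range, ← hsum]
    exact Finset.sum_congr rfl fun t _ => (hPp t t.2).symm
  have hq : ∀ v, pbar v = #{t ∈ Finset.range (2 * τ) | v ≤ P t} := by
    intro v
    rw [hpbar, Finset.card_filter, Finset.card_filter,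
      ← Fin.sum_univ_eq_sum_range fun t => if v ≤ P t then 1 else 0]
    exact Finset.sum_congr rfl fun t _ => by rw [← hPp t t.2]
  obtain ⟨k, rfl⟩ : ∃ k, kk = k + 1 := ⟨kk - 1, by have := hp1 ⟨0, hσ⟩; omega⟩
  have hP0 : P 0 = k + 1 := by rw [hkk, hPp]
  have hn : ∑ b ∈ Finset.range (k + 2), blockSize (k + 1) τ pbar b = n :=
    (sum_blockSize hpbar1 hP0 hP hq).trans hsumP
  have hpos : ∀ t, t < 2 * τ → 1 ≤ P t := fun t ht =>
    Nat.one_le_iff_ne_zero.2 ((hPm t).not.2 (by omega))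
  rw [chiDSymbol_eq (α := fun i : Fin τ => (P (2 * i) : ℤ) + 1)
    (β := fun i : Fin τ => (P (2 * i + 1) : ℤ) - 1)]
  · refine isJInd_detChar (g := blockType (k + 1)) (c := blockSize (k + 1) τ pbar) (N := k + 2)
      ?_ ?_ ?_ ?_ ?_ ?_ hn ?_ (minExponent_mem_contentSet hPm hP0 hP hq hn)
    · intro i j hij
      have : P (2 * j) ≤ P (2 * i) := hP (Nat.mul_le_mul_left 2 hij)
      dsimp only
      omega
    · intro i j hij
      have : P (2 * j + 1) ≤ P (2 * i + 1) := hP (Nat.succ_le_succ (Nat.mul_le_mul_left 2 hij))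
      dsimp only
      omega
    · intro i
      positivity
    · intro i
      have := hpos (2 * i + 1) (by omega)
      omega
    · rw [← hsumP, ← sum_univ_two_mul, ← Finset.sum_add_distrib]
      push_cast
      exact Finset.sum_congr rfl fun i _ => by ring
    · refine (Finset.sum_lt_sum_of_nonempty ?_ fun i _ => ?_).ne'
      · exact ⟨⟨0, by omega⟩, Finset.mem_univ _⟩
      · have : P (2 * i + 1) ≤ P (2 * i) := hP (Nat.le_succ _)
        omega
    · intro b
      rw [blockType]
      split_ifs <;> simp
  · intro i
    have h1 : 2 * τ - 2 - 2 * (τ - 1 - (i : ℕ)) = 2 * i := by omega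
    simp only [hPp, h1]
    push_cast
    ring
  · intro i
    have h1 : 2 * τ - 1 - 2 * (τ - 1 - (i : ℕ)) = 2 * i + 1 := by omega
    have h2 := hpos (2 * i + 1) (by omega)
    simp only [hPp, h1]
    omega

end

end CS
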